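/- arXiv:1906.01289 — 8 statements merged into one kernel-verified Lean document; each statement's English description precedes it below -/
import Mathlib

section
/- Let d ≥ 1, m > 1, m* = m/(m−1), and suppose (b,V) satisfies hypothesis (H1) with parameters δ > 0, ρ > 0, a ∈ ℝ, η > 0, R > 0. Then liminf_{β→∞} β^{−δm*/(δm*+η)} λ_max(β) ≥ c₀, where c₀ := ((δm*+η)/(δm*)) · (ρ^{m*} δ/η)^{η/(δm*+η)}. -/
open Filter Real RealInnerProductSpace

noncomputable section

abbrev Euc (d : ℕ) := EuclideanSpace ℝ (Fin d)

/-- The Laplacian of `φ`, defined as the sum of the second partial derivatives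
in the coordinate directions. -/
def lap {d : ℕ} (φ : Euc d → ℝ) (x : Euc d) : ℝ :=
  ∑ i : Fin d, fderiv ℝ (fun y => fderiv ℝ φ y (EuclideanSpace.single i 1)) x
    (EuclideanSpace.single i 1)

/-- `(lam, φ)` is a subsolution of the ergodic problem (EP). -/
def IsSubsol {d : ℕ} (m : ℝ) (b : Euc d → Euc d) (V : Euc d → ℝ) (β lam : ℝ)
    (φ : Euc d → ℝ) : Prop :=
  ContDiff ℝ 3 φ ∧ ∀ x : Euc d,
    lam - lap φ x + ⟪b x, gradient φ x⟫ + (1 / m) * ‖gradient φ x‖ ^ m - β * V x ≤ 0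

/-- The generalized principal eigenvalue `λ_max(β)`. -/
def lamMax {d : ℕ} (m : ℝ) (b : Euc d → Euc d) (V : Euc d → ℝ) (β : ℝ) : ℝ :=
  sSup {lam : ℝ | ∃ φ : Euc d → ℝ, IsSubsol m b V β lam φ}

/-- Hypothesis (H0) with parameter `δ` and constants `ρ, R` and auxiliary function `α`. -/
def HypH0 {d : ℕ} (δ ρ R : ℝ) (b : Euc d → Euc d) (V : Euc d → ℝ) (α : Euc d → ℝ) : Prop :=
  ContDiff ℝ 2 b ∧ ContDiff ℝ 2 V ∧ (∃ M : ℝ, ∀ x : Euc d, ‖gradient V x‖ ≤ M) ∧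
  ContDiff ℝ 2 α ∧
  (∀ x : Euc d, R ≤ ‖x‖ → b x = ((ρ + α x) * ‖x‖ ^ (δ - 1)) • x) ∧
  Tendsto α (cocompact (Euc d)) (nhds 0) ∧
  (∀ x : Euc d, 0 ≤ V x) ∧
  Metric.closedBall (0 : Euc d) R ⊆ interior (Function.support V) ∧
  Tendsto V (cocompact (Euc d)) (nhds 0)

/-- Hypothesis (H1): (H0) together with `α(x) = a|x|⁻¹` and `V(x) = |x|^{-η}` outside `B_R`. -/
def HypH1 {d : ℕ} (δ ρ R a η : ℝ) (b : Euc d → Euc d) (V : Euc d → ℝ) (α : Euc d → ℝ) : Prop :=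
  HypH0 δ ρ R b V α ∧
  ∀ x : Euc d, R ≤ ‖x‖ → α x = a * ‖x‖⁻¹ ∧ V x = ‖x‖ ^ (-η)


theorem one_d (g g1 : ℝ → ℝ) (g2 : ℝ) (hmax : IsLocalMax g 0)
    (h1 : ∀ᶠ t in nhds (0:ℝ), HasDerivAt g (g1 t) t) (h2 : HasDerivAt g1 g2 0) : g2 ≤ 0 := by
  by_contra hpos
  push Not at hpos
  have e1 : deriv g =ᶠ[nhds 0] g1 := h1.mono fun t ht => ht.deriv
  have hd2 : deriv (deriv g) 0 = g2 := by rw [e1.deriv_eq]; exact h2.deriv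
  have hmin : IsLocalMin g 0 := isLocalMin_of_deriv_deriv_pos (by rw [hd2]; exact hpos)
    hmax.deriv_eq_zero h1.self_of_nhds.continuousAt
  have hc : g =ᶠ[nhds 0] fun _ => g 0 := by
    filter_upwards [hmax, hmin] with t a b using le_antisymm a b
  have : deriv g =ᶠ[nhds 0] fun _ => 0 := by
    have := hc.deriv
    filter_upwards [this] with t ht
    rw [ht]; simp
  have h3 : deriv (deriv g) 0 = 0 := by rw [this.deriv_eq]; simp
  linarith

theorem max_principle {d : ℕ} (φ w : Euc d → ℝ) (x : Euc d) (hφ : ContDiffAt ℝ 2 φ x)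
    (hw : ContDiffAt ℝ 2 w x) (hmax : IsLocalMax (fun y => φ y - w y) x) :
    fderiv ℝ φ x = fderiv ℝ w x ∧ lap φ x ≤ lap w x := by
  constructor
  · have := hmax.fderiv_eq_zero
    rw [fderiv_fun_sub (hφ.differentiableAt (by norm_num)) (hw.differentiableAt (by norm_num))] at this
    exact sub_eq_zero.mp this
  · unfold lap
    apply Finset.sum_le_sum
    intro i _
    set e : Euc d := EuclideanSpace.single i 1
    have key : ∀ ψ : Euc d → ℝ, ContDiffAt ℝ 2 ψ x →
        (∀ᶠ t in nhds (0:ℝ), HasDerivAt (fun t : ℝ => ψ (x + t • e)) (fderiv ℝ ψ (x + t • e) e) t) ∧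
        HasDerivAt (fun t : ℝ => fderiv ℝ ψ (x + t • e) e)
          (fderiv ℝ (fun y => fderiv ℝ ψ y e) x e) 0 := by
      intro ψ hψ
      have hl : ∀ t : ℝ, HasDerivAt (fun t : ℝ => x + t • e) e t := by
        intro t
        simpa using ((hasDerivAt_id t).smul_const e).const_add x
      have hc : Tendsto (fun t : ℝ => x + t • e) (nhds 0) (nhds x) := by
        have := (hl 0).continuousAt.tendsto
        simpa using this
      constructor
      · have h1 : ∀ᶠ y in nhds x, DifferentiableAt ℝ ψ y := by
          filter_upwards [hψ.eventually (by norm_num)] with y hy using hy.differentiableAt (by norm_num)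
        filter_upwards [hc.eventually h1] with t ht
        exact ht.hasFDerivAt.comp_hasDerivAt t (hl t)
      · have h2 : DifferentiableAt ℝ (fun y => fderiv ℝ ψ y e) x := by
          have : DifferentiableAt ℝ (fderiv ℝ ψ) x :=
            (hψ.fderiv_right (m := 1) (by norm_num)).differentiableAt (by norm_num)
          exact this.clm_apply (differentiableAt_const _)
        have h3 : HasFDerivAt (fun y => fderiv ℝ ψ y e) (fderiv ℝ (fun y => fderiv ℝ ψ y e) x) (x + (0:ℝ) • e) := by
          simpa using h2.hasFDerivAt
        exact h3.comp_hasDerivAt 0 (hl 0)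
    obtain ⟨a1, a2⟩ := key φ hφ
    obtain ⟨b1, b2⟩ := key w hw
    have := one_d (fun t => φ (x + t • e) - w (x + t • e)) _ _ ?_ 
      (by filter_upwards [a1, b1] with t p q using p.sub q) (a2.sub b2)
    · linarith
    · have hc : Tendsto (fun t : ℝ => x + t • e) (nhds 0) (nhds x) := by
        have : ContinuousAt (fun t : ℝ => x + t • e) 0 := by fun_prop
        simpa using this.tendsto
      have := hc.eventually hmax
      simpa [IsLocalMax, IsMaxFilter] using this

theorem radial_fderiv {d : ℕ} (h : ℝ → ℝ) (h1 : ℝ) (x0 x : Euc d)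
    (H : HasDerivAt h h1 (‖x - x0‖ ^ 2)) :
    HasFDerivAt (fun y => h (‖y - x0‖ ^ 2)) ((2 * h1) • innerSL ℝ (x - x0)) x := by
  have h2 : HasFDerivAt (fun y : Euc d => ‖y - x0‖ ^ 2) (2 • (innerSL ℝ (x - x0))) x := by
    have := ((hasFDerivAt_id x).sub_const x0).norm_sq
    simpa using this
  refine (H.comp_hasFDerivAt x h2).congr_fderiv ?_
  refine ContinuousLinearMap.ext fun v => ?_
  simp [-inner_sub_left, -innerSL_apply_apply, -map_sub]
  ring

theorem radial_gradient {d : ℕ} (h : ℝ → ℝ) (h1 : ℝ) (x0 x : Euc d)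
    (H : HasDerivAt h h1 (‖x - x0‖ ^ 2)) :
    gradient (fun y => h (‖y - x0‖ ^ 2)) x = (2 * h1) • (x - x0) := by
  have := radial_fderiv h h1 x0 x H
  apply HasGradientAt.gradient
  rw [hasGradientAt_iff_hasFDerivAt]
  refine this.congr_fderiv ?_
  refine ContinuousLinearMap.ext fun v => ?_
  simp [-inner_sub_left, -map_sub, inner_smul_left]

theorem radial_lap {d : ℕ} (h h1 : ℝ → ℝ) (h2 : ℝ) (x0 x : Euc d)
    (H : ∀ᶠ s in nhds (‖x - x0‖ ^ 2), HasDerivAt h (h1 s) s) (H2 : HasDerivAt h1 h2 (‖x - x0‖ ^ 2)) :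
    lap (fun y => h (‖y - x0‖ ^ 2)) x = 4 * h2 * ‖x - x0‖ ^ 2 + 2 * d * h1 (‖x - x0‖ ^ 2) := by
  have hc : Tendsto (fun y : Euc d => ‖y - x0‖ ^ 2) (nhds x) (nhds (‖x - x0‖ ^ 2)) := by
    have : Continuous (fun y : Euc d => ‖y - x0‖ ^ 2) := by fun_prop
    exact this.tendsto x
  have key : ∀ i : Fin d, fderiv ℝ (fun y => fderiv ℝ (fun y => h (‖y - x0‖ ^ 2)) y (EuclideanSpace.single i 1)) x
    (EuclideanSpace.single i 1) = 4 * h2 * ((x - x0) i) ^ 2 + 2 * h1 (‖x - x0‖ ^ 2) := by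
    intro i
    have e : (fun y => fderiv ℝ (fun y => h (‖y - x0‖ ^ 2)) y (EuclideanSpace.single i 1)) =ᶠ[nhds x]
        fun y => (2 * h1 (‖y - x0‖ ^ 2)) * ((y - x0) i) := by
      filter_upwards [hc.eventually H] with y hy
      rw [(radial_fderiv h _ x0 y hy).fderiv]
      simp [EuclideanSpace.inner_single_right]
    rw [e.fderiv_eq]
    have q1 := (radial_fderiv h1 h2 x0 x H2).const_mul 2
    have q2 : HasFDerivAt (fun y : Euc d => (y - x0) i) (EuclideanSpace.proj i : Euc d →L[ℝ] ℝ) x :=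
      ((EuclideanSpace.proj i : Euc d →L[ℝ] ℝ).hasFDerivAt.comp x ((hasFDerivAt_id x).sub_const x0))
    rw [(q1.fun_mul q2).fderiv]
    simp [EuclideanSpace.inner_single_right]
    ring
  unfold lap
  rw [Finset.sum_congr rfl fun i _ => key i, Finset.sum_add_distrib, ← Finset.mul_sum, 
    EuclideanSpace.real_norm_sq_eq]
  simp
  ring

theorem w_bound (d : ℕ) (m q : ℝ) (hm : 1 < m) (hq : 0 < q) (hqm : q * (m - 1) = 2) :
    ∃ K : ℝ, 0 ≤ K ∧ ∀ n : ℝ, 0 ≤ n → n < 1 →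
      4 * (q * (q + 1) * (1 - n ^ 2) ^ (-q - 2)) * n ^ 2 + 2 * d * (q * (1 - n ^ 2) ^ (-q - 1))
        - (1 / (2 * m)) * (2 * (q * (1 - n ^ 2) ^ (-q - 1)) * n) ^ m ≤ K := by
  set C1 : ℝ := 4 * q * (q + 1) + 2 * d * q with hC1
  have hC1p : 0 < C1 := by positivity
  set c : ℝ := q ^ m / (2 * m) with hc
  have hcp : 0 < c := by positivity
  refine ⟨C1 * (3 / 4) ^ (-q - 2) + C1 * (C1 / c) ^ ((q + 2) / m), by positivity, ?_⟩
  intro n hn0 hn1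
  have hu : 0 < 1 - n ^ 2 := by nlinarith
  set u : ℝ := 1 - n ^ 2 with hu_def
  have hu1 : u ≤ 1 := by nlinarith
  have htp : 0 < u ^ (-q - 2) := by positivity
  have ht : u ^ (-q - 1) ≤ u ^ (-q - 2) :=
    Real.rpow_le_rpow_of_exponent_ge hu hu1 (by linarith)
  have hlin : 4 * (q * (q + 1) * u ^ (-q - 2)) * n ^ 2 + 2 * d * (q * u ^ (-q - 1))
      ≤ C1 * u ^ (-q - 2) := by
    have e1 : 4 * (q * (q + 1) * u ^ (-q - 2)) * n ^ 2 ≤ 4 * (q * (q + 1) * u ^ (-q - 2)) * 1 := by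
      gcongr
      nlinarith
    have e2 : 2 * d * (q * u ^ (-q - 1)) ≤ 2 * d * (q * u ^ (-q - 2)) := by gcongr
    rw [hC1]; nlinarith
  have hnonneg : 0 ≤ (1 / (2 * m)) * (2 * (q * u ^ (-q - 1)) * n) ^ m := by positivity
  have hA : 0 ≤ C1 * (3 / 4 : ℝ) ^ (-q - 2) := by positivity
  have hB : 0 ≤ C1 * (C1 / c) ^ ((q + 2) / m) := by positivity
  by_cases hn : n < 1 / 2
  · have : u ^ (-q - 2) ≤ (3 / 4 : ℝ) ^ (-q - 2) :=
      Real.rpow_le_rpow_of_nonpos (by norm_num) (by nlinarith) (by linarith)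
    have := mul_le_mul_of_nonneg_left this hC1p.le
    linarith
  · push Not at hn
    have h1 : c * (u ^ (-q - 2) * u ^ (-m)) ≤ (1 / (2 * m)) * (2 * (q * u ^ (-q - 1)) * n) ^ m := by
      have e1 : u ^ (-q - 2) * u ^ (-m) = (u ^ (-q - 1)) ^ m := by
        rw [← Real.rpow_add hu, ← Real.rpow_mul hu.le]
        congr 1; nlinarith
      have e2 : (q * u ^ (-q - 1)) ^ m ≤ (2 * (q * u ^ (-q - 1)) * n) ^ m := by
        apply Real.rpow_le_rpow (by positivity) _ (by linarith)
        have : 0 < q * u ^ (-q - 1) := by positivity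
        nlinarith
      rw [Real.mul_rpow hq.le (by positivity)] at e2
      rw [e1, hc]
      calc q ^ m / (2 * m) * (u ^ (-q - 1)) ^ m = (1 / (2 * m)) * (q ^ m * (u ^ (-q - 1)) ^ m) := by ring
        _ ≤ _ := by gcongr
    by_cases hcase : C1 / c ≤ u ^ (-m)
    · have : C1 ≤ c * u ^ (-m) := by
        rw [div_le_iff₀ hcp] at hcase; linarith
      have := mul_le_mul_of_nonneg_right this htp.le
      nlinarith
    · push Not at hcase
      have : u ^ (-q - 2) ≤ (C1 / c) ^ ((q + 2) / m) := by
        have e : u ^ (-q - 2) = (u ^ (-m)) ^ ((q + 2) / m) := by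
          rw [← Real.rpow_mul hu.le]; congr 1; field_simp; ring
        rw [e]
        apply Real.rpow_le_rpow (by positivity) hcase.le (by positivity)
      have := mul_le_mul_of_nonneg_left this hC1p.le
      linarith

theorem exists_max {d : ℕ} (φ : Euc d → ℝ) (hφ : Continuous φ) (x0 : Euc d) (q : ℝ) (hq : 0 < q) :
    ∃ z : Euc d, ‖z - x0‖ < 1 ∧ IsLocalMax (fun y => φ y - (1 - ‖y - x0‖ ^ 2) ^ (-q)) z := by
  obtain ⟨M, hM⟩ := (isCompact_closedBall x0 (1:ℝ)).bddAbove_image hφ.continuousOn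
  have hM' : ∀ y ∈ Metric.closedBall x0 (1:ℝ), φ y ≤ M := fun y hy => hM ⟨y, hy, rfl⟩
  have hx0 : φ x0 ≤ M := hM' x0 (by simp)
  set L : ℝ := 2 + M - φ x0 with hL
  have hL2 : 1 < L := by linarith
  set u0 : ℝ := L ^ (-1 / q) with hu0
  have hu0p : 0 < u0 := by positivity
  have hu01 : u0 < 1 := Real.rpow_lt_one_of_one_lt_of_neg hL2 (div_neg_of_neg_of_pos (by norm_num) hq)
  have hu0q : u0 ^ (-q) = L := by
    rw [hu0, ← Real.rpow_mul (by linarith)]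
    have : -1 / q * -q = 1 := by field_simp
    rw [this, Real.rpow_one]
  set r := Real.sqrt (1 - u0) with hr
  have hr2 : r ^ 2 = 1 - u0 := Real.sq_sqrt (by linarith)
  have hr0 : 0 ≤ r := Real.sqrt_nonneg _
  have hr1 : r < 1 := by nlinarith
  have hcont : ContinuousOn (fun y => φ y - (1 - ‖y - x0‖ ^ 2) ^ (-q)) (Metric.closedBall x0 r) := by
    apply hφ.continuousOn.sub
    apply ContinuousOn.rpow_const (by fun_prop)
    intro y hy
    left
    rw [mem_closedBall_iff_norm] at hy
    have := norm_nonneg (y - x0)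
    nlinarith
  obtain ⟨z, hz, hzmax⟩ := (isCompact_closedBall x0 r).exists_isMaxOn ⟨x0, by simpa using hr0⟩ hcont
  have hz' := mem_closedBall_iff_norm.mp hz
  have h0 : φ x0 - 1 ≤ φ z - (1 - ‖z - x0‖ ^ 2) ^ (-q) := by
    have := hzmax (show x0 ∈ Metric.closedBall x0 r by simpa using hr0)
    simpa using this
  have hne : ‖z - x0‖ ≠ r := by
    intro h
    rw [h, hr2] at h0
    have : (1 - (1 - u0)) = u0 := by ring
    rw [this, hu0q] at h0
    have := hM' z (by rw [mem_closedBall_iff_norm]; linarith)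
    linarith
  have hlt : ‖z - x0‖ < r := lt_of_le_of_ne hz' hne
  refine ⟨z, by linarith, hzmax.isLocalMax ?_⟩
  exact Filter.mem_of_superset (Metric.isOpen_ball.mem_nhds (by rwa [mem_ball_iff_norm])) Metric.ball_subset_closedBall

theorem upper_aux {d : ℕ} (m mst : ℝ) (hm : 1 < m) (hmst : mst = m / (m - 1)) :
    ∃ K : ℝ, 0 ≤ K ∧ ∀ (φ : Euc d → ℝ) (b : Euc d → Euc d) (V : Euc d → ℝ) (β lam B v : ℝ) (x0 : Euc d),
      IsSubsol m b V β lam φ → 0 ≤ B → (∀ x, ‖x - x0‖ < 1 → ‖b x‖ ≤ B ∧ β * V x ≤ v) →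
      lam ≤ K + (2 * B) ^ mst / mst + v := by
  have hm1 : 0 < m - 1 := by linarith
  have hq : 0 < 2 / (m - 1) := by positivity
  obtain ⟨K, hK0, hK⟩ := w_bound d m (2 / (m - 1)) hm hq (by field_simp)
  set q := 2 / (m - 1)
  refine ⟨K, hK0, ?_⟩
  intro φ b V β lam B v x0 hsub hB hb
  obtain ⟨hφ, hineq⟩ := hsub
  obtain ⟨z, hz1, hzmax⟩ := exists_max φ hφ.continuous x0 q hq
  set n := ‖z - x0‖ with hn
  have hn0 : 0 ≤ n := norm_nonneg _
  have hs1 : n ^ 2 < 1 := by nlinarith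
  have hd1 : ∀ s : ℝ, s < 1 → HasDerivAt (fun s : ℝ => (1 - s) ^ (-q)) (q * (1 - s) ^ (-q - 1)) s := by
    intro s hs
    have := ((hasDerivAt_id s).const_sub 1).rpow_const (p := -q) (Or.inl (by simp; linarith))
    refine this.congr_deriv ?_
    simp only [id]
    ring
  have hd2 : ∀ s : ℝ, s < 1 → HasDerivAt (fun s : ℝ => q * (1 - s) ^ (-q - 1)) (q * (q + 1) * (1 - s) ^ (-q - 2)) s := by
    intro s hs
    have := (((hasDerivAt_id s).const_sub 1).rpow_const (p := -q - 1) (Or.inl (by simp; linarith))).const_mul q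
    refine this.congr_deriv ?_
    have e : -q - 1 - 1 = -q - 2 := by ring
    rw [e]
    simp only [id]
    ring
  have hw : ContDiffAt ℝ 2 (fun y => (1 - ‖y - x0‖ ^ 2) ^ (-q)) z := by
    apply ContDiffAt.rpow_const_of_ne
    · apply ContDiffAt.sub contDiffAt_const
      exact ((contDiff_id.sub contDiff_const).norm_sq ℝ).contDiffAt
    · rw [← hn]; linarith
  obtain ⟨hg, hl⟩ := max_principle φ _ z (hφ.contDiffAt.of_le (by norm_num)) hw hzmax
  have hgrad : gradient φ z = (2 * (q * (1 - n ^ 2) ^ (-q - 1))) • (z - x0) := by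
    rw [← radial_gradient (fun s : ℝ => (1 - s) ^ (-q)) _ x0 z (hd1 _ hs1)]
    unfold gradient
    rw [hg]
  have hlap := radial_lap (fun s : ℝ => (1 - s) ^ (-q)) _ _ x0 z
    (by filter_upwards [Iio_mem_nhds hs1] with s hs using hd1 s hs) (hd2 _ hs1)
  rw [hlap] at hl
  rw [← hn] at hl
  have hh1 : 0 ≤ 2 * (q * (1 - n ^ 2) ^ (-q - 1)) := by
    have : 0 < 1 - n ^ 2 := by linarith
    positivity
  have hnorm : ‖gradient φ z‖ = 2 * (q * (1 - n ^ 2) ^ (-q - 1)) * n := by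
    rw [hgrad, norm_smul, Real.norm_of_nonneg hh1]
  have hKn := hK n hn0 hz1
  rw [← hnorm] at hKn
  obtain ⟨hb1, hV⟩ := hb z hz1
  have hin := hineq z
  have habs := abs_real_inner_le_norm (b z) (gradient φ z)
  have hneg := neg_abs_le (⟪b z, gradient φ z⟫)
  set g := ‖gradient φ z‖ with hgdef
  have hg0 : 0 ≤ g := norm_nonneg _
  have hBg : ‖b z‖ * g ≤ B * g := by gcongr
  have hconj : mst.HolderConjugate m := by
    rw [hmst]
    exact (Real.HolderConjugate.conjExponent hm).symm
  have hy := Real.young_inequality_of_nonneg (a := 2 * B) (b := g / 2) (by positivity) (by positivity) hconj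
  have hg2 : (g / 2) ^ m / m ≤ 1 / (2 * m) * g ^ m := by
    rw [Real.div_rpow hg0 (by norm_num)]
    have : (2:ℝ) ≤ 2 ^ m := by
      simpa using Real.rpow_le_rpow_of_exponent_le (x := 2) (by norm_num) hm.le
    have h3 : 0 ≤ g ^ m := by positivity
    rw [div_div, one_div_mul_eq_div]
    gcongr
  have e1 : 1 / m * g ^ m = 1 / (2 * m) * g ^ m + 1 / (2 * m) * g ^ m := by field_simp; ring
  have e2 : 2 * B * (g / 2) = B * g := by ring
  rw [e2] at hy
  linarith

theorem amgm (p η X β r : ℝ) (hp : 0 < p) (hη : 0 < η) (hX : 0 < X) (hβ : 0 < β) (hr : 0 < r) :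
    (p + η) / p * X ^ (η / (p + η)) * β ^ (p / (p + η)) ≤ X * η / p * r ^ p + β * r ^ (-η) := by
  have hk : 0 < (p + η) / p := by positivity
  set k := (p + η) / p with hkdef
  have hw : η / (p + η) + p / (p + η) = 1 := by field_simp; ring
  have h := Real.geom_mean_le_arith_mean2_weighted (w₁ := η / (p + η)) (w₂ := p / (p + η))
    (p₁ := k * (X * r ^ p)) (p₂ := k * (β * r ^ (-η)))
    (by positivity) (by positivity) (by positivity) (by positivity) hw
  have e1 : (k * (X * r ^ p)) ^ (η / (p + η)) * (k * (β * r ^ (-η))) ^ (p / (p + η))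
      = k * X ^ (η / (p + η)) * β ^ (p / (p + η)) := by
    rw [Real.mul_rpow hk.le (by positivity), Real.mul_rpow hX.le (by positivity),
      Real.mul_rpow hk.le (by positivity), Real.mul_rpow hβ.le (by positivity),
      ← Real.rpow_mul hr.le, ← Real.rpow_mul hr.le]
    have e2 : k ^ (η / (p + η)) * k ^ (p / (p + η)) = k := by
      rw [← Real.rpow_add hk, hw, Real.rpow_one]
    have e3 : r ^ (p * (η / (p + η))) * r ^ (-η * (p / (p + η))) = 1 := by
      rw [← Real.rpow_add hr]
      have : p * (η / (p + η)) + -η * (p / (p + η)) = 0 := by ring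
      rw [this, Real.rpow_zero]
    calc _ = (k ^ (η / (p + η)) * k ^ (p / (p + η))) * X ^ (η / (p + η)) * β ^ (p / (p + η)) *
          (r ^ (p * (η / (p + η))) * r ^ (-η * (p / (p + η)))) := by ring
      _ = _ := by rw [e2, e3]; ring
  rw [e1] at h
  refine h.trans (le_of_eq ?_)
  rw [hkdef]
  field_simp

theorem bracket_tendsto (m δ ρ a C κ D : ℝ) (hm : 1 < m) (hδ : 0 < δ) :
    Tendsto (fun r : ℝ => C * r ^ (-δ - 1) * (1 + r⁻¹ ^ 2) ^ (κ / 2 - 1) *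
        ((κ - 2) * (1 + r⁻¹ ^ 2)⁻¹ + D) - (ρ + a * r⁻¹) * C * (1 + r⁻¹ ^ 2) ^ (κ / 2 - 1)
        + 1 / m * (C * (1 + r⁻¹ ^ 2) ^ (κ / 2 - 1)) ^ m) atTop (nhds (-(ρ * C) + 1 / m * C ^ m)) := by
  have h1 : Tendsto (fun r : ℝ => r⁻¹) atTop (nhds 0) := tendsto_inv_atTop_zero
  have h2 : Tendsto (fun r : ℝ => 1 + r⁻¹ ^ 2) atTop (nhds 1) := by
    simpa using (h1.pow 2).const_add 1
  have h3 : Tendsto (fun r : ℝ => (1 + r⁻¹ ^ 2) ^ (κ / 2 - 1)) atTop (nhds 1) := by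
    simpa using h2.rpow_const (p := κ / 2 - 1) (Or.inl one_ne_zero)
  have h4 : Tendsto (fun r : ℝ => r ^ (-δ - 1)) atTop (nhds 0) := by
    have := tendsto_rpow_neg_atTop (y := δ + 1) (by linarith)
    convert this using 3; ring
  have h5 : Tendsto (fun r : ℝ => (1 + r⁻¹ ^ 2)⁻¹) atTop (nhds 1) := by
    simpa using h2.inv₀ one_ne_zero
  have h6 : Tendsto (fun r : ℝ => (C * (1 + r⁻¹ ^ 2) ^ (κ / 2 - 1)) ^ m) atTop (nhds (C ^ m)) := by
    simpa using (h3.const_mul C).rpow_const (p := m) (Or.inr (by linarith))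
  have := ((((h4.const_mul C).mul h3).mul ((h5.const_mul (κ - 2)).add_const D)).sub
    ((((h1.const_mul a).const_add ρ).mul_const C).mul h3)).add (h6.const_mul (1 / m))
  convert this using 2
  ring

theorem bracket_eq (m δ ρ a C κ D p r : ℝ) (hr : 0 < r) (hC : 0 ≤ C)
    (h1 : κ - 2 = p + (-δ - 1)) (h2 : (κ - 1) * m = p) :
    (C * (κ - 2) * ((1 + r ^ 2) ^ (κ / 2 - 2) * r ^ 2) + D * C * (1 + r ^ 2) ^ (κ / 2 - 1))
     - (ρ + a * r⁻¹) * r ^ (δ - 1) * (C * (1 + r ^ 2) ^ (κ / 2 - 1)) * r ^ 2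
     + 1 / m * (C * (1 + r ^ 2) ^ (κ / 2 - 1) * r) ^ m =
    r ^ p * (C * r ^ (-δ - 1) * (1 + r⁻¹ ^ 2) ^ (κ / 2 - 1) *
        ((κ - 2) * (1 + r⁻¹ ^ 2)⁻¹ + D) - (ρ + a * r⁻¹) * C * (1 + r⁻¹ ^ 2) ^ (κ / 2 - 1)
        + 1 / m * (C * (1 + r⁻¹ ^ 2) ^ (κ / 2 - 1)) ^ m) := by
  have hY : 0 < 1 + r⁻¹ ^ 2 := by positivity
  have e0 : 1 + r ^ 2 = r ^ 2 * (1 + r⁻¹ ^ 2) := by field_simp; ring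
  have e0' : (r ^ 2) = r ^ (2:ℝ) := by norm_cast
  have e1 : (1 + r ^ 2) ^ (κ / 2 - 1) = r ^ (κ - 2) * (1 + r⁻¹ ^ 2) ^ (κ / 2 - 1) := by
    rw [e0, Real.mul_rpow (by positivity) hY.le, e0', ← Real.rpow_mul hr.le]
    congr 2; ring
  have e2 : (1 + r ^ 2) ^ (κ / 2 - 2) * r ^ 2 =
      r ^ (κ - 2) * (1 + r⁻¹ ^ 2) ^ (κ / 2 - 1) * (1 + r⁻¹ ^ 2)⁻¹ := by
    have : κ / 2 - 2 = (κ / 2 - 1) - 1 := by ring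
    rw [this, Real.rpow_sub_one (by positivity), e1, e0]
    field_simp
  have e3 : r ^ (κ - 2) = r ^ p * r ^ (-δ - 1) := by rw [h1, Real.rpow_add hr]
  have e4 : r ^ (δ - 1) * r ^ (κ - 2) * r ^ 2 = r ^ p := by
    rw [e0', ← Real.rpow_add hr, ← Real.rpow_add hr]; congr 1; linarith
  have e5 : (C * (r ^ (κ - 2) * (1 + r⁻¹ ^ 2) ^ (κ / 2 - 1)) * r) ^ m =
      r ^ p * (C * (1 + r⁻¹ ^ 2) ^ (κ / 2 - 1)) ^ m := by
    have : C * (r ^ (κ - 2) * (1 + r⁻¹ ^ 2) ^ (κ / 2 - 1)) * r =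
        r ^ (κ - 1) * (C * (1 + r⁻¹ ^ 2) ^ (κ / 2 - 1)) := by
      have : r ^ (κ - 1) = r ^ (κ - 2) * r := by
        rw [← Real.rpow_add_one hr.ne']; congr 1; ring
      rw [this]; ring
    rw [this, Real.mul_rpow (by positivity) (by positivity), ← Real.rpow_mul hr.le, h2]
  rw [e2, e1, e5]
  calc _ = (r ^ (κ - 2)) * (C * (1 + r⁻¹ ^ 2) ^ (κ / 2 - 1) *
        ((κ - 2) * (1 + r⁻¹ ^ 2)⁻¹ + D)) - (r ^ (δ - 1) * r ^ (κ - 2) * r ^ 2) *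
          ((ρ + a * r⁻¹) * C * (1 + r⁻¹ ^ 2) ^ (κ / 2 - 1)) +
        1 / m * (r ^ p * (C * (1 + r⁻¹ ^ 2) ^ (κ / 2 - 1)) ^ m) := by ring
    _ = _ := by rw [e4, e3]; ring

theorem lower_phi {d : ℕ} (m δ ρ R a mst : ℝ) (hm : 1 < m) (hδ : 0 < δ) (hρ : 0 < ρ) (hR : 0 < R)
    (hmst : mst = m / (m - 1)) (b : Euc d → Euc d) (hb : Continuous b)
    (hbR : ∀ x : Euc d, R ≤ ‖x‖ → b x = ((ρ + a * ‖x‖⁻¹) * ‖x‖ ^ (δ - 1)) • x)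
    (A' : ℝ) (hA' : A' < ρ ^ mst / mst) :
    ∃ φ : Euc d → ℝ, ContDiff ℝ 3 φ ∧ ∃ R1 K : ℝ, R ≤ R1 ∧
      (∀ x : Euc d, R1 ≤ ‖x‖ → - lap φ x + ⟪b x, gradient φ x⟫ + (1 / m) * ‖gradient φ x‖ ^ m
        ≤ - (A' * ‖x‖ ^ (δ * mst))) ∧
      (∀ x : Euc d, ‖x‖ ≤ R1 → - lap φ x + ⟪b x, gradient φ x⟫ + (1 / m) * ‖gradient φ x‖ ^ m
        ≤ K) := by
  have hm1 : 0 < m - 1 := by linarith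
  have hmst1 : mst - 1 = 1 / (m - 1) := by rw [hmst]; field_simp; ring
  have hmstm : (mst - 1) * m = mst := by rw [hmst1, hmst]; ring
  have hmstp : 0 < mst := by rw [hmst]; positivity
  set κ : ℝ := δ * (mst - 1) + 1 with hκ
  have hκ0 : 0 < κ := by rw [hκ, hmst1]; positivity
  set C : ℝ := ρ ^ (mst - 1) with hC
  have hC0 : 0 < C := by positivity
  have hd1 : ∀ s : ℝ, -1 < s → HasDerivAt (fun s : ℝ => -(C / κ) * (1 + s) ^ (κ / 2))
      (-(C / 2) * (1 + s) ^ (κ / 2 - 1)) s := by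
    intro s hs
    have := (((hasDerivAt_id s).const_add 1).rpow_const (p := κ / 2)
      (Or.inl (by simp; linarith))).const_mul (-(C / κ))
    refine this.congr_deriv ?_
    simp only [id]
    field_simp
  have hd2 : ∀ s : ℝ, -1 < s → HasDerivAt (fun s : ℝ => -(C / 2) * (1 + s) ^ (κ / 2 - 1))
      (-(C / 2) * (κ / 2 - 1) * (1 + s) ^ (κ / 2 - 2)) s := by
    intro s hs
    have := (((hasDerivAt_id s).const_add 1).rpow_const (p := κ / 2 - 1)
      (Or.inl (by simp; linarith))).const_mul (-(C / 2))
    refine this.congr_deriv ?_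
    have e : κ / 2 - 1 - 1 = κ / 2 - 2 := by ring
    rw [e]
    simp only [id]
    ring
  set φ : Euc d → ℝ := fun x => -(C / κ) * (1 + ‖x - 0‖ ^ 2) ^ (κ / 2) with hφ
  have hs : ∀ x : Euc d, -1 < ‖x - 0‖ ^ 2 := fun x => by
    have : 0 ≤ ‖x - 0‖ ^ 2 := by positivity
    linarith
  have hgrad : ∀ x, gradient φ x = (-(C * (1 + ‖x‖ ^ 2) ^ (κ / 2 - 1))) • x := by
    intro x
    have := radial_gradient _ _ 0 x (hd1 _ (hs x))
    rw [hφ, this]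
    simp only [sub_zero]
    congr 1; ring
  have hlap : ∀ x, - lap φ x = C * (κ - 2) * ((1 + ‖x‖ ^ 2) ^ (κ / 2 - 2) * ‖x‖ ^ 2) +
      d * C * (1 + ‖x‖ ^ 2) ^ (κ / 2 - 1) := by
    intro x
    have := radial_lap _ _ _ 0 x
      (by filter_upwards [Ioi_mem_nhds (hs x)] with s hs using hd1 s hs) (hd2 _ (hs x))
    rw [hφ, this]
    simp only [sub_zero]
    ring
  have hnorm : ∀ x, ‖gradient φ x‖ = C * (1 + ‖x‖ ^ 2) ^ (κ / 2 - 1) * ‖x‖ := by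
    intro x
    rw [hgrad, norm_smul, norm_neg, Real.norm_of_nonneg (by positivity)]
  refine ⟨φ, ?_, ?_⟩
  · apply ContDiff.mul contDiff_const
    apply ContDiff.rpow_const_of_ne
    · exact contDiff_const.add ((contDiff_id.sub contDiff_const).norm_sq ℝ)
    · intro x; positivity
  · have hT := bracket_tendsto m δ ρ a C κ d hm hδ
    have hlim : -(ρ * C) + 1 / m * C ^ m = - (ρ ^ mst / mst) := by
      have e1 : ρ * C = ρ ^ mst := by
        rw [hC, ← Real.rpow_one_add' hρ.le (by simp; exact hmstp.ne')]; congr 1; ring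
      have e2 : C ^ m = ρ ^ mst := by rw [hC, ← Real.rpow_mul hρ.le, hmstm]
      rw [e1, e2]
      have : 1 / mst = 1 - 1 / m := by rw [hmst]; field_simp
      rw [div_eq_mul_one_div (ρ ^ mst) mst, this]; ring
    rw [hlim] at hT
    have hev := hT.eventually_lt_const (show - (ρ ^ mst / mst) < - A' by linarith)
    obtain ⟨R0, hR0⟩ := Filter.eventually_atTop.mp hev
    have hcont : Continuous fun x : Euc d => - lap φ x + ⟪b x, gradient φ x⟫ + (1 / m) * ‖gradient φ x‖ ^ m := by
      have hrp : ∀ e : ℝ, Continuous fun x : Euc d => (1 + ‖x‖ ^ 2) ^ e := fun e =>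
        Continuous.rpow_const (by fun_prop) (fun x => Or.inl (by positivity))
      simp only [hlap, hnorm, hgrad]
      have h1 := hrp (κ / 2 - 1)
      have h2 := hrp (κ / 2 - 2)
      refine Continuous.add (Continuous.add (by fun_prop) ?_) ?_
      · exact hb.inner (by fun_prop)
      · apply Continuous.mul continuous_const
        exact Continuous.rpow_const (by fun_prop) (fun x => Or.inr (by linarith))
    obtain ⟨K, hK⟩ := (isCompact_closedBall (0 : Euc d) (max R R0)).bddAbove_image hcont.continuousOn
    refine ⟨max R R0, K, le_max_left _ _, ?_, fun x hx => hK ⟨x, by simpa using hx, rfl⟩⟩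
    intro x hx
    have hxR : R ≤ ‖x‖ := (le_max_left _ _).trans hx
    have hx0 : 0 < ‖x‖ := hR.trans_le hxR
    have hbr := (hR0 ‖x‖ ((le_max_right _ _).trans hx)).le
    have heq := bracket_eq m δ ρ a C κ d (δ * mst) ‖x‖ hx0 hC0.le (by rw [hκ]; ring)
      (by rw [hκ]; linear_combination δ * hmstm)
    have hin : ⟪b x, gradient φ x⟫ = - ((ρ + a * ‖x‖⁻¹) * ‖x‖ ^ (δ - 1) * (C * (1 + ‖x‖ ^ 2) ^ (κ / 2 - 1)) * ‖x‖ ^ 2) := by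
      rw [hbR x hxR, hgrad, real_inner_smul_left, real_inner_smul_right, real_inner_self_eq_norm_sq]
      ring
    rw [hin, hnorm, hlap, ← sub_eq_add_neg, heq]
    have := mul_le_mul_of_nonneg_left hbr (show 0 ≤ ‖x‖ ^ (δ * mst) by positivity)
    linarith

theorem upper_final {d : ℕ} (hd : 1 ≤ d) (m δ ρ R a η mst : ℝ) (hm : 1 < m) (hδ : 0 < δ) (hρ : 0 < ρ)
    (hη : 0 < η) (hR : 0 < R)
    (hmst : mst = m / (m - 1)) (b : Euc d → Euc d) (V : Euc d → ℝ)
    (hbR : ∀ x : Euc d, R ≤ ‖x‖ → b x = ((ρ + a * ‖x‖⁻¹) * ‖x‖ ^ (δ - 1)) • x)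
    (hVR : ∀ x : Euc d, R ≤ ‖x‖ → V x = ‖x‖ ^ (-η)) :
    ∃ K : ℝ, 0 ≤ K ∧ ∀ᶠ β : ℝ in atTop, ∀ lam φ, IsSubsol m b V β lam φ →
      lam ≤ K * β ^ (δ * mst / (δ * mst + η)) := by
  obtain ⟨K, hK0, hK⟩ := upper_aux (d := d) m mst hm hmst
  have hmstp : 0 < mst := by rw [hmst]; exact div_pos (by linarith) (by linarith)
  set p := δ * mst with hp
  have hpp : 0 < p := by positivity
  set D : ℝ := 2 * ((ρ + |a| / R) * 2 ^ δ) with hD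
  have hD0 : 0 ≤ D := by positivity
  refine ⟨K + D ^ mst / mst + (1 / 2) ^ (-η), by positivity, ?_⟩
  have hlim : Tendsto (fun β : ℝ => β ^ (1 / (p + η))) atTop atTop := tendsto_rpow_atTop (by positivity)
  filter_upwards [hlim.eventually_ge_atTop (2 * (R + 1)), eventually_ge_atTop 1] with β hβr hβ1 lam φ hsub
  have hβ0 : 0 < β := by linarith
  set r := β ^ (1 / (p + η)) with hr
  have hr0 : 0 < r := by positivity
  set x0 : Euc d := r • EuclideanSpace.single ⟨0, hd⟩ 1 with hx0
  have hx0n : ‖x0‖ = r := by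
    rw [hx0, norm_smul, Real.norm_of_nonneg hr0.le]; simp
  have hmain := hK φ b V β lam ((ρ + |a| / R) * (2 * r) ^ δ) (β * (1 / 2 * r) ^ (-η)) x0 hsub (by positivity) ?_
  · have hrp : r ^ p = β ^ (p / (p + η)) := by
      rw [hr, ← Real.rpow_mul hβ0.le]; congr 1; ring
    have hrη : β * r ^ (-η) = β ^ (p / (p + η)) := by
      rw [hr, ← Real.rpow_mul hβ0.le, ← Real.rpow_one_add' hβ0.le]
      · congr 1; field_simp; ring
      · have : 1 + 1 / (p + η) * -η = p / (p + η) := by field_simp; ring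
        rw [this]; positivity
    have e1 : (2 * ((ρ + |a| / R) * (2 * r) ^ δ)) ^ mst = D ^ mst * β ^ (p / (p + η)) := by
      have : 2 * ((ρ + |a| / R) * (2 * r) ^ δ) = D * r ^ δ := by
        rw [hD, Real.mul_rpow (by norm_num) hr0.le]; ring
      rw [this, Real.mul_rpow hD0 (by positivity), ← Real.rpow_mul hr0.le, ← hp, hrp]
    have e2 : β * (1 / 2 * r) ^ (-η) = (1 / 2) ^ (-η) * β ^ (p / (p + η)) := by
      rw [Real.mul_rpow (by norm_num) hr0.le, ← hrη]; ring
    rw [e1, e2] at hmain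
    have h1 : 1 ≤ β ^ (p / (p + η)) := Real.one_le_rpow hβ1 (by positivity)
    have h2 : K ≤ K * β ^ (p / (p + η)) := le_mul_of_one_le_right hK0 h1
    calc lam ≤ _ := hmain
      _ ≤ K * β ^ (p / (p + η)) + D ^ mst * β ^ (p / (p + η)) / mst + (1 / 2) ^ (-η) * β ^ (p / (p + η)) := by
        linarith
      _ = _ := by ring
  · intro x hx
    have t1 : ‖x‖ ≤ r + 1 := by
      have := norm_le_norm_add_norm_sub' x x0
      linarith
    have t2 : r - 1 ≤ ‖x‖ := by
      have := norm_le_norm_add_norm_sub' x0 x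
      rw [norm_sub_rev] at this
      linarith
    have hxR : R ≤ ‖x‖ := by linarith
    have hxp : 0 < ‖x‖ := by linarith
    constructor
    · rw [hbR x hxR, norm_smul, norm_mul, Real.norm_of_nonneg (show 0 ≤ ‖x‖ ^ (δ - 1) by positivity),
        mul_assoc, ← Real.rpow_add_one hxp.ne', sub_add_cancel]
      gcongr
      · calc ‖ρ + a * ‖x‖⁻¹‖ ≤ ‖ρ‖ + ‖a * ‖x‖⁻¹‖ := norm_add_le _ _
          _ = ρ + |a| / ‖x‖ := by
            rw [norm_mul, Real.norm_of_nonneg hρ.le, Real.norm_eq_abs, norm_inv, norm_norm]; rfl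
          _ ≤ ρ + |a| / R := by gcongr
      · linarith
    · rw [hVR x hxR]
      gcongr ?_ * ?_
      exact Real.rpow_le_rpow_of_nonpos (by positivity) (by linarith) (by linarith)

/-- lower bound for the asymptotics of `λ_max(β)` in the strong drift case. -/
theorem stmt1 (d : ℕ) (hd : 1 ≤ d) (m δ ρ R a η : ℝ) (hm : 1 < m)
    (hδ : 0 < δ) (hρ : 0 < ρ) (hη : 0 < η) (hR : 0 < R)
    (mst : ℝ) (hmst : mst = m / (m - 1))
    (c₀ : ℝ) (hc₀ : c₀ = ((δ * mst + η) / (δ * mst)) * (ρ ^ mst * δ / η) ^ (η / (δ * mst + η)))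
    (b : Euc d → Euc d) (V : Euc d → ℝ) (α : Euc d → ℝ)
    (hH1 : HypH1 δ ρ R a η b V α) :
    c₀ ≤ Filter.liminf (fun β : ℝ => β ^ (-(δ * mst) / (δ * mst + η)) * lamMax m b V β)
      atTop := by
  obtain ⟨⟨hb2, hV2, -, -, hbR0, -, hVnn, hVsupp, -⟩, hαV⟩ := hH1
  have hbR : ∀ x : Euc d, R ≤ ‖x‖ → b x = ((ρ + a * ‖x‖⁻¹) * ‖x‖ ^ (δ - 1)) • x := by
    intro x hx
    rw [hbR0 x hx, (hαV x hx).1]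
  have hVR : ∀ x : Euc d, R ≤ ‖x‖ → V x = ‖x‖ ^ (-η) := fun x hx => (hαV x hx).2
  have hVpos : ∀ x, 0 < V x := by
    intro x
    by_cases hx : R ≤ ‖x‖
    · rw [hVR x hx]
      have : 0 < ‖x‖ := by linarith
      positivity
    · push Not at hx
      have := interior_subset (hVsupp (show x ∈ Metric.closedBall 0 R by simpa using hx.le))
      exact lt_of_le_of_ne (hVnn x) (Ne.symm this)
  have hmstp : 0 < mst := by rw [hmst]; exact div_pos (by linarith) (by linarith)
  obtain ⟨K, hK0, hK⟩ := upper_final hd m δ ρ R a η mst hm hδ hρ hη hR hmst b V hbR hVR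
  have hpp : 0 < δ * mst := by positivity
  have hc0pos : 0 < c₀ := by rw [hc₀]; positivity
  have hneg : ∀ β : ℝ, 0 < β → β ^ (-(δ * mst) / (δ * mst + η)) * β ^ (δ * mst / (δ * mst + η)) = 1 := by
    intro β hβ
    rw [← Real.rpow_add hβ, ← add_div]; simp
  have hcob : IsCoboundedUnder (· ≥ ·) atTop
      (fun β : ℝ => β ^ (-(δ * mst) / (δ * mst + η)) * lamMax m b V β) := by
    apply IsBoundedUnder.isCoboundedUnder_ge
    refine ⟨K, ?_⟩
    rw [Filter.eventually_map]
    filter_upwards [hK, eventually_gt_atTop 0] with β hβ hβ0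
    have : lamMax m b V β ≤ K * β ^ (δ * mst / (δ * mst + η)) := by
      apply Real.sSup_le
      · rintro lam ⟨φ, hφ⟩
        exact hβ lam φ hφ
      · positivity
    calc _ ≤ β ^ (-(δ * mst) / (δ * mst + η)) * (K * β ^ (δ * mst / (δ * mst + η))) := by gcongr
      _ = K * (β ^ (-(δ * mst) / (δ * mst + η)) * β ^ (δ * mst / (δ * mst + η))) := by ring
      _ = K := by rw [hneg β hβ0, mul_one]
  apply le_of_forall_lt_imp_le_of_dense
  intro c hc
  apply Filter.le_liminf_of_le hcob
  obtain ⟨t, ht0, ht1, htc⟩ : ∃ t : ℝ, 0 < t ∧ t < 1 ∧ c ≤ t * c₀ := by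
    refine ⟨max (1 / 2) (c / c₀), lt_max_of_lt_left (by norm_num),
      max_lt (by norm_num) ((div_lt_one hc0pos).mpr hc), ?_⟩
    rw [← div_le_iff₀ hc0pos]
    exact le_max_right _ _
  have hApos : 0 < ρ ^ mst / mst := by positivity
  obtain ⟨φ, hφ, R1, K1, hR1, hout, hinn⟩ := lower_phi m δ ρ R a mst hm hδ hρ hR hmst b hb2.continuous hbR
    (t * (ρ ^ mst / mst)) (by nlinarith)
  obtain ⟨v, hv0, hv⟩ : ∃ v : ℝ, 0 < v ∧ ∀ x : Euc d, ‖x‖ ≤ R1 → v ≤ V x := by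
    obtain ⟨z, -, hz⟩ := (isCompact_closedBall (0 : Euc d) R1).exists_isMinOn
      ⟨0, by simpa using (hR.le.trans hR1)⟩ hV2.continuous.continuousOn
    exact ⟨V z, hVpos z, fun x hx => hz (show x ∈ Metric.closedBall 0 R1 by simpa using hx)⟩
  have hθ : 0 < η / (δ * mst + η) := by positivity
  filter_upwards [hK, eventually_ge_atTop 1,
    (tendsto_rpow_atTop hθ).eventually_ge_atTop ((t * c₀ + |K1|) / v)] with β hβK hβ1 hβ2
  have hβ0 : 0 < β := by linarith
  have hβθ1 : 1 ≤ β ^ (δ * mst / (δ * mst + η)) := Real.one_le_rpow hβ1 (by positivity)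
  have hsub : IsSubsol m b V β (t * c₀ * β ^ (δ * mst / (δ * mst + η))) φ := by
    refine ⟨hφ, fun x => ?_⟩
    rcases le_total R1 ‖x‖ with hx | hx
    · have h1 := hout x hx
      have hxR := hR1.trans hx
      have hxp : 0 < ‖x‖ := by linarith
      have h2 := amgm (δ * mst) η (ρ ^ mst * δ / η) β ‖x‖ hpp hη (by positivity) hβ0 hxp
      rw [← hc₀] at h2
      have e : ρ ^ mst * δ / η * η / (δ * mst) = ρ ^ mst / mst := by field_simp
      rw [e] at h2
      rw [hVR x hxR]
      have h3 := mul_le_mul_of_nonneg_left h2 ht0.le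
      have h4 : 0 < β * ‖x‖ ^ (-η) := by positivity
      nlinarith
    · have h1 := hinn x hx
      have h2 := mul_le_mul_of_nonneg_left (hv x hx) hβ0.le
      have e : β ^ (δ * mst / (δ * mst + η)) * β ^ (η / (δ * mst + η)) = β := by
        rw [← Real.rpow_add hβ0, ← add_div, div_self (by positivity), Real.rpow_one]
      have h3 : t * c₀ + |K1| ≤ β ^ (η / (δ * mst + η)) * v := (div_le_iff₀ hv0).mp hβ2
      have h4 := mul_le_mul_of_nonneg_left h3 (show 0 ≤ β ^ (δ * mst / (δ * mst + η)) by positivity)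
      rw [← mul_assoc, e] at h4
      have h5 : |K1| ≤ β ^ (δ * mst / (δ * mst + η)) * |K1| := le_mul_of_one_le_left (abs_nonneg _) hβθ1
      have h6 := le_abs_self K1
      linarith
  have hle : t * c₀ * β ^ (δ * mst / (δ * mst + η)) ≤ lamMax m b V β := by
    apply le_csSup
    · exact ⟨_, fun lam ⟨φ, hφ⟩ => hβK lam φ hφ⟩
    · exact ⟨φ, hsub⟩
  calc c ≤ t * c₀ := htc
    _ = β ^ (-(δ * mst) / (δ * mst + η)) * (t * c₀ * β ^ (δ * mst / (δ * mst + η))) := by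
      rw [mul_comm (t * c₀), ← mul_assoc, hneg β hβ0, one_mul]
    _ ≤ _ := by gcongr

end
end

section
/- Let d ≥ 1, m > 1, m* = m/(m−1), and suppose (b,V) satisfies hypothesis (H1) with parameters δ > 0, ρ > 0, a ∈ ℝ, η > 0, R > 0. Then limsup_{β→∞} β^{−δm*/(δm*+η)} λ_max(β) ≤ c₀, where c₀ := ((δm*+η)/(δm*)) · (ρ^{m*} δ/η)^{η/(δm*+η)}. -/
open Filter Real RealInnerProductSpace

noncomputable section

/-- Necessary first and second order conditions at a local maximum on the line. -/
theorem aux_second (g g' : ℝ → ℝ) (g2 : ℝ) (h1 : ∀ᶠ t in nhds (0:ℝ), HasDerivAt g (g' t) t)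
    (h2 : HasDerivAt g' g2 0) (hmax : IsLocalMax g 0) : g' 0 = 0 ∧ g2 ≤ 0 := by
  have h10 := h1.self_of_nhds
  have e1 : g' 0 = 0 := hmax.hasDerivAt_eq_zero h10
  refine ⟨e1, ?_⟩
  by_contra hpos
  push Not at hpos
  have hd : deriv g =ᶠ[nhds 0] g' := h1.mono fun t ht => ht.deriv
  have hdd : deriv (deriv g) 0 = g2 := by rw [hd.deriv_eq, h2.deriv]
  have hmin : IsLocalMin g 0 := isLocalMin_of_deriv_deriv_pos (by rw [hdd]; exact hpos)
    (by rw [h10.deriv, e1]) h10.continuousAt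
  have hc : g =ᶠ[nhds 0] fun _ => g 0 := by
    filter_upwards [hmin, hmax] with t h3 h4
    exact le_antisymm h4 h3
  have : deriv (deriv g) 0 = 0 := by
    have h5 : deriv g =ᶠ[nhds 0] deriv (fun _ => g 0) := hc.deriv
    rw [h5.deriv_eq]; simp
  linarith

/-- At some point of the open unit ball around `x0` the graph of `φ` is touched from above by a
translate of the barrier `(1 - |x - x0|^2)^(-s)`. -/
theorem aux_max {d : ℕ} (φ : Euc d → ℝ) (hφ : Continuous φ) (x0 : Euc d) (s : ℝ) (hs : 0 < s) :
    ∃ x : Euc d, 0 < 1 - ‖x - x0‖ ^ 2 ∧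
      IsLocalMax (fun z => φ z - (1 - ‖z - x0‖ ^ 2) ^ (-s)) x := by
  obtain ⟨M, hM⟩ := (isCompact_closedBall x0 1).bddAbove_image hφ.continuousOn
  have hM' : ∀ z, ‖z - x0‖ ≤ 1 → φ z ≤ M := fun z hz => hM ⟨z, by
    simpa [Metric.mem_closedBall, dist_eq_norm] using hz, rfl⟩
  set Q : ℝ := max (M - φ x0 + 2) 2 with hQ
  have hQ2 : 2 ≤ Q := le_max_right _ _
  have hQ1 : M - φ x0 + 2 ≤ Q := le_max_left _ _
  set u0 : ℝ := Q ^ (-(1 / s)) with hu0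
  have hu0p : 0 < u0 := rpow_pos_of_pos (by linarith) _
  have hu0l : u0 < 1 := rpow_lt_one_of_one_lt_of_neg (by linarith) (by
    have : 0 < 1 / s := by positivity
    linarith)
  have hu0s : u0 ^ (-s) = Q := by
    rw [hu0, ← rpow_mul (by linarith)]
    have : -(1 / s) * -s = 1 := by field_simp
    rw [this, rpow_one]
  have hcu : Continuous fun z : Euc d => 1 - ‖z - x0‖ ^ 2 := by fun_prop
  set K : Set (Euc d) := {z | u0 ≤ 1 - ‖z - x0‖ ^ 2} with hK
  have hKb : ∀ z ∈ K, ‖z - x0‖ ≤ 1 := by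
    intro z hz
    have : u0 ≤ 1 - ‖z - x0‖ ^ 2 := hz
    nlinarith [norm_nonneg (z - x0)]
  have hKc : IsCompact K := by
    refine (isCompact_closedBall x0 1).of_isClosed_subset (isClosed_le continuous_const hcu) ?_
    intro z hz
    simpa [Metric.mem_closedBall, dist_eq_norm] using hKb z hz
  have hx0 : x0 ∈ K := by
    simp only [hK, Set.mem_setOf_eq, sub_self, norm_zero]; linarith
  obtain ⟨x, hxK, hx⟩ := hKc.exists_isMaxOn (f := fun z => φ z - (1 - ‖z - x0‖ ^ 2) ^ (-s))
    ⟨x0, hx0⟩ (by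
      refine hφ.continuousOn.sub (hcu.continuousOn.rpow_const ?_)
      intro z hz
      left
      have : u0 ≤ 1 - ‖z - x0‖ ^ 2 := hz
      linarith)
  have hxu : u0 ≤ 1 - ‖x - x0‖ ^ 2 := hxK
  refine ⟨x, by linarith, ?_⟩
  have hlt : u0 < 1 - ‖x - x0‖ ^ 2 := by
    refine lt_of_le_of_ne hxu fun he => ?_
    have h1 := hx hx0
    simp only [Set.mem_setOf_eq, sub_self, norm_zero] at h1
    rw [← he, hu0s] at h1
    have h2 := hM' x (hKb x hxK)
    norm_num at h1
    linarith
  have hn : K ∈ nhds x := by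
    filter_upwards [hcu.continuousAt.eventually (lt_mem_nhds hlt)] with z hz
    exact le_of_lt hz
  exact hx.isLocalMax hn

theorem aux_dir {d : ℕ} (φ : Euc d → ℝ) (hφ : ContDiff ℝ 3 φ) (x0 x : Euc d) (s : ℝ)
    (hu : 0 < 1 - ‖x - x0‖ ^ 2)
    (hmax : IsLocalMax (fun z => φ z - (1 - ‖z - x0‖ ^ 2) ^ (-s)) x) (i : Fin d) :
    fderiv ℝ φ x (EuclideanSpace.single i 1)
        = 2 * s * (1 - ‖x - x0‖ ^ 2) ^ (-s - 1) * (x - x0) i ∧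
    fderiv ℝ (fun y => fderiv ℝ φ y (EuclideanSpace.single i 1)) x (EuclideanSpace.single i 1)
      ≤ 4 * s * (s + 1) * (1 - ‖x - x0‖ ^ 2) ^ (-s - 2) * ((x - x0) i) ^ 2
        + 2 * s * (1 - ‖x - x0‖ ^ 2) ^ (-s - 1) := by
  set e : Euc d := EuclideanSpace.single i 1 with he
  set u : ℝ := 1 - ‖x - x0‖ ^ 2 with hudef
  set yi : ℝ := (x - x0) i with hyi
  have hline : ∀ t : ℝ, HasDerivAt (fun t : ℝ => x + t • e) e t := by
    intro t
    simpa using ((hasDerivAt_id t).smul_const e).const_add x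
  have hnorm : ∀ t : ℝ, 1 - ‖x + t • e - x0‖ ^ 2 = u - 2 * t * yi - t ^ 2 := by
    intro t
    have h1 : x + t • e - x0 = (x - x0) + t • e := by abel
    rw [h1, norm_add_sq_real, inner_smul_right, norm_smul]
    have h2 : ⟪x - x0, e⟫ = yi := by
      rw [he, EuclideanSpace.inner_single_right]; simp [hyi]
    have h3 : ‖e‖ = 1 := by simp [he]
    rw [h2, h3, mul_one, Real.norm_eq_abs, sq_abs, hudef]; ring
  have hP : ∀ t : ℝ, HasDerivAt (fun t : ℝ => u - 2 * t * yi - t ^ 2) (-2 * yi - 2 * t) t := by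
    intro t
    have := (((hasDerivAt_id t).const_mul 2).mul_const yi).const_sub u |>.sub
      ((hasDerivAt_id t).pow 2)
    refine this.congr_deriv ?_
    simp
  have hPc : Continuous fun t : ℝ => u - 2 * t * yi - t ^ 2 := by fun_prop
  have hev : ∀ᶠ t in nhds (0:ℝ), 0 < u - 2 * t * yi - t ^ 2 :=
    hPc.continuousAt.eventually (lt_mem_nhds (by simpa using hu))
  have hdφ : Differentiable ℝ φ := hφ.differentiable (by norm_num)
  have hdφ2 : Differentiable ℝ (fun y => fderiv ℝ φ y e) := by
    have : ContDiff ℝ 2 (fun y => fderiv ℝ φ y e) :=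
      (hφ.fderiv_right (m := 2) (by norm_num)).clm_apply contDiff_const
    exact this.differentiable (by norm_num)
  have key := aux_second
    (fun t => φ (x + t • e) - (u - 2 * t * yi - t ^ 2) ^ (-s))
    (fun t => fderiv ℝ φ (x + t • e) e
      - (-2 * yi - 2 * t) * (-s) * (u - 2 * t * yi - t ^ 2) ^ (-s - 1))
    (fderiv ℝ (fun y => fderiv ℝ φ y e) x e
      - (4 * s * (s + 1) * u ^ (-s - 2) * yi ^ 2 + 2 * s * u ^ (-s - 1)))
    ?_ ?_ ?_
  · simp only [zero_smul, add_zero, mul_zero, zero_mul, sub_zero] at key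
    obtain ⟨k1, k2⟩ := key
    norm_num at k1
    constructor <;> linarith
  · filter_upwards [hev] with t ht
    refine HasDerivAt.sub ?_ ?_
    · exact (hdφ (x + t • e)).hasFDerivAt.comp_hasDerivAt t (hline t)
    · exact (hP t).rpow_const (Or.inl ht.ne')
  · refine HasDerivAt.sub ?_ ?_
    · have h0 : x + (0:ℝ) • e = x := by simp
      have := (hdφ2 (x + (0:ℝ) • e)).hasFDerivAt.comp_hasDerivAt (0:ℝ) (hline 0)
      rw [h0] at this
      exact this
    · have hA : HasDerivAt (fun t : ℝ => (-2 * yi - 2 * t) * (-s)) (2 * s) 0 := by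
        have := (((hasDerivAt_id (0:ℝ)).const_mul 2).const_sub (-2 * yi)).mul_const (-s)
        refine this.congr_deriv ?_
        ring
      have hB := (hP 0).rpow_const (p := -s - 1) (Or.inl (by simpa using hu.ne'))
      refine (hA.mul hB).congr_deriv ?_
      have : -s - 1 - 1 = -s - 2 := by ring
      rw [this]
      simp
      ring
  · have hc : Filter.Tendsto (fun t : ℝ => x + t • e) (nhds 0) (nhds x) := by
      have := (hline 0).continuousAt.tendsto
      simpa using this
    have := hc.eventually hmax
    filter_upwards [this] with t ht
    simp only [hnorm] at ht
    simpa [hudef] using ht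

theorem aux_contact {d : ℕ} (φ : Euc d → ℝ) (hφ : ContDiff ℝ 3 φ) (x0 : Euc d) (s : ℝ)
    (hs : 0 < s) :
    ∃ x : Euc d, 0 < 1 - ‖x - x0‖ ^ 2 ∧
      ‖gradient φ x‖ = 2 * s * (1 - ‖x - x0‖ ^ 2) ^ (-s - 1) * ‖x - x0‖ ∧
      lap φ x ≤ 4 * s * (s + 1) * (1 - ‖x - x0‖ ^ 2) ^ (-s - 2) * ‖x - x0‖ ^ 2
        + 2 * s * d * (1 - ‖x - x0‖ ^ 2) ^ (-s - 1) := by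
  obtain ⟨x, hu, hmax⟩ := aux_max φ hφ.continuous x0 s hs
  refine ⟨x, hu, ?_, ?_⟩
  · have hg : gradient φ x = (2 * s * (1 - ‖x - x0‖ ^ 2) ^ (-s - 1)) • (x - x0) := by
      ext i
      have h1 := (aux_dir φ hφ x0 x s hu hmax i).1
      have h2 : fderiv ℝ φ x (EuclideanSpace.single i 1) = gradient φ x i := by
        rw [← toDual_gradient, InnerProductSpace.toDual_apply_apply,
          EuclideanSpace.inner_single_right]
        simp
      rw [← h2, h1]; simp
    rw [hg, norm_smul, Real.norm_of_nonneg]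
    have := rpow_pos_of_pos hu (-s - 1)
    positivity
  · unfold lap
    refine (Finset.sum_le_sum fun i _ => (aux_dir φ hφ x0 x s hu hmax i).2).trans ?_
    rw [Finset.sum_add_distrib, ← Finset.mul_sum, ← EuclideanSpace.real_norm_sq_eq]
    simp
    apply le_of_eq; ring

theorem aux_pow (A B p q T : ℝ) (hA : 0 < A) (hB : 0 < B) (hp : 0 < p) (hpq : p < q)
    (hT : 0 < T) : A * T ^ p - B * T ^ q ≤ A * (A / B) ^ (p / (q - p)) := by
  have hqp : 0 < q - p := by linarith
  have hAB : 0 < A / B := by positivity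
  have e : T ^ q = T ^ p * T ^ (q - p) := by rw [← rpow_add hT]; congr 1; ring
  have hTp := rpow_pos_of_pos hT p
  rcases le_total (A / B) (T ^ (q - p)) with h | h
  · have h1 : A ≤ T ^ (q - p) * B := (div_le_iff₀ hB).1 h
    have h2 : A * T ^ p - B * T ^ q ≤ 0 := by
      rw [e]; nlinarith
    exact h2.trans (by positivity)
  · have h1 : T ^ p ≤ (A / B) ^ (p / (q - p)) := by
      have : T ^ p = (T ^ (q - p)) ^ (p / (q - p)) := by
        rw [← rpow_mul hT.le]; congr 1; field_simp
      rw [this]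
      exact rpow_le_rpow (by positivity) h (by positivity)
    have h2 : 0 ≤ B * T ^ q := by positivity
    nlinarith

theorem aux_const (d : ℕ) (m s ε : ℝ) (hm : 1 < m) (hs : 0 < s) (hsm : s + 2 < (s + 1) * m)
    (hε : 0 < ε) :
    ∃ C : ℝ, 0 ≤ C ∧ ∀ n : ℝ, 0 ≤ n → 0 < 1 - n ^ 2 →
      4 * s * (s + 1) * (1 - n ^ 2) ^ (-s - 2) * n ^ 2 + 2 * s * d * (1 - n ^ 2) ^ (-s - 1)
        - ε * (2 * s * (1 - n ^ 2) ^ (-s - 1) * n) ^ m ≤ C := by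
  set A : ℝ := 4 * s * (s + 1) + 2 * s * d with hA
  have hAp : 0 < A := by positivity
  set B : ℝ := ε * s ^ m with hB
  have hBp : 0 < B := by positivity
  refine ⟨A * (A / B) ^ ((s + 2) / ((s + 1) * m - (s + 2))) + A * (3 / 4 : ℝ) ^ (-s - 2),
    by positivity, ?_⟩
  intro n hn hu
  set u := 1 - n ^ 2 with hudef
  have hu1 : u ≤ 1 := by nlinarith
  have hP2 := rpow_pos_of_pos hu (-s - 2)
  have hP1 := rpow_pos_of_pos hu (-s - 1)
  have hle : u ^ (-s - 1) ≤ u ^ (-s - 2) := rpow_le_rpow_of_exponent_ge hu hu1 (by linarith)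
  have hfirst : 4 * s * (s + 1) * u ^ (-s - 2) * n ^ 2 + 2 * s * d * u ^ (-s - 1)
      ≤ A * u ^ (-s - 2) := by
    have h1 : n ^ 2 ≤ 1 := by linarith
    have h2 : 4 * s * (s + 1) * u ^ (-s - 2) * n ^ 2 ≤ 4 * s * (s + 1) * u ^ (-s - 2) * 1 := by
      gcongr
    have h3 : 2 * s * d * u ^ (-s - 1) ≤ 2 * s * d * u ^ (-s - 2) := by gcongr
    rw [hA]; linarith
  rcases le_total (1 / 2) n with h | h
  · have h1 : (s * u ^ (-s - 1)) ^ m ≤ (2 * s * u ^ (-s - 1) * n) ^ m := by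
      apply rpow_le_rpow (by positivity) _ (by linarith)
      have : 0 < s * u ^ (-s - 1) := by positivity
      nlinarith
    have h2 : (s * u ^ (-s - 1)) ^ m = s ^ m * (u⁻¹) ^ ((s + 1) * m) := by
      rw [mul_rpow hs.le hP1.le, ← rpow_mul hu.le, inv_rpow hu.le, ← rpow_neg hu.le]
      congr 2; ring
    have h3 : u ^ (-s - 2) = (u⁻¹) ^ (s + 2) := by
      rw [inv_rpow hu.le, ← rpow_neg hu.le]; congr 1; ring
    have h4 := aux_pow A B (s + 2) ((s + 1) * m) u⁻¹ hAp hBp (by linarith) hsm (by positivity)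
    have h5 : 0 ≤ A * (3 / 4 : ℝ) ^ (-s - 2) := by positivity
    have h6 : ε * (s ^ m * (u⁻¹) ^ ((s + 1) * m)) ≤ ε * (2 * s * u ^ (-s - 1) * n) ^ m := by
      rw [← h2]; gcongr
    rw [h3] at hfirst
    rw [h3]
    rw [hB, mul_assoc] at h4
    rw [← hB] at h4
    linarith
  · have h1 : 3 / 4 ≤ u := by nlinarith
    have h2 : u ^ (-s - 2) ≤ (3 / 4 : ℝ) ^ (-s - 2) :=
      rpow_le_rpow_of_nonpos (by norm_num) h1 (by linarith)
    have h3 : 0 ≤ ε * (2 * s * u ^ (-s - 1) * n) ^ m := by positivity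
    have h4 : 0 ≤ A * (A / B) ^ ((s + 2) / ((s + 1) * m - (s + 2))) := by
      have : 0 < A / B := by positivity
      positivity
    have h5 : A * u ^ (-s - 2) ≤ A * (3 / 4 : ℝ) ^ (-s - 2) := by gcongr
    linarith

/-- Upper bound for every subsolution in terms of `b` and `V` on an arbitrary unit ball; the
constant does not depend on the ball. -/
theorem aux_bound (d : ℕ) (m q t : ℝ) (hm : 1 < m) (hq : q = m / (m - 1)) (ht : 1 < t) :
    ∃ C : ℝ, 0 ≤ C ∧ ∀ (b : Euc d → Euc d) (V : Euc d → ℝ) (β lam : ℝ) (φ : Euc d → ℝ)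
      (x0 : Euc d) (P W : ℝ), 0 ≤ β → IsSubsol m b V β lam φ →
      (∀ x, ‖x - x0‖ < 1 → ‖b x‖ ≤ P ∧ V x ≤ W) →
      lam ≤ C + β * W + t ^ q * (P ^ q / q) := by
  have hconj : m.HolderConjugate q := by
    rw [hq]; exact Real.HolderConjugate.conjExponent hm
  have hm0 : 0 < m := by linarith
  have hq0 : 0 < q := hconj.symm.pos
  set s : ℝ := 1 / (m - 1) with hs
  have hm1 : 0 < m - 1 := by linarith
  have hsp : 0 < s := by positivity
  have hsm : s + 2 < (s + 1) * m := by
    have : s * (m - 1) = 1 := by rw [hs]; field_simp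
    nlinarith
  have ht0 : 0 < t := by linarith
  set ε : ℝ := (1 - (t⁻¹) ^ m) / m with hε
  have hεp : 0 < ε := by
    have : (t⁻¹) ^ m < 1 := rpow_lt_one (by positivity) (inv_lt_one_of_one_lt₀ ht) hm0
    have h2 : 0 < 1 - (t⁻¹) ^ m := by linarith
    positivity
  obtain ⟨C, hC0, hC⟩ := aux_const d m s ε hm hsp hsm hεp
  refine ⟨C, hC0, ?_⟩
  intro b V β lam φ x0 P W hβ hsub hball
  obtain ⟨hφ, hineq⟩ := hsub
  obtain ⟨x, hu, hgrad, hlap⟩ := aux_contact φ hφ x0 s hsp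
  have hx1 : ‖x - x0‖ < 1 := by nlinarith [norm_nonneg (x - x0)]
  obtain ⟨hb, hV⟩ := hball x hx1
  have h1 := hineq x
  have h2 := hC ‖x - x0‖ (norm_nonneg _) hu
  rw [← hgrad] at h2
  set p := ‖gradient φ x‖ with hp
  have hp0 : 0 ≤ p := norm_nonneg _
  have h3 : -(‖b x‖ * p) ≤ ⟪b x, gradient φ x⟫ :=
    neg_le_of_abs_le (abs_real_inner_le_norm _ _)
  have h4 : ‖b x‖ * p ≤ P * p := by gcongr
  have hP0 : 0 ≤ P := (norm_nonneg _).trans hb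
  have h5 := Real.young_inequality_of_nonneg (a := t⁻¹ * p) (b := t * P) (by positivity)
    (by positivity) hconj
  rw [mul_rpow (by positivity) hp0, mul_rpow ht0.le hP0] at h5
  have h6 : t⁻¹ * p * (t * P) = P * p := by field_simp
  rw [h6] at h5
  have h7 : β * V x ≤ β * W := by gcongr
  have h8 : ε * p ^ m = 1 / m * p ^ m - (t⁻¹) ^ m * p ^ m / m := by rw [hε]; ring
  have h9 : t ^ q * P ^ q / q = t ^ q * (P ^ q / q) := by ring
  linarith

theorem aux_c0 (q δ ρ η k : ℝ) (hq : 0 < q) (hδ : 0 < δ) (hρ : 0 < ρ) (hη : 0 < η)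
    (hk : k = (η / (ρ ^ q * δ)) ^ (1 / (δ * q + η))) :
    k ^ (-η) + ρ ^ q * k ^ (δ * q) / q
      = ((δ * q + η) / (δ * q)) * (ρ ^ q * δ / η) ^ (η / (δ * q + η)) := by
  have hr := rpow_pos_of_pos hρ q
  have hX : 0 < η / (ρ ^ q * δ) := by positivity
  have hN : 0 < δ * q + η := by positivity
  have hkp : 0 < k := by rw [hk]; positivity
  have e1 : k ^ (-η) = (ρ ^ q * δ / η) ^ (η / (δ * q + η)) := by
    have : ρ ^ q * δ / η = (η / (ρ ^ q * δ))⁻¹ := by rw [inv_div]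
    rw [this, hk, ← rpow_mul hX.le, inv_rpow hX.le, ← rpow_neg hX.le]
    congr 1; ring
  have e2 : k ^ (δ * q) = k ^ (-η) * (η / (ρ ^ q * δ)) := by
    have h1 : k ^ (δ * q + η) = η / (ρ ^ q * δ) := by
      rw [hk, ← rpow_mul hX.le, one_div_mul_cancel hN.ne', rpow_one]
    rw [← h1, ← rpow_add hkp]; congr 1; ring
  rw [e2, ← e1]
  field_simp

theorem aux_G (C q δ ρ η k a κ c : ℝ) (hq : 0 < q) (hδ : 0 < δ) (hρ : 0 < ρ)
    (hk : 0 < k)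
    (hc : k ^ (-η) + κ * (ρ ^ q * k ^ (δ * q) / q) < c) :
    ∀ᶠ w in nhds (0:ℝ), C * w ^ (δ * q) + (k - w) ^ (-η)
      + κ * ((ρ + |a| * (w / (k - w))) ^ q * (k + w) ^ (δ * q) / q) < c := by
  have hδq : 0 < δ * q := by positivity
  have hcont : ContinuousAt (fun w : ℝ => C * w ^ (δ * q) + (k - w) ^ (-η)
      + κ * ((ρ + |a| * (w / (k - w))) ^ q * (k + w) ^ (δ * q) / q)) 0 := by
    have c1 : ContinuousAt (fun w : ℝ => w ^ (δ * q)) 0 :=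
      continuousAt_id.rpow_const (Or.inr hδq.le)
    have c2 : ContinuousAt (fun w : ℝ => (k - w) ^ (-η)) 0 :=
      (by fun_prop : ContinuousAt (fun w : ℝ => k - w) 0).rpow_const
        (Or.inl (by simpa using hk.ne'))
    have c3 : ContinuousAt (fun w : ℝ => w / (k - w)) 0 :=
      continuousAt_id.div (by fun_prop) (by simpa using hk.ne')
    have c4 : ContinuousAt (fun w : ℝ => (ρ + |a| * (w / (k - w))) ^ q) 0 :=
      (continuousAt_const.add (continuousAt_const.mul c3)).rpow_const (Or.inr hq.le)
    have c5 : ContinuousAt (fun w : ℝ => (k + w) ^ (δ * q)) 0 :=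
      (by fun_prop : ContinuousAt (fun w : ℝ => k + w) 0).rpow_const (Or.inr hδq.le)
    exact ((continuousAt_const.mul c1).add c2).add
      (continuousAt_const.mul ((c4.mul c5).div_const q))
  refine hcont.eventually (gt_mem_nhds ?_)
  simpa [zero_rpow hδq.ne'] using hc

/-- Eventual bound for the rescaled eigenvalue. -/
theorem aux_event (d : ℕ) (hd : 1 ≤ d) (m δ ρ R a η : ℝ) (hm : 1 < m)
    (hδ : 0 < δ) (hρ : 0 < ρ) (hη : 0 < η) (q : ℝ) (hq : q = m / (m - 1))
    (b : Euc d → Euc d) (V : Euc d → ℝ) (α : Euc d → ℝ)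
    (hH1 : HypH1 δ ρ R a η b V α) (c : ℝ)
    (hc : ((δ * q + η) / (δ * q)) * (ρ ^ q * δ / η) ^ (η / (δ * q + η)) < c) :
    ∀ᶠ β : ℝ in atTop, β ^ (-(δ * q) / (δ * q + η)) * lamMax m b V β ≤ c := by
  have hq0 : 0 < q := by rw [hq]; exact div_pos (by linarith) (by linarith)
  set N := δ * q + η with hN
  have hNp : 0 < N := by positivity
  set k : ℝ := (η / (ρ ^ q * δ)) ^ (1 / N) with hk
  have hkp : 0 < k := by
    have := rpow_pos_of_pos hρ q
    positivity
  rw [hN, ← aux_c0 q δ ρ η k hq0 hδ hρ hη hk] at hc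
  set D : ℝ := ρ ^ q * k ^ (δ * q) / q with hD
  obtain ⟨t, ht1, htc⟩ : ∃ t : ℝ, 1 < t ∧ k ^ (-η) + t ^ q * D < c := by
    have hcont : ContinuousAt (fun t : ℝ => k ^ (-η) + t ^ q * D) 1 :=
      continuousAt_const.add ((continuousAt_id.rpow_const (Or.inl one_ne_zero)).mul
        continuousAt_const)
    have h1 : ∀ᶠ t in nhds (1:ℝ), k ^ (-η) + t ^ q * D < c :=
      hcont.eventually (gt_mem_nhds (by simpa using hc))
    have h2 : ∀ᶠ t in nhdsWithin (1:ℝ) (Set.Ioi 1), k ^ (-η) + t ^ q * D < c :=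
      h1.filter_mono nhdsWithin_le_nhds
    obtain ⟨t, h3, h4⟩ := (h2.and self_mem_nhdsWithin).exists
    exact ⟨t, h4, h3⟩
  obtain ⟨C, hC0, hC⟩ := aux_bound d m q t hm hq ht1
  have hG := aux_G C q δ ρ η k a (t ^ q) c hq0 hδ hρ hkp htc
  have hw0 : Tendsto (fun β : ℝ => β ^ (-(1 / N))) atTop (nhds 0) :=
    tendsto_rpow_neg_atTop (by positivity)
  have hsmall : ∀ᶠ w in nhds (0:ℝ), w * (|R| + 1) < k := by
    have hcont : ContinuousAt (fun w : ℝ => w * (|R| + 1)) 0 := by fun_prop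
    exact hcont.eventually (gt_mem_nhds (by simpa using hkp))
  filter_upwards [hw0.eventually hG, hw0.eventually hsmall, eventually_gt_atTop 0]
    with β h1 h2 hβ
  set w : ℝ := β ^ (-(1 / N)) with hw
  have hwp : 0 < w := rpow_pos_of_pos hβ _
  have e1 : β ^ (-(δ * q) / N) = w ^ (δ * q) := by
    rw [hw, ← rpow_mul hβ.le]; congr 1; ring
  have e2 : w ^ (δ * q) * β = w ^ (-η) := by
    have : β = w ^ (-N) := by
      rw [hw, ← rpow_mul hβ.le]
      have : -(1 / N) * -N = 1 := by field_simp
      rw [this, rpow_one]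
    rw [this, ← rpow_add hwp]; congr 1; rw [hN]; ring
  set r : ℝ := k / w with hr
  have hrR : |R| + 1 < r := by rw [hr, lt_div_iff₀ hwp]; linarith
  have hr1 : 0 < r - 1 := by linarith [abs_nonneg R]
  have hkw : k = r * w := by rw [hr]; field_simp
  set x0 : Euc d := EuclideanSpace.single (⟨0, by omega⟩ : Fin d) r with hx0
  have hx0n : ‖x0‖ = r := by
    rw [hx0, EuclideanSpace.norm_single, Real.norm_of_nonneg (by linarith)]
  set W : ℝ := (r - 1) ^ (-η) with hW
  set P : ℝ := (ρ + |a| / (r - 1)) * (r + 1) ^ δ with hP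
  have hball : ∀ x, ‖x - x0‖ < 1 → ‖b x‖ ≤ P ∧ V x ≤ W := by
    intro x hx
    have hlo : r - 1 ≤ ‖x‖ := by
      have := norm_sub_norm_le x0 x
      rw [norm_sub_rev] at this; linarith
    have hhi : ‖x‖ ≤ r + 1 := by
      have := norm_sub_norm_le x x0
      linarith
    have hRx : R ≤ ‖x‖ := by linarith [le_abs_self R]
    have hxp : 0 < ‖x‖ := by linarith
    obtain ⟨⟨-, -, -, -, hb, -⟩, hαV⟩ := hH1
    obtain ⟨hα, hV⟩ := hαV x hRx
    refine ⟨?_, ?_⟩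
    · rw [hb x hRx, hα, norm_smul, norm_mul, Real.norm_of_nonneg (rpow_nonneg hxp.le _),
        mul_assoc]
      have e3 : ‖x‖ ^ (δ - 1) * ‖x‖ = ‖x‖ ^ δ := by
        rw [rpow_sub_one hxp.ne']; field_simp
      rw [e3, hP]
      have h5 : ‖ρ + a * ‖x‖⁻¹‖ ≤ ρ + |a| / (r - 1) := by
        refine (norm_add_le _ _).trans ?_
        rw [Real.norm_of_nonneg hρ.le, norm_mul, Real.norm_eq_abs,
          Real.norm_of_nonneg (inv_nonneg.2 hxp.le), div_eq_mul_inv]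
        gcongr
      have h6 : ‖x‖ ^ δ ≤ (r + 1) ^ δ := rpow_le_rpow hxp.le hhi hδ.le
      gcongr
    · rw [hV, hW]
      exact rpow_le_rpow_of_nonpos hr1 hlo (by linarith)
  have hPn : 0 ≤ P := by positivity
  have hlam : lamMax m b V β ≤ C + β * W + t ^ q * (P ^ q / q) := by
    unfold lamMax
    refine Real.sSup_le ?_ (by positivity)
    rintro lam ⟨φ, hφ⟩
    exact hC b V β lam φ x0 P W hβ.le hφ hball
  rw [e1]
  refine le_trans (mul_le_mul_of_nonneg_left hlam (by positivity)) (le_trans (le_of_eq ?_) h1.le)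
  have f1 : w ^ (δ * q) * (β * W) = (k - w) ^ (-η) := by
    rw [← mul_assoc, e2, hW, ← mul_rpow hwp.le hr1.le]
    congr 1; rw [hkw]; ring
  have f2 : w ^ (δ * q) * P ^ q
      = (ρ + |a| * (w / (k - w))) ^ q * (k + w) ^ (δ * q) := by
    rw [hP, mul_rpow (by positivity) (by positivity),
      ← rpow_mul (show (0:ℝ) ≤ r + 1 by linarith)]
    have g1 : |a| / (r - 1) = |a| * (w / (k - w)) := by
      rw [hkw]
      have : r * w - w = (r - 1) * w := by ring
      rw [this]; field_simp
    have g2 : (k + w) ^ (δ * q) = w ^ (δ * q) * (r + 1) ^ (δ * q) := by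
      rw [← mul_rpow hwp.le (by positivity)]; congr 1; rw [hkw]; ring
    rw [g1, g2]; ring
  rw [← f1, ← f2]; ring

/-- upper bound for the asymptotics of `λ_max(β)` in the strong drift case. -/
theorem stmt2 (d : ℕ) (hd : 1 ≤ d) (m δ ρ R a η : ℝ) (hm : 1 < m)
    (hδ : 0 < δ) (hρ : 0 < ρ) (hη : 0 < η) (hR : 0 < R)
    (mst : ℝ) (hmst : mst = m / (m - 1))
    (c₀ : ℝ) (hc₀ : c₀ = ((δ * mst + η) / (δ * mst)) * (ρ ^ mst * δ / η) ^ (η / (δ * mst + η)))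
    (b : Euc d → Euc d) (V : Euc d → ℝ) (α : Euc d → ℝ)
    (hH1 : HypH1 δ ρ R a η b V α) :
    Filter.limsup (fun β : ℝ => β ^ (-(δ * mst) / (δ * mst + η)) * lamMax m b V β)
      atTop ≤ c₀ := by
  subst hc₀
  have hq0 : 0 < mst := by rw [hmst]; exact div_pos (by linarith) (by linarith)
  set c₀ := ((δ * mst + η) / (δ * mst)) * (ρ ^ mst * δ / η) ^ (η / (δ * mst + η)) with hc
  have hc0 : 0 ≤ c₀ := by
    have := rpow_pos_of_pos hρ mst
    positivity
  refine le_of_forall_gt_imp_ge_of_dense fun c hcc => ?_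
  have hev := aux_event d hd m δ ρ R a η hm hδ hρ hη mst hmst b V α hH1 c hcc
  rw [Filter.limsup_eq]
  by_cases hbd : BddBelow {x : ℝ | ∀ᶠ β : ℝ in atTop,
      β ^ (-(δ * mst) / (δ * mst + η)) * lamMax m b V β ≤ x}
  · exact csInf_le hbd hev
  · rw [Real.sInf_of_not_bddBelow hbd]
    linarith

end
end

section
/- Let d ≥ 1, m > 1, and suppose (b,V) satisfies hypothesis (H0) with parameter δ > 0 and constants ρ > 0, R > 0. Assume moreover that α(x) = a|x|^{−1} for all x ∉ B_R for some a ∈ ℝ, and that the support of V is contained in B_{R'} for some R' > R. Then the limit λ̄_max := lim_{β→∞} λ_max(β) is finite. -/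
open Filter Real RealInnerProductSpace

noncomputable section

/-- Second-derivative necessary condition at a local max. -/
theorem snd_deriv_le {g g' : ℝ → ℝ} {g'' : ℝ} (hg : ∀ᶠ t in nhds 0, HasDerivAt g (g' t) t)
    (hg' : HasDerivAt g' g'' 0) (hmax : IsLocalMax g 0) : g' 0 = 0 ∧ g'' ≤ 0 := by
  have h0 : g' 0 = 0 := hmax.hasDerivAt_eq_zero hg.self_of_nhds
  refine ⟨h0, ?_⟩
  by_contra hpos
  push Not at hpos
  have hd : deriv g =ᶠ[nhds 0] g' := hg.mono fun t ht => ht.deriv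
  have hdd : deriv (deriv g) 0 = g'' := by rw [hd.deriv_eq, hg'.deriv]
  have hmin : IsLocalMin g 0 := by
    apply isLocalMin_of_deriv_deriv_pos
    · rw [hdd]; exact hpos
    · rw [hd.self_of_nhds, h0]
    · exact hg.self_of_nhds.continuousAt
  have hconst : g =ᶠ[nhds 0] fun _ => g 0 := by
    filter_upwards [hmax, hmin] with t h1 h2
    exact le_antisymm h1 h2
  have h1 : deriv g =ᶠ[nhds 0] fun _ => 0 := by
    have := hconst.deriv
    simpa using this
  have h2 : deriv (deriv g) 0 = 0 := by rw [h1.deriv_eq]; simp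
  linarith

/-- Derivatives of `u⁻¹ ^ n` along a coordinate line. -/
theorem line_deriv (n : ℕ) (U p : ℝ) (hU : 0 < U) :
    (∀ᶠ t in nhds (0:ℝ), HasDerivAt (fun t : ℝ => ((U - 2 * t * p - t ^ 2)⁻¹) ^ (n+1))
      ((n+1) * ((U - 2 * t * p - t ^ 2)⁻¹) ^ (n+2) * (2 * p + 2 * t)) t) ∧
    HasDerivAt (fun t : ℝ => (n+1) * ((U - 2 * t * p - t ^ 2)⁻¹) ^ (n+2) * (2 * p + 2 * t))
      ((n+1) * (n+2) * 4 * p ^ 2 * (U⁻¹) ^ (n+3) + 2 * (n+1) * (U⁻¹) ^ (n+2)) 0 := by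
  have key : ∀ t : ℝ, HasDerivAt (fun t : ℝ => U - 2 * t * p - t ^ 2) (-(2 * p + 2 * t)) t := by
    intro t
    have h := (((((hasDerivAt_id t).const_mul 2).mul_const p).const_sub U).sub
      ((hasDerivAt_id t).pow 2))
    refine h.congr_deriv ?_
    simp; ring
  have key2 : ∀ t : ℝ, U - 2 * t * p - t ^ 2 ≠ 0 → ∀ k : ℕ,
      HasDerivAt (fun t : ℝ => ((U - 2 * t * p - t ^ 2)⁻¹) ^ (k+1))
      ((k+1) * ((U - 2 * t * p - t ^ 2)⁻¹) ^ (k+2) * (2 * p + 2 * t)) t := by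
    intro t ht k
    have h := ((key t).inv ht).pow (k+1)
    refine h.congr_deriv ?_
    simp only [Pi.inv_apply, Nat.add_sub_cancel]
    push_cast
    rw [div_eq_mul_inv, ← inv_pow]
    generalize (U - 2 * t * p - t ^ 2)⁻¹ = z
    ring
  constructor
  · have hc : ContinuousAt (fun t : ℝ => U - 2 * t * p - t ^ 2) 0 := (key 0).continuousAt
    have : ∀ᶠ t in nhds (0:ℝ), U - 2 * t * p - t ^ 2 ≠ 0 :=
      hc.eventually_ne (by simpa using hU.ne')
    filter_upwards [this] with t ht
    exact key2 t ht n
  · have h1 := (key2 0 (by simpa using hU.ne') (n+1)).const_mul ((n:ℝ)+1)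
    have h2 : HasDerivAt (fun t : ℝ => 2 * p + 2 * t) 2 0 := by
      have h := ((hasDerivAt_id (0:ℝ)).const_mul 2).const_add (2 * p)
      simpa using h
    have h := h1.mul h2
    refine h.congr_deriv ?_
    push_cast
    simp
    ring

theorem norm_sq_line {d : ℕ} (q : Euc d) (i : Fin d) (t : ℝ) :
    ‖q + t • EuclideanSpace.single i (1:ℝ)‖ ^ 2 = ‖q‖ ^ 2 + 2 * t * q i + t ^ 2 := by
  rw [norm_add_sq_real, inner_smul_right, EuclideanSpace.inner_single_right, norm_smul]
  simp
  ring

/-- Derivatives of a `C³` function along a coordinate line. -/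
theorem phi_line {d : ℕ} (φ : Euc d → ℝ) (hφ : ContDiff ℝ 3 φ) (x : Euc d) (i : Fin d) :
    (∀ t : ℝ, HasDerivAt (fun t : ℝ => φ (x + t • EuclideanSpace.single i (1:ℝ)))
      (fderiv ℝ φ (x + t • EuclideanSpace.single i (1:ℝ)) (EuclideanSpace.single i 1)) t) ∧
    HasDerivAt (fun t : ℝ => fderiv ℝ φ (x + t • EuclideanSpace.single i (1:ℝ))
        (EuclideanSpace.single i 1))
      (fderiv ℝ (fun y => fderiv ℝ φ y (EuclideanSpace.single i 1)) x
        (EuclideanSpace.single i 1)) 0 := by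
  have hl : ∀ t : ℝ, HasDerivAt (fun t : ℝ => x + t • EuclideanSpace.single i (1:ℝ))
      (EuclideanSpace.single i (1:ℝ)) t := by
    intro t
    have h := ((hasDerivAt_id t).smul_const (EuclideanSpace.single i (1:ℝ))).const_add x
    simpa using h
  constructor
  · intro t
    have h1 : DifferentiableAt ℝ φ (x + t • EuclideanSpace.single i (1:ℝ)) :=
      (hφ.differentiable (by norm_num)).differentiableAt
    exact h1.hasFDerivAt.comp_hasDerivAt t (hl t)
  · have h2 : ContDiff ℝ 2 (fun y => fderiv ℝ φ y (EuclideanSpace.single i (1:ℝ))) :=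
      (hφ.fderiv_right (by norm_num)).clm_apply contDiff_const
    have h3 : DifferentiableAt ℝ (fun y => fderiv ℝ φ y (EuclideanSpace.single i (1:ℝ)))
        (x + (0:ℝ) • EuclideanSpace.single i (1:ℝ)) :=
      (h2.differentiable (by norm_num)).differentiableAt
    have h := h3.hasFDerivAt.comp_hasDerivAt (0:ℝ) (hl 0)
    simpa [Function.comp_def] using h

/-- At a touching point of `φ - w` we control gradient and Laplacian. -/
theorem touching {d : ℕ} (φ : Euc d → ℝ) (hφ : ContDiff ℝ 3 φ) (x0 : Euc d) (n : ℕ) :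
    ∃ x : Euc d, ‖x - x0‖ < 1 ∧
      gradient φ x = (2 * ((n:ℝ)+1) * ((1 - ‖x - x0‖ ^ 2)⁻¹) ^ (n+2)) • (x - x0) ∧
      lap φ x ≤ (n+1) * (n+2) * 4 * ‖x - x0‖ ^ 2 * ((1 - ‖x - x0‖ ^ 2)⁻¹) ^ (n+3)
        + d * (2 * (n+1) * ((1 - ‖x - x0‖ ^ 2)⁻¹) ^ (n+2)) := by
  obtain ⟨M, hM⟩ := (isCompact_closedBall x0 1).exists_bound_of_continuousOn
    hφ.continuous.continuousOn
  have hM0 : 0 ≤ M := (norm_nonneg _).trans (hM x0 (by simp))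
  set ε : ℝ := (2 * M + 2)⁻¹ with hε
  have hε0 : 0 < ε := by positivity
  have hε1 : ε < 1 := by rw [hε]; apply inv_lt_one_of_one_lt₀; linarith
  set K : Set (Euc d) := {y | ‖y - x0‖ ^ 2 ≤ 1 - ε} with hK
  have hKsub : K ⊆ Metric.closedBall x0 1 := by
    intro y hy
    rw [Metric.mem_closedBall, dist_eq_norm]
    have : ‖y - x0‖ ^ 2 ≤ 1 - ε := hy
    nlinarith [norm_nonneg (y - x0)]
  have hKc : IsCompact K := (isCompact_closedBall x0 1).of_isClosed_subset
    (isClosed_le (by fun_prop) (by fun_prop)) hKsub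
  have hx0K : x0 ∈ K := by simp [hK]; linarith
  set F : Euc d → ℝ := fun y => φ y - ((1 - ‖y - x0‖ ^ 2)⁻¹) ^ (n+1) with hF
  have hFc : ContinuousOn F K := by
    apply hφ.continuous.continuousOn.sub
    apply ContinuousOn.pow
    apply ContinuousOn.inv₀
    · fun_prop
    · intro y hy
      have : ‖y - x0‖ ^ 2 ≤ 1 - ε := hy
      linarith
  obtain ⟨x, hxK, hx⟩ := hKc.exists_isMaxOn ⟨x0, hx0K⟩ hFc
  have hxle : ‖x - x0‖ ^ 2 ≤ 1 - ε := hxK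
  have hlt : ‖x - x0‖ ^ 2 < 1 - ε := by
    rcases hxle.lt_or_eq with h | h
    · exact h
    exfalso
    have h1 : F x0 ≤ F x := hx hx0K
    have h2 : (2 * M + 2) ≤ (2 * M + 2) ^ (n+1) := le_self_pow₀ (by linarith) (by omega)
    have h3 := abs_le.1 (hM x (hKsub hxK))
    have h4 := abs_le.1 (hM x0 (by simp))
    simp only [hF, h] at h1
    simp [hε] at h1
    linarith [h3.2, h4.1]
  have hmaxx : IsLocalMax F x := by
    have : K ∈ nhds x := by
      have : {y : Euc d | ‖y - x0‖ ^ 2 < 1 - ε} ∈ nhds x :=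
        (isOpen_lt (by fun_prop) (by fun_prop)).mem_nhds hlt
      exact Filter.mem_of_superset this fun y (hy : ‖y - x0‖ ^ 2 < 1 - ε) => (le_of_lt hy : ‖y - x0‖ ^ 2 ≤ 1 - ε)
    exact hx.isLocalMax this
  have hU : 0 < 1 - ‖x - x0‖ ^ 2 := by linarith
  have hline : ∀ i : Fin d,
      fderiv ℝ φ x (EuclideanSpace.single i 1)
        = (n+1) * ((1 - ‖x - x0‖ ^ 2)⁻¹) ^ (n+2) * (2 * (x - x0) i) ∧
      fderiv ℝ (fun y => fderiv ℝ φ y (EuclideanSpace.single i 1)) x (EuclideanSpace.single i 1)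
        ≤ (n+1) * (n+2) * 4 * ((x - x0) i) ^ 2 * ((1 - ‖x - x0‖ ^ 2)⁻¹) ^ (n+3)
          + 2 * (n+1) * ((1 - ‖x - x0‖ ^ 2)⁻¹) ^ (n+2) := by
    intro i
    obtain ⟨hp1, hp2⟩ := phi_line φ hφ x i
    obtain ⟨hw1, hw2⟩ := line_deriv n (1 - ‖x - x0‖ ^ 2) ((x - x0) i) hU
    have hcomp : IsLocalMax (fun t : ℝ => φ (x + t • EuclideanSpace.single i (1:ℝ)) -
        ((1 - ‖x - x0‖ ^ 2 - 2 * t * (x - x0) i - t ^ 2)⁻¹) ^ (n+1)) 0 := by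
      have hFe : (fun t : ℝ => φ (x + t • EuclideanSpace.single i (1:ℝ)) -
        ((1 - ‖x - x0‖ ^ 2 - 2 * t * (x - x0) i - t ^ 2)⁻¹) ^ (n+1))
          = F ∘ (fun t : ℝ => x + t • EuclideanSpace.single i (1:ℝ)) := by
        funext t
        simp only [hF, Function.comp]
        rw [add_sub_right_comm, norm_sq_line]
        congr 3
        ring
      rw [hFe]
      apply IsLocalMax.comp_continuous
      · simpa using hmaxx
      · fun_prop
    have := snd_deriv_le (hw1.mono fun t ht => (hp1 t).sub ht) (hp2.sub hw2) hcomp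
    simp only [Pi.sub_apply] at this
    constructor
    · have h := this.1
      simp at h
      simp
      linarith
    · linarith [this.2]
  refine ⟨x, by nlinarith [norm_nonneg (x - x0)], ?_, ?_⟩
  · ext i
    have h1 : (gradient φ x) i = fderiv ℝ φ x (EuclideanSpace.single i 1) := by
      rw [gradient, ← InnerProductSpace.toDual_symm_apply, EuclideanSpace.inner_single_right]
      simp
    rw [h1, (hline i).1]
    simp
    ring
  · unfold lap
    calc _ ≤ ∑ i : Fin d, ((n+1) * (n+2) * 4 * ((x - x0) i) ^ 2 * ((1 - ‖x - x0‖ ^ 2)⁻¹) ^ (n+3)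
          + 2 * (n+1) * ((1 - ‖x - x0‖ ^ 2)⁻¹) ^ (n+2)) := Finset.sum_le_sum fun i _ => (hline i).2
      _ = _ := by
        rw [Finset.sum_add_distrib, ← Finset.sum_mul, ← Finset.mul_sum,
          ← EuclideanSpace.real_norm_sq_eq]
        simp

/-- Uniform bound for the eigenvalue of a subsolution, independent of `β`. -/
theorem unif_bound {d : ℕ} (m : ℝ) (hm : 1 < m) (b : Euc d → Euc d) (hb : Continuous b)
    (V : Euc d → ℝ) (x0 : Euc d) (hV : ∀ x, ‖x - x0‖ < 1 → V x = 0) :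
    ∃ C : ℝ, ∀ β lam : ℝ, ∀ φ : Euc d → ℝ, IsSubsol m b V β lam φ → lam ≤ C := by
  obtain ⟨B, hB⟩ := (isCompact_closedBall x0 1).exists_bound_of_continuousOn hb.continuousOn
  have hB0 : 0 ≤ B := (norm_nonneg _).trans (hB x0 (by simp))
  obtain ⟨n, hn⟩ := exists_nat_gt (2 / (m - 1))
  have hn' : (n:ℝ) + 4 ≤ (n + 2) * m := by
    rw [div_lt_iff₀ (by linarith)] at hn
    linarith
  set A : ℝ := (n+1) * (n+2) * 4 + d * (2 * (n+1)) + B * (2 * (n+1)) with hA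
  have hA0 : 0 ≤ A := by positivity
  refine ⟨A * 2 ^ (n+3) + A * (m * A) ^ (n+3), ?_⟩
  intro β lam φ ⟨hφ, hsub⟩
  obtain ⟨x, hx1, hgrad, hlap⟩ := touching φ hφ x0 n
  have hs := hsub x
  rw [hV x hx1] at hs
  set s := ‖x - x0‖ with hsdef
  have hs0 : 0 ≤ s := norm_nonneg _
  have hu : 0 < 1 - s ^ 2 := by nlinarith
  set y := (1 - s ^ 2)⁻¹ with hy
  have hy1 : 1 ≤ y := by
    rw [hy]; apply (one_le_inv₀ hu).2; nlinarith
  have hnorm : ‖gradient φ x‖ = 2 * (n+1) * y ^ (n+2) * s := by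
    rw [hgrad, norm_smul, Real.norm_of_nonneg (by positivity)]
  have hinner : -(B * (2 * (n+1) * y ^ (n+2) * s)) ≤ ⟪b x, gradient φ x⟫ := by
    have h1 := (abs_le.1 (abs_real_inner_le_norm (b x) (gradient φ x))).1
    have h2 : ‖b x‖ ≤ B := hB x (by rw [Metric.mem_closedBall, dist_eq_norm]; exact hx1.le)
    have h3 : ‖b x‖ * ‖gradient φ x‖ ≤ B * ‖gradient φ x‖ := by gcongr
    rw [hnorm] at h1 h3
    linarith
  have hyy : y ^ (n+2) ≤ y ^ (n+3) := pow_le_pow_right₀ hy1 (by omega)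
  have hyp : 0 < y ^ (n+2) := by positivity
  have hs2 : s ^ 2 ≤ 1 := by nlinarith
  have hmain : lam ≤ A * y ^ (n+3) - 1 / m * ‖gradient φ x‖ ^ m := by
    have e1 : ((n:ℝ)+1) * (n+2) * 4 * s ^ 2 * y ^ (n+3) ≤ (n+1) * (n+2) * 4 * 1 * y ^ (n+3) := by
      gcongr
    have e2 : (d:ℝ) * (2 * (n+1) * y ^ (n+2)) ≤ d * (2 * (n+1) * y ^ (n+3)) := by gcongr
    have e3 : B * (2 * (n+1) * y ^ (n+2) * s) ≤ B * (2 * (n+1) * y ^ (n+3) * 1) := by gcongr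
    rw [hA]
    linarith
  have hg0 : 0 ≤ 1 / m * ‖gradient φ x‖ ^ m := by positivity
  rcases le_total y 2 with h2 | h2
  · have e1 : A * y ^ (n+3) ≤ A * 2 ^ (n+3) := by gcongr
    have e2 : 0 ≤ A * (m * A) ^ (n+3) := by positivity
    linarith
  have hge : y ^ (n+4) ≤ ‖gradient φ x‖ ^ m := by
    have hyu : y * (1 - s ^ 2) = 1 := by rw [hy]; field_simp
    have hs12 : 1 / 2 ≤ s := by nlinarith
    have e1 : y ^ (n+2) ≤ ‖gradient φ x‖ := by
      rw [hnorm]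
      have : 1 ≤ 2 * ((n:ℝ)+1) * s := by nlinarith [(Nat.cast_nonneg n : (0:ℝ) ≤ n)]
      nlinarith
    calc y ^ (n+4) = y ^ ((n:ℝ)+4) := by rw [← Real.rpow_natCast]; push_cast; rfl
      _ ≤ y ^ (((n:ℝ)+2) * m) := Real.rpow_le_rpow_of_exponent_le hy1 hn'
      _ = (y ^ (n+2)) ^ m := by
        rw [Real.rpow_mul (by linarith), ← Real.rpow_natCast y (n+2)]; push_cast; rfl
      _ ≤ _ := Real.rpow_le_rpow hyp.le e1 (by linarith)
  have hmain2 : lam ≤ y ^ (n+3) * (A - 1 / m * y) := by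
    have : 1 / m * y ^ (n+4) ≤ 1 / m * ‖gradient φ x‖ ^ m := by gcongr
    calc lam ≤ A * y ^ (n+3) - 1 / m * y ^ (n+4) := by linarith
      _ = _ := by ring
  have p1 : 0 ≤ A * 2 ^ (n+3) := by positivity
  have p2 : 0 ≤ A * (m * A) ^ (n+3) := by positivity
  rcases le_total y (m * A) with h3 | h3
  · have : A * y ^ (n+3) ≤ A * (m * A) ^ (n+3) := by gcongr
    linarith
  · have : A - 1 / m * y ≤ 0 := by
      have : A ≤ y / m := by rw [le_div_iff₀ (by linarith)]; linarith
      rw [one_div, inv_mul_eq_div]; linarith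
    have : y ^ (n+3) * (A - 1 / m * y) ≤ 0 := mul_nonpos_of_nonneg_of_nonpos (by positivity) this
    linarith

/-- finiteness of the limit of `λ_max(β)` for strong drift and compactly
supported potential. -/
theorem stmt3 (d : ℕ) (hd : 1 ≤ d) (m δ ρ R a R' : ℝ) (hm : 1 < m)
    (hδ : 0 < δ) (hρ : 0 < ρ) (hR : 0 < R)
    (b : Euc d → Euc d) (V : Euc d → ℝ) (α : Euc d → ℝ)
    (hH0 : HypH0 δ ρ R b V α)
    (hα : ∀ x : Euc d, R ≤ ‖x‖ → α x = a * ‖x‖⁻¹)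
    (hR' : R < R') (hsupp : Function.support V ⊆ Metric.ball (0 : Euc d) R') :
    ∃ L : ℝ, Tendsto (fun β : ℝ => lamMax m b V β) atTop (nhds L) := by
  obtain ⟨hb, -, -, -, -, -, hV0, -, -⟩ := hH0
  set x0 : Euc d := EuclideanSpace.single ⟨0, hd⟩ (R' + 1) with hx0
  have hx0n : ‖x0‖ = R' + 1 := by
    rw [hx0, EuclideanSpace.norm_single, Real.norm_of_nonneg (by linarith)]
  have hV : ∀ x, ‖x - x0‖ < 1 → V x = 0 := by
    intro x hx
    by_contra hne
    have h1 := hsupp (Function.mem_support.2 hne)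
    rw [mem_ball_zero_iff] at h1
    have h2 := norm_sub_norm_le x0 x
    rw [norm_sub_rev] at h2
    linarith
  obtain ⟨C, hC⟩ := unif_bound m hm b hb.continuous V x0 hV
  set S : ℝ → Set ℝ := fun β => {lam : ℝ | ∃ φ : Euc d → ℝ, IsSubsol m b V β lam φ} with hS
  have hbdd : ∀ β, BddAbove (S β) := fun β => ⟨C, fun lam ⟨φ, h⟩ => hC β lam φ h⟩
  have hsub : ∀ β β', β ≤ β' → S β ⊆ S β' := by
    rintro β β' hle lam ⟨φ, h1, h2⟩
    refine ⟨φ, h1, fun x => ?_⟩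
    have := mul_le_mul_of_nonneg_right hle (hV0 x)
    linarith [h2 x]
  have hzero : (0:ℝ) ∈ S 0 := by
    refine ⟨fun _ => 0, contDiff_const, fun x => ?_⟩
    have hg : gradient (fun _ : Euc d => (0:ℝ)) x = 0 := by simp [gradient]
    rw [hg]
    simp [lap, Real.zero_rpow (by linarith : m ≠ 0)]
  have hne : ∀ β, 0 ≤ β → (S β).Nonempty := fun β hβ => ⟨0, hsub 0 β hβ hzero⟩
  have hmono : Monotone (fun β : ℝ => lamMax m b V (max β 0)) := by
    intro β β' hle
    exact csSup_le_csSup (hbdd _) (hne _ (le_max_right _ _)) (hsub _ _ (max_le_max_right 0 hle))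
  have hB : BddAbove (Set.range (fun β : ℝ => lamMax m b V (max β 0))) := by
    refine ⟨C, ?_⟩
    rintro _ ⟨β, rfl⟩
    exact csSup_le (hne _ (le_max_right _ _)) fun lam ⟨φ, h⟩ => hC _ lam φ h
  refine ⟨_, (tendsto_atTop_ciSup hmono hB).congr' ?_⟩
  filter_upwards [eventually_ge_atTop 0] with β hβ
  rw [max_eq_left hβ]

end
end

section
/- Let d ≥ 1, m > 1, m* = m/(m−1), and suppose (b,V) satisfies hypothesis (H0) with parameter δ = 0 and constants ρ > 0, R > 0. Then λ_max(β) ≤ ρ^{m*}/m* for every β ≥ 0. -/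
open Filter Real RealInnerProductSpace

noncomputable section

/-- Second order necessary condition at an interior maximum in one variable. -/
theorem second_order_max (v v' : ℝ → ℝ) (v2 : ℝ)
    (h1 : ∀ᶠ t in nhds (0:ℝ), HasDerivAt v (v' t) t) (h2 : HasDerivAt v' v2 0)
    (hmax : IsLocalMax v 0) : v' 0 = 0 ∧ v2 ≤ 0 := by
  have h10 : HasDerivAt v (v' 0) 0 := h1.self_of_nhds
  have e1 : deriv v =ᶠ[nhds 0] v' := h1.mono fun t ht => ht.deriv
  have e2 : deriv (deriv v) 0 = v2 := by rw [e1.deriv_eq, h2.deriv]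
  refine ⟨hmax.hasDerivAt_eq_zero h10, ?_⟩
  by_contra! hpos
  have hmin : IsLocalMin v 0 := by
    apply isLocalMin_of_deriv_deriv_pos (by rw [e2]; exact hpos)
    · exact hmax.deriv_eq_zero
    · exact h10.continuousAt
  have hc : v =ᶠ[nhds 0] fun _ => v 0 := by
    filter_upwards [hmax, hmin] with t a b
    exact le_antisymm a b
  have h3 : deriv v =ᶠ[nhds 0] deriv (fun _ => v 0) := hc.deriv
  rw [h3.deriv_eq] at e2
  simp at e2
  linarith

/-- Derivatives of the barrier along a line. -/
theorem barrier_deriv (k : ℕ) (r h a : ℝ) (hr : 0 < r) (hh : 0 < h) :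
    ∃ g' : ℝ → ℝ,
      (∀ᶠ t in nhds (0:ℝ), HasDerivAt
        (fun t => r * ((h - (2 * t * a + t ^ 2) / r ^ 2)⁻¹) ^ (k+1)) (g' t) t) ∧
      g' 0 = (k+1) * (h⁻¹) ^ (k+2) * (2 * a / r) ∧
      HasDerivAt g' ((k+1) * (k+2) * (h⁻¹) ^ (k+3) * (4 * a ^ 2 / r ^ 3)
        + (k+1) * (h⁻¹) ^ (k+2) * (2 / r)) 0 := by
  have hP : ∀ t : ℝ, HasDerivAt (fun t => h - (2 * t * a + t ^ 2) / r ^ 2)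
      (-(2 * a + 2 * t) / r ^ 2) t := by
    intro t
    have := ((((hasDerivAt_id t).const_mul 2).mul_const a).add (hasDerivAt_pow 2 t)).div_const (r^2)
    have := this.const_sub h
    refine this.congr_deriv ?_
    simp; ring
  have hinv : ∀ t : ℝ, h - (2 * t * a + t ^ 2) / r ^ 2 ≠ 0 →
      HasDerivAt (fun t => (h - (2 * t * a + t ^ 2) / r ^ 2)⁻¹)
      (((h - (2 * t * a + t ^ 2) / r ^ 2)⁻¹) ^ 2 * ((2 * a + 2 * t) / r ^ 2)) t := by
    intro t ht
    have := (hP t).inv ht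
    refine this.congr_deriv ?_
    field_simp
  refine ⟨fun t => r * ((k+1) * ((h - (2 * t * a + t ^ 2) / r ^ 2)⁻¹) ^ (k+2)
      * ((2 * a + 2 * t) / r ^ 2)), ?_, ?_, ?_⟩
  · have hne : ∀ᶠ t in nhds (0:ℝ), h - (2 * t * a + t ^ 2) / r ^ 2 ≠ 0 := by
      apply (hP 0).continuousAt.eventually_ne
      simpa using hh.ne'
    filter_upwards [hne] with t ht
    have := ((hinv t ht).pow (k+1)).const_mul r
    refine this.congr_deriv ?_
    push_cast
    ring
  · simp
    field_simp
  · have h0 : h - (2 * (0:ℝ) * a + 0 ^ 2) / r ^ 2 ≠ 0 := by simpa using hh.ne'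
    have hl : HasDerivAt (fun t : ℝ => (2 * a + 2 * t) / r ^ 2) (2 / r ^ 2) 0 := by
      have := (((hasDerivAt_id (0:ℝ)).const_mul 2).const_add (2*a)).div_const (r^2)
      simpa using this
    have := (((((hinv 0 h0).pow (k+2)).const_mul ((k:ℝ)+1)).mul hl)).const_mul r
    refine this.congr_deriv ?_
    push_cast
    have e : k + 2 - 1 = k + 1 := by omega
    simp [e]
    field_simp
    ring

/-- The point where `φ` minus the barrier is maximal. -/
theorem touching_s4 {d : ℕ} (φ : Euc d → ℝ) (hφ : Continuous φ) (k : ℕ) (r : ℝ) (hr : 0 < r)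
    (x0 : Euc d) :
    ∃ z : Euc d, 0 < 1 - ‖z - x0‖ ^ 2 / r ^ 2 ∧
      IsLocalMax (fun x => φ x - r * ((1 - ‖x - x0‖ ^ 2 / r ^ 2)⁻¹) ^ (k+1)) z := by
  obtain ⟨M, hM⟩ := (isCompact_closedBall x0 r).exists_bound_of_continuousOn hφ.continuousOn
  have hM0 : 0 ≤ M := (norm_nonneg _).trans (hM x0 (by simp [hr.le]))
  set h : Euc d → ℝ := fun x => 1 - ‖x - x0‖ ^ 2 / r ^ 2 with hh
  have hc : Continuous h := by fun_prop
  set N : ℝ := (2 * M + r + 1) / r + 1 with hN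
  have hN1 : 1 < N := by
    have : 0 < (2 * M + r + 1) / r := by positivity
    linarith
  have hsub : ∀ x, N⁻¹ ≤ h x → x ∈ Metric.closedBall x0 r := by
    intro x hx
    have h0 : 0 < N⁻¹ := by positivity
    have : 0 < 1 - ‖x - x0‖ ^ 2 / r ^ 2 := lt_of_lt_of_le h0 hx
    have h2 : ‖x - x0‖ ^ 2 < r ^ 2 := by
      have : ‖x - x0‖ ^ 2 / r ^ 2 < 1 := by linarith
      rwa [div_lt_one (by positivity)] at this
    rw [Metric.mem_closedBall, dist_eq_norm]
    exact (le_abs_self _).trans (abs_le_of_sq_le_sq h2.le hr.le)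
  have hK : IsCompact {x | N⁻¹ ≤ h x} :=
    (isCompact_closedBall x0 r).of_isClosed_subset (isClosed_le continuous_const hc) hsub
  have hx0 : h x0 = 1 := by simp [hh]
  have hx0K : x0 ∈ {x | N⁻¹ ≤ h x} := by
    simp only [Set.mem_ofPred_eq, hx0]
    exact inv_le_one_of_one_le₀ hN1.le
  have hcont : ContinuousOn (fun x => φ x - r * ((h x)⁻¹) ^ (k+1)) {x | N⁻¹ ≤ h x} := by
    apply hφ.continuousOn.sub
    apply continuousOn_const.mul
    apply ContinuousOn.pow
    apply hc.continuousOn.inv₀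
    intro x hx
    have : 0 < N⁻¹ := by positivity
    exact (lt_of_lt_of_le this hx).ne'
  obtain ⟨z, hzK, hz⟩ := hK.exists_isMaxOn ⟨x0, hx0K⟩ hcont
  have hzpos : 0 < h z := lt_of_lt_of_le (by positivity) hzK
  refine ⟨z, hzpos, ?_⟩
  have hlt : N⁻¹ < h z := by
    rcases lt_or_eq_of_le (show N⁻¹ ≤ h z from hzK) with h1 | h1
    · exact h1
    exfalso
    have h2 := hz hx0K
    simp only [Set.mem_ofPred_eq, hx0, ← h1, inv_inv, inv_one, one_pow, mul_one] at h2
    have h3 := abs_le.1 (hM x0 (hsub x0 hx0K))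
    have h4 := abs_le.1 (hM z (hsub z hzK))
    have h5 : N ≤ N ^ (k+1) := le_self_pow₀ hN1.le (by omega)
    have h6 : r * N = 2 * M + r + 1 + r := by rw [hN]; field_simp
    have h7 : r * N ≤ r * N ^ (k+1) := mul_le_mul_of_nonneg_left h5 hr.le
    linarith
  have : {x | N⁻¹ ≤ h x} ∈ nhds z := by
    filter_upwards [hc.continuousAt.eventually_const_lt hlt] with x hx using hx.le
  exact hz.isLocalMax this

/-- First and second order information at the touching point. -/
theorem touching_info {d : ℕ} (φ : Euc d → ℝ) (hφ : ContDiff ℝ 3 φ) (k : ℕ) (r : ℝ)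
    (hr : 0 < r) (x0 : Euc d) :
    ∃ z : Euc d, ∃ s h : ℝ, 0 < h ∧ 0 ≤ s ∧ h = 1 - s ^ 2 ∧ ‖z - x0‖ = r * s ∧
      ‖gradient φ z‖ = 2 * (k+1) * (h⁻¹) ^ (k+2) * s ∧
      lap φ z ≤ (4 * (k+1) * (k+2) + 2 * d * (k+1)) * (h⁻¹) ^ (k+3) / r := by
  obtain ⟨z, hz, hmax⟩ := touching_s4 φ hφ.continuous k r hr x0
  set h := 1 - ‖z - x0‖ ^ 2 / r ^ 2 with hh
  have key : ∀ i : Fin d, fderiv ℝ φ z (EuclideanSpace.single i 1)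
        = (k+1) * (h⁻¹) ^ (k+2) * (2 * (z - x0) i / r) ∧
      fderiv ℝ (fun y => fderiv ℝ φ y (EuclideanSpace.single i 1)) z (EuclideanSpace.single i 1)
        ≤ (k+1) * (k+2) * (h⁻¹) ^ (k+3) * (4 * ((z - x0) i) ^ 2 / r ^ 3)
        + (k+1) * (h⁻¹) ^ (k+2) * (2 / r) := by
    intro i
    set e : Euc d := EuclideanSpace.single i 1 with he
    obtain ⟨g', hg1, hg0, hg2⟩ := barrier_deriv k r h ((z - x0) i) hr hz
    have hl : ∀ t : ℝ, HasDerivAt (fun t : ℝ => z + t • e) e t := by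
      intro t
      simpa using ((hasDerivAt_id t).smul_const e).const_add z
    have hd1 : Differentiable ℝ φ := hφ.differentiable (by norm_num)
    have hd2 : Differentiable ℝ (fun y => fderiv ℝ φ y e) := by
      have : ContDiff ℝ 2 (fderiv ℝ φ) := hφ.fderiv_right (by norm_num)
      exact (this.clm_apply contDiff_const).differentiable (by norm_num)
    have hv1 : ∀ t : ℝ, HasDerivAt (fun t : ℝ => φ (z + t • e)) (fderiv ℝ φ (z + t • e) e) t :=
      fun t => (hd1 _).hasFDerivAt.comp_hasDerivAt t (hl t)
    have hv2 : HasDerivAt (fun t : ℝ => fderiv ℝ φ (z + t • e) e)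
        (fderiv ℝ (fun y => fderiv ℝ φ y e) z e) 0 := by
      have := (hd2 (z + (0:ℝ) • e)).hasFDerivAt.comp_hasDerivAt 0 (hl 0)
      refine this.congr_deriv ?_
      simp
    have hline : ∀ t : ℝ, 1 - ‖z + t • e - x0‖ ^ 2 / r ^ 2
        = h - (2 * t * (z - x0) i + t ^ 2) / r ^ 2 := by
      intro t
      have h1 : z + t • e - x0 = (z - x0) + t • e := by abel
      have h2 : ‖(z - x0) + t • e‖ ^ 2 = ‖z - x0‖ ^ 2 + 2 * t * (z - x0) i + t ^ 2 := by
        rw [norm_add_sq_real, norm_smul, inner_smul_right]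
        simp [he, EuclideanSpace.inner_single_right, mul_pow]
        ring
      rw [h1, h2, hh]
      ring
    have hm2 : IsLocalMax (fun t : ℝ => φ (z + t • e)
        - r * ((h - (2 * t * (z - x0) i + t ^ 2) / r ^ 2)⁻¹) ^ (k+1)) 0 := by
      have hc : Tendsto (fun t : ℝ => z + t • e) (nhds 0) (nhds z) := by
        have := (hl 0).continuousAt.tendsto
        simpa using this
      have := hc.eventually hmax
      filter_upwards [this] with t ht
      simp only [hline] at ht
      simpa using ht
    obtain ⟨a1, a2⟩ := second_order_max _ (fun t => fderiv ℝ φ (z + t • e) e - g' t) _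
      (hg1.mono fun t ht => (hv1 t).sub ht) (hv2.sub hg2) hm2
    constructor
    · simp only [zero_smul, add_zero] at a1
      rw [← hg0]; linarith
    · linarith
  have hsum : ∑ i : Fin d, ((z - x0) i) ^ 2 = ‖z - x0‖ ^ 2 := by
    rw [EuclideanSpace.norm_sq_eq]; simp
  refine ⟨z, ‖z - x0‖ / r, h, hz, by positivity, by rw [hh, div_pow], by field_simp, ?_, ?_⟩
  · have hg : gradient φ z = ((k+1) * (h⁻¹) ^ (k+2) * (2 / r)) • (z - x0) := by
      ext i
      have h1 : gradient φ z i = fderiv ℝ φ z (EuclideanSpace.single i 1) := by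
        rw [← InnerProductSpace.toDual_symm_apply (𝕜 := ℝ), EuclideanSpace.inner_single_right]
        simp [gradient]
      rw [h1, (key i).1]
      simp
      ring
    rw [hg, norm_smul, Real.norm_of_nonneg (by positivity)]
    ring
  · have hle : lap φ z ≤ ∑ i : Fin d, ((k+1) * (k+2) * (h⁻¹) ^ (k+3) * (4 * ((z - x0) i) ^ 2 / r ^ 3)
        + (k+1) * (h⁻¹) ^ (k+2) * (2 / r)) := Finset.sum_le_sum fun i _ => (key i).2
    have heq : ∑ i : Fin d, (((k:ℝ)+1) * (k+2) * (h⁻¹) ^ (k+3) * (4 * ((z - x0) i) ^ 2 / r ^ 3)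
        + (k+1) * (h⁻¹) ^ (k+2) * (2 / r)) = (k+1) * (k+2) * (h⁻¹) ^ (k+3) * 4 / r *
          (‖z - x0‖ ^ 2 / r ^ 2) + d * ((k+1) * (h⁻¹) ^ (k+2) * (2 / r)) := by
      rw [Finset.sum_add_distrib, ← hsum, Finset.sum_div, Finset.mul_sum]
      congr 1
      · apply Finset.sum_congr rfl
        intro i _
        field_simp
      · simp
    rw [heq] at hle
    have hs1 : ‖z - x0‖ ^ 2 / r ^ 2 ≤ 1 := by linarith
    have hh1 : h ≤ 1 := by
      have : 0 ≤ ‖z - x0‖ ^ 2 / r ^ 2 := by positivity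
      linarith
    have hi : 1 ≤ h⁻¹ := (one_le_inv₀ hz).2 hh1
    have hp : (h⁻¹) ^ (k+2) ≤ (h⁻¹) ^ (k+3) := pow_le_pow_right₀ hi (by omega)
    calc lap φ z ≤ _ := hle
      _ ≤ (k+1) * (k+2) * (h⁻¹) ^ (k+3) * 4 / r * 1 + d * ((k+1) * (h⁻¹) ^ (k+3) * (2 / r)) := by
          gcongr
      _ = _ := by ring

theorem cocompact_norm {d : ℕ} {P : Euc d → Prop} (h : ∀ᶠ x in cocompact (Euc d), P x) :
    ∃ R0 : ℝ, ∀ x : Euc d, R0 ≤ ‖x‖ → P x := by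
  rw [← Metric.cobounded_eq_cocompact, hasBasis_cobounded_norm.eventually_iff] at h
  obtain ⟨R0, -, h⟩ := h
  exact ⟨R0, fun x hx => h hx⟩

set_option maxHeartbeats 1000000 in
/-- upper bound `λ_max(β) ≤ ρ^{m*}/m*` in the moderate drift case `δ = 0`. -/
theorem stmt4 (d : ℕ) (hd : 1 ≤ d) (m ρ R : ℝ) (hm : 1 < m)
    (hρ : 0 < ρ) (hR : 0 < R)
    (mst : ℝ) (hmst : mst = m / (m - 1))
    (b : Euc d → Euc d) (V : Euc d → ℝ) (α : Euc d → ℝ)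
    (hH0 : HypH0 0 ρ R b V α) :
    ∀ β : ℝ, 0 ≤ β → lamMax m b V β ≤ ρ ^ mst / mst := by
  intro β hβ
  obtain ⟨-, -, -, -, hb, hα, hV0, -, hV⟩ := hH0
  have hm0 : 0 < m := by linarith
  have hmst0 : 0 < mst := by rw [hmst]; exact div_pos hm0 (by linarith)
  have hconj : mst.HolderConjugate m := by
    have : m.HolderConjugate mst := by rw [hmst]; exact Real.HolderConjugate.conjExponent hm
    exact this.symm
  apply Real.sSup_le _ (by positivity)
  rintro lam ⟨φ, hφ, hsub⟩
  by_contra! hlt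
  -- choose `q > ρ` with room to spare
  obtain ⟨q, hqρ, hq⟩ : ∃ q, ρ < q ∧ q ^ mst / mst < lam := by
    have hc : ContinuousAt (fun q : ℝ => q ^ mst / mst) ρ :=
      (Real.continuousAt_rpow_const _ _ (Or.inr hmst0.le)).div_const _
    have h1 := hc.eventually_lt_const hlt
    have h2 : ∀ᶠ q in nhdsWithin ρ (Set.Ioi ρ), q ^ mst / mst < lam := h1.filter_mono nhdsWithin_le_nhds
    obtain ⟨q, h3, h4⟩ := (h2.and self_mem_nhdsWithin).exists
    exact ⟨q, h4, h3⟩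
  have hq0 : 0 < q := hρ.trans hqρ
  set t : ℝ := (ρ + q) / (2 * q) with ht
  have ht0 : 0 < t := by positivity
  have ht1 : t < 1 := by rw [ht, div_lt_one (by positivity)]; linarith
  have htq : t * q = (ρ + q) / 2 := by rw [ht]; field_simp
  set ε : ℝ := (lam - q ^ mst / mst) / 3 with hε
  have hε0 : 0 < ε := by rw [hε]; linarith
  obtain ⟨R1, hR1⟩ := cocompact_norm (hα.eventually
    (Metric.ball_mem_nhds (0:ℝ) (show 0 < (q - ρ) / 2 by linarith)))
  have hβV : Tendsto (fun x => β * V x) (cocompact (Euc d)) (nhds 0) := by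
    simpa using hV.const_mul β
  obtain ⟨R2, hR2⟩ := cocompact_norm (hβV.eventually (gt_mem_nhds hε0))
  -- the growth exponent
  obtain ⟨k, hk⟩ := exists_nat_ge (1 / (m - 1))
  have hkm : (k:ℝ) + 3 ≤ (k + 2) * m := by
    rw [div_le_iff₀ (by linarith)] at hk
    nlinarith
  set C : ℝ := 4 * (k+1) * (k+2) + 2 * d * (k+1) with hC
  have hC0 : 0 < C := by positivity
  have hθ : 0 < (1 - t ^ m) / m := by
    have : t ^ m < 1 := Real.rpow_lt_one ht0.le ht1 hm0
    apply div_pos _ hm0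
    linarith
  set θ : ℝ := (1 - t ^ m) / m with hθd
  obtain ⟨r, hr⟩ : ∃ r : ℝ, R ≤ r ∧ R1 ≤ r ∧ R2 ≤ r ∧ C / θ ≤ r ∧ C * 2 ^ (k+3) / ε ≤ r :=
    ((eventually_ge_atTop R).and ((eventually_ge_atTop R1).and ((eventually_ge_atTop R2).and
      ((eventually_ge_atTop (C / θ)).and (eventually_ge_atTop (C * 2 ^ (k+3) / ε)))))).exists
  obtain ⟨hrR, hrR1, hrR2, hrθ, hrε⟩ := hr
  have hr0 : 0 < r := hR.trans_le hrR
  set x0 : Euc d := EuclideanSpace.single ⟨0, hd⟩ (2 * r) with hx0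
  have hx0n : ‖x0‖ = 2 * r := by
    rw [hx0, EuclideanSpace.norm_single, Real.norm_of_nonneg (by positivity)]
  obtain ⟨z, s, h, hh0, hs0, hhs, hzs, hgrad, hlap⟩ := touching_info φ hφ k r hr0 x0
  have hs1 : s ≤ 1 := by
    have : s ^ 2 ≤ 1 := by linarith
    exact (sq_le_one_iff₀ hs0).1 this
  have hzr : r ≤ ‖z‖ := by
    have h1 : ‖x0‖ ≤ ‖z‖ + ‖z - x0‖ := by
      have := norm_sub_le z (z - x0)
      simpa using this
    have h2 : r * s ≤ r * 1 := by gcongr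
    linarith
  have hz0 : 0 < ‖z‖ := hr0.trans_le hzr
  have hbz : ‖b z‖ ≤ t * q := by
    have h1 := hR1 z (hrR1.trans hzr)
    rw [dist_zero_right, Real.norm_eq_abs, abs_lt] at h1
    rw [hb z (hrR.trans hzr), norm_smul, norm_mul, htq]
    have h2 : ‖z‖ ^ ((0:ℝ) - 1) = ‖z‖⁻¹ := by
      rw [zero_sub, Real.rpow_neg_one]
    rw [h2, norm_inv, norm_norm, mul_assoc, inv_mul_cancel₀ hz0.ne', mul_one, Real.norm_eq_abs,
      abs_le]
    constructor <;> linarith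
  have hVz := hR2 z (hrR2.trans hzr)
  have hsz := hsub z
  set p := ‖gradient φ z‖ with hp
  have hp0 : 0 ≤ p := norm_nonneg _
  have hinner : -(p * (t * q)) ≤ ⟪b z, gradient φ z⟫ := by
    have h1 := abs_le.1 (abs_real_inner_le_norm (b z) (gradient φ z))
    have h2 : ‖b z‖ * p ≤ (t * q) * p := by gcongr
    linarith [h1.1]
  have hyoung : q * (t * p) ≤ q ^ mst / mst + (t * p) ^ m / m :=
    Real.young_inequality_of_nonneg hq0.le (by positivity) hconj
  rw [Real.mul_rpow ht0.le hp0] at hyoung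
  have hmain : lam ≤ lap φ z - θ * p ^ m + q ^ mst / mst + β * V z := by
    have : θ * p ^ m = (1 / m) * p ^ m - t ^ m * p ^ m / m := by rw [hθd]; ring
    rw [this]
    linarith
  have hfin : lap φ z - θ * p ^ m ≤ ε := by
    have hpm : 0 ≤ p ^ m := by positivity
    rcases le_total h (1/2) with hcase | hcase
    · -- near the boundary the gradient term dominates
      have hs2 : 1 / 2 ≤ s := by
        by_contra! hcon
        have : s * s ≤ (1/2) * (1/2) := by gcongr
        linarith [sq s]
      have hi1 : 1 ≤ h⁻¹ := (one_le_inv₀ hh0).2 (by linarith)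
      have hpge : (h⁻¹) ^ (k+2) ≤ p := by
        rw [hgrad]
        have h1 : 1 ≤ 2 * ((k:ℝ)+1) * s := by
          have : (0:ℝ) ≤ k := by positivity
          have h3 : 0 ≤ k * s := by positivity
          linarith
        have h2 : 0 ≤ (h⁻¹) ^ (k+2) := by positivity
        calc (h⁻¹) ^ (k+2) = 1 * (h⁻¹) ^ (k+2) := by ring
          _ ≤ (2 * ((k:ℝ)+1) * s) * (h⁻¹) ^ (k+2) := by gcongr
          _ = _ := by ring
      have hpm2 : (h⁻¹) ^ (k+3) ≤ p ^ m := by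
        calc (h⁻¹) ^ (k+3) = (h⁻¹) ^ ((k:ℝ)+3) := by
              rw [← Real.rpow_natCast]; push_cast; rfl
          _ ≤ (h⁻¹) ^ (((k:ℝ)+2) * m) := Real.rpow_le_rpow_of_exponent_le hi1 hkm
          _ = ((h⁻¹) ^ (k+2)) ^ m := by
              rw [Real.rpow_mul (by positivity), ← Real.rpow_natCast]; push_cast; rfl
          _ ≤ p ^ m := by gcongr
      have h1 : C / r ≤ θ := by
        rw [div_le_iff₀ hθ] at hrθ
        rw [div_le_iff₀ hr0]; linarith
      have h2 : C * (h⁻¹) ^ (k+3) / r ≤ θ * p ^ m := by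
        calc C * (h⁻¹) ^ (k+3) / r = C / r * (h⁻¹) ^ (k+3) := by ring
          _ ≤ θ * p ^ m := by gcongr
      linarith
    · have hi2 : h⁻¹ ≤ 2 := by
        rw [inv_le_comm₀ hh0 (by norm_num)]; linarith
      have h1 : C * (h⁻¹) ^ (k+3) / r ≤ C * 2 ^ (k+3) / r := by gcongr
      have h2 : C * 2 ^ (k+3) / r ≤ ε := by
        rw [div_le_iff₀ hε0] at hrε
        rw [div_le_iff₀ hr0]; linarith
      have h3 : 0 ≤ θ * p ^ m := by positivity
      linarith
  linarith

end
end

section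
/- Let d ≥ 1 and m > 1. Define H : ℝ^d → ℝ by H(p) := (1/m)|p|^m and, for p, q ∈ ℝ^d, set h(p;q) := H(q+p) − H(q) − DH(q)·p, where DH denotes the gradient of H. Then for every r > 0 and K > r there exists c > 0 such that h(p;q) ≥ c|p|² for all q ∈ ℝ^d with |q| = r and all p ∈ ℝ^d with |p| < K. -/
open Filter Real RealInnerProductSpace

noncomputable section

theorem tangent_le {S : Set ℝ} {f : ℝ → ℝ} {f' x y : ℝ} (hf : ConvexOn ℝ S f)
    (hx : x ∈ S) (hy : y ∈ S) (hd : HasDerivAt f f' x) : f' * (y - x) ≤ f y - f x := by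
  rcases lt_trichotomy x y with h | h | h
  · have := hf.le_slope_of_hasDerivAt hx hy h hd
    rw [slope_def_field, le_div_iff₀ (by linarith)] at this
    exact this
  · subst h; simp
  · have := hf.slope_le_of_hasDerivAt hy hx h hd
    rw [slope_def_field, div_le_iff₀ (by linarith)] at this
    linarith

theorem lemA {m r s L : ℝ} (hm : 1 < m) (hm2 : m < 2) (hr : 0 < r) (hrL : r < L)
    (hs : 0 ≤ s) (hsL : s ≤ L) :
    ((m - 1) * L ^ (m - 2)) / 2 * (s - r) ^ 2
      ≤ (1 / m) * s ^ m - (1 / m) * r ^ m - r ^ (m - 2) * r * (s - r) := by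
  set c := (m - 1) * L ^ (m - 2) with hc
  have hder : ∀ x : ℝ, 0 < x →
      HasDerivAt (fun x : ℝ => (1 / m) * x ^ m - c / 2 * x ^ 2) (x ^ (m - 1) - c * x) x := by
    intro x hx
    have h1 := (Real.hasDerivAt_rpow_const (p := m) (Or.inl hx.ne')).const_mul (1 / m)
    have h2 := (hasDerivAt_pow 2 x).const_mul (c / 2)
    refine (h1.sub h2).congr_deriv ?_
    have : m ≠ 0 := by linarith
    field_simp
    norm_num
    ring
  have hder2 : ∀ x : ℝ, 0 < x →
      HasDerivAt (fun x : ℝ => x ^ (m - 1) - c * x) ((m - 1) * x ^ (m - 2) - c) x := by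
    intro x hx
    have h1 := (Real.hasDerivAt_rpow_const (p := m - 1) (Or.inl hx.ne'))
    have h2 := (hasDerivAt_id x).const_mul c
    refine (h1.sub h2).congr_deriv ?_
    rw [show m - 1 - 1 = m - 2 by ring]; ring
  have hconv : ConvexOn ℝ (Set.Icc 0 L) (fun x : ℝ => (1 / m) * x ^ m - c / 2 * x ^ 2) := by
    apply convexOn_of_hasDerivWithinAt2_nonneg (convex_Icc 0 L)
      (f' := fun x : ℝ => x ^ (m - 1) - c * x) (f'' := fun x : ℝ => (m - 1) * x ^ (m - 2) - c)
    · apply Continuous.continuousOn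
      have : Continuous (fun x : ℝ => x ^ m) := Real.continuous_rpow_const (by linarith)
      fun_prop
    · intro x hx
      rw [interior_Icc] at hx
      exact (hder x hx.1).hasDerivWithinAt
    · intro x hx
      rw [interior_Icc] at hx
      exact (hder2 x hx.1).hasDerivWithinAt
    · intro x hx
      rw [interior_Icc] at hx
      have : L ^ (m - 2) ≤ x ^ (m - 2) :=
        Real.rpow_le_rpow_of_nonpos hx.1 hx.2.le (by linarith)
      have := mul_le_mul_of_nonneg_left this (show 0 ≤ m - 1 by linarith)
      simp only [hc]; linarith
  have := tangent_le hconv ⟨hr.le, hrL.le⟩ ⟨hs, hsL⟩ (hder r hr)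
  have e : r ^ (m - 1) = r ^ (m - 2) * r := by
    rw [← Real.rpow_add_one hr.ne']; congr 1; ring
  rw [e] at this
  linarith

theorem lemB {m r s : ℝ} (hm2 : 2 ≤ m) (hr : 0 < r) (hs : 0 ≤ s) :
    r ^ (m - 2) * (s ^ 2 - r ^ 2) / 2 ≤ (1 / m) * s ^ m - (1 / m) * r ^ m := by
  have h := one_add_mul_self_le_rpow_one_add (s := s ^ 2 / r ^ 2 - 1) (p := m / 2)
    (by have : 0 ≤ s ^ 2 / r ^ 2 := by positivity
        linarith) (by linarith)
  have e : (1 + (s ^ 2 / r ^ 2 - 1)) ^ (m / 2) = s ^ m / r ^ m := by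
    rw [add_sub_cancel, ← div_pow, ← Real.rpow_natCast, ← Real.rpow_mul (by positivity),
      ← Real.div_rpow hs hr.le]
    congr 1; push_cast; ring
  have e2 : r ^ m = r ^ (m - 2) * r ^ 2 := by
    rw [← Real.rpow_natCast, ← Real.rpow_add hr]; congr 1; push_cast; ring
  have hA : 0 < r ^ (m - 2) := Real.rpow_pos_of_pos hr _
  rw [e, le_div_iff₀ (Real.rpow_pos_of_pos hr _), e2] at h
  have e3 : (1 + m / 2 * (s ^ 2 / r ^ 2 - 1)) * (r ^ (m - 2) * r ^ 2)
      = m * (r ^ (m - 2) * (s ^ 2 - r ^ 2) / 2) + r ^ (m - 2) * r ^ 2 := by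
    field_simp; ring
  rw [e3] at h
  rw [e2, ← mul_sub, one_div, ← div_eq_inv_mul, le_div_iff₀ (by linarith)]
  linarith

/-- quadratic lower bound for the second-order Taylor remainder of
`H(p) = (1/m)|p|^m`. -/
theorem stmt6 (d : ℕ) (hd : 1 ≤ d) (m : ℝ) (hm : 1 < m)
    (H : Euc d → ℝ) (hH : H = fun p => (1 / m) * ‖p‖ ^ m)
    (DH : Euc d → Euc d) (hDH : DH = fun q => (‖q‖ ^ (m - 2)) • q)
    (h : Euc d → Euc d → ℝ) (hh : h = fun p q => H (q + p) - H q - ⟪DH q, p⟫) :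
    ∀ r K : ℝ, 0 < r → r < K →
      ∃ c : ℝ, 0 < c ∧ ∀ q p : Euc d, ‖q‖ = r → ‖p‖ < K → c * ‖p‖ ^ 2 ≤ h p q := by
  intro r K hr hrK
  have hA : 0 < r ^ (m - 2) := Real.rpow_pos_of_pos hr _
  have key : ∀ q p : Euc d, ‖q‖ = r → h p q = (1 / m) * ‖q + p‖ ^ m - (1 / m) * r ^ m
      - r ^ (m - 2) * (‖q + p‖ ^ 2 - r ^ 2) / 2 + r ^ (m - 2) / 2 * ‖p‖ ^ 2 := by
    intro q p hq
    have := norm_add_sq_real q p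
    subst hh hH hDH
    simp only [real_inner_smul_left]
    rw [this, hq]
    ring
  rcases lt_or_ge m 2 with hm2 | hm2
  · have hL : 0 < r + K := by linarith
    have hLp : 0 < (r + K) ^ (m - 2) := Real.rpow_pos_of_pos hL _
    refine ⟨((m - 1) * (r + K) ^ (m - 2)) / 2, by
      have : 0 < m - 1 := by linarith
      positivity, ?_⟩
    intro q p hq hp
    rw [key q p hq]
    have ht := norm_add_le q p
    have hl := lemA (s := ‖q + p‖) hm hm2 hr (show r < r + K by linarith) (norm_nonneg _)
      (by linarith)
    have hle : (r + K) ^ (m - 2) ≤ r ^ (m - 2) :=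
      Real.rpow_le_rpow_of_nonpos hr (by linarith) (by linarith)
    have hcA : (m - 1) * (r + K) ^ (m - 2) ≤ r ^ (m - 2) := by nlinarith
    have hsq : (‖q + p‖ - r) ^ 2 ≤ ‖p‖ ^ 2 := by
      rw [sq_le_sq, abs_of_nonneg (norm_nonneg p), ← hq]
      simpa using abs_norm_sub_norm_le (q + p) q
    have := mul_le_mul_of_nonneg_left hsq (sub_nonneg.2 hcA)
    linarith
  · refine ⟨r ^ (m - 2) / 2, by positivity, ?_⟩
    intro q p hq hp
    rw [key q p hq]
    have := lemB (s := ‖q + p‖) hm2 hr (norm_nonneg _)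
    linarith

end
end

section
/- Let d ≥ 1 and 1 < m < 2. Define H : ℝ^d → ℝ by H(p) := (1/m)|p|^m and h(p;q) := H(q+p) − H(q) − DH(q)·p. Then for every r > 0, every K > r, every q ∈ ℝ^d with |q| = r, and every p ∈ ℝ^d with |p| < K, one has h(p;q) ≥ (m−1)·2^{m−3}·K^{m−2}·|p|². -/
open Filter Real RealInnerProductSpace

noncomputable section

theorem stmt7_aux (m : ℝ) (hm : 1 < m) (hm2 : m < 2) (M a b : ℝ) (ha : 0 < a) (haM : a < M)
    (hb : 0 ≤ b) (hbM : b ≤ M) :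
    0 ≤ (b ^ m / m - (m - 1) * M ^ (m - 2) * b ^ 2 / 2)
      - (a ^ m / m - (m - 1) * M ^ (m - 2) * a ^ 2 / 2)
      - (a ^ (m - 1) - (m - 1) * M ^ (m - 2) * a) * (b - a) := by
  set c : ℝ := (m - 1) * M ^ (m - 2) with hc
  have hM : 0 < M := ha.trans haM
  have hd1 : ∀ x : ℝ, 0 < x →
      HasDerivAt (fun s : ℝ => s ^ m / m - c * s ^ 2 / 2) (x ^ (m - 1) - c * x) x := by
    intro x hx
    have h1 := (Real.hasDerivAt_rpow_const (x := x) (p := m) (Or.inl hx.ne')).div_const m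
    have h2 := (((hasDerivAt_id x).pow 2).const_mul c).div_const 2
    refine (h1.sub h2).congr_deriv ?_
    have hm0 : m ≠ 0 := by linarith
    simp
    field_simp
  have hd2 : ∀ x : ℝ, 0 < x →
      HasDerivAt (fun s : ℝ => s ^ (m - 1) - c * s) ((m - 1) * x ^ (m - 2) - c) x := by
    intro x hx
    have h1 := (Real.hasDerivAt_rpow_const (x := x) (p := m - 1) (Or.inl hx.ne'))
    have h2 := (hasDerivAt_id x).const_mul c
    refine (h1.sub h2).congr_deriv ?_
    rw [show m - 1 - 1 = m - 2 by ring]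
    simp
  have hconv : ConvexOn ℝ (Set.Icc 0 M) (fun s : ℝ => s ^ m / m - c * s ^ 2 / 2) := by
    refine convexOn_of_hasDerivWithinAt2_nonneg (convex_Icc 0 M)
      (f' := fun s : ℝ => s ^ (m - 1) - c * s) (f'' := fun x => (m - 1) * x ^ (m - 2) - c)
      ?_ ?_ ?_ ?_
    · have h1 : Continuous (fun s : ℝ => s ^ m) := Real.continuous_rpow_const (by linarith)
      exact (by fun_prop : Continuous (fun s : ℝ => s ^ m / m - c * s ^ 2 / 2)).continuousOn
    · intro x hx
      rw [interior_Icc] at hx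
      exact (hd1 x hx.1).hasDerivWithinAt
    · intro x hx
      rw [interior_Icc] at hx
      exact (hd2 x hx.1).hasDerivWithinAt
    · intro x hx
      rw [interior_Icc] at hx
      have h1 : M ^ (m - 2) ≤ x ^ (m - 2) :=
        Real.rpow_le_rpow_of_nonpos hx.1 hx.2.le (by linarith)
      have := mul_le_mul_of_nonneg_left h1 (by linarith : 0 ≤ m - 1)
      simp only [hc]
      linarith
  have haI : a ∈ Set.Icc 0 M := ⟨ha.le, haM.le⟩
  have hbI : b ∈ Set.Icc 0 M := ⟨hb, hbM⟩
  rcases lt_trichotomy a b with hab | hab | hab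
  · have h1 := hconv.le_slope_of_hasDerivAt haI hbI hab (hd1 a ha)
    rw [slope_def_field, le_div_iff₀ (by linarith)] at h1
    linarith
  · subst hab
    simp
  · have h1 := hconv.slope_le_of_hasDerivAt hbI haI hab (hd1 a ha)
    rw [slope_def_field, div_le_iff₀ (by linarith)] at h1
    linarith

/-- explicit quadratic lower bound for the Taylor remainder when `1 < m < 2`. -/
theorem stmt7 (d : ℕ) (hd : 1 ≤ d) (m : ℝ) (hm : 1 < m) (hm2 : m < 2)
    (H : Euc d → ℝ) (hH : H = fun p => (1 / m) * ‖p‖ ^ m)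
    (DH : Euc d → Euc d) (hDH : DH = fun q => (‖q‖ ^ (m - 2)) • q)
    (h : Euc d → Euc d → ℝ) (hh : h = fun p q => H (q + p) - H q - ⟪DH q, p⟫) :
    ∀ r K : ℝ, 0 < r → r < K → ∀ q p : Euc d, ‖q‖ = r → ‖p‖ < K →
      (m - 1) * 2 ^ (m - 3) * K ^ (m - 2) * ‖p‖ ^ 2 ≤ h p q := by
  intro r K hr hrK q p hq hp
  have hK : 0 < K := hr.trans hrK
  have hb : ‖q + p‖ ≤ 2 * K := by linarith [norm_add_le q p]
  have key := stmt7_aux m hm hm2 (2 * K) r ‖q + p‖ hr (by linarith) (norm_nonneg _) hb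
  have hin : ⟪q, p⟫ ≤ r * ‖q + p‖ - r ^ 2 := by
    have h1 := real_inner_le_norm q (q + p)
    rw [inner_add_right, real_inner_self_eq_norm_sq, hq] at h1
    linarith
  have hsq := norm_add_sq_real q p
  rw [hq] at hsq
  have hco : 0 ≤ r ^ (m - 2) - (m - 1) * (2 * K) ^ (m - 2) := by
    have h1 : (2 * K) ^ (m - 2) ≤ r ^ (m - 2) :=
      Real.rpow_le_rpow_of_nonpos hr (by linarith) (by linarith)
    have h2 : 0 < (2 * K) ^ (m - 2) := Real.rpow_pos_of_pos (by linarith) _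
    nlinarith
  have hr1 : r ^ (m - 1) = r ^ (m - 2) * r := by
    rw [← Real.rpow_add_one hr.ne']
    congr 1
    ring
  have hmul := mul_le_mul_of_nonneg_left hin hco
  have hcst : (2 : ℝ) ^ (m - 3) * K ^ (m - 2) = (2 * K) ^ (m - 2) / 2 := by
    rw [Real.mul_rpow (by norm_num) hK.le, show m - 2 = m - 3 + 1 by ring,
      Real.rpow_add_one (by norm_num : (2 : ℝ) ≠ 0)]
    ring
  rw [hh, hH, hDH]
  simp only [real_inner_smul_left, hq]
  rw [mul_assoc (m - 1), hcst]
  have hp2 : ‖p‖ ^ 2 = ‖q + p‖ ^ 2 - r ^ 2 - 2 * ⟪q, p⟫ := by linarith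
  rw [hp2]
  rw [hr1] at key
  ring_nf at key hmul ⊢
  linarith

end
end

section
/- Let d ≥ 1 and m ≥ 2. Define H : ℝ^d → ℝ by H(p) := (1/m)|p|^m and h(p;q) := H(q+p) − H(q) − DH(q)·p. Then for every r > 0, every K > r, every q ∈ ℝ^d with |q| = r, and every p ∈ ℝ^d with |p| < K, one has h(p;q) ≥ (4K−r)·r^{m−1}·2^{−(m+1)}·K^{−2}·|p|². -/
open Filter Real RealInnerProductSpace

noncomputable section

/-- explicit quadratic lower bound for the Taylor remainder when `m ≥ 2`. -/
theorem stmt8 (d : ℕ) (hd : 1 ≤ d) (m : ℝ) (hm2 : 2 ≤ m)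
    (H : Euc d → ℝ) (hH : H = fun p => (1 / m) * ‖p‖ ^ m)
    (DH : Euc d → Euc d) (hDH : DH = fun q => (‖q‖ ^ (m - 2)) • q)
    (h : Euc d → Euc d → ℝ) (hh : h = fun p q => H (q + p) - H q - ⟪DH q, p⟫) :
    ∀ r K : ℝ, 0 < r → r < K → ∀ q p : Euc d, ‖q‖ = r → ‖p‖ < K →
      (4 * K - r) * r ^ (m - 1) * 2 ^ (-(m + 1)) * K ^ (-2 : ℝ) * ‖p‖ ^ 2 ≤ h p q := by
  intro r K hr hK q p hq hp
  have hK0 : 0 < K := hr.trans hK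
  have hm0 : 0 < m := by linarith
  subst hh hDH hH
  simp only [hq]
  rw [real_inner_smul_left]
  have hn := norm_add_sq_real q p
  rw [hq] at hn
  set t := ‖q + p‖ with ht
  have ht0 : 0 ≤ t := norm_nonneg _
  set A := r ^ (m - 2) with hA
  have hA0 : 0 < A := Real.rpow_pos_of_pos hr _
  have h1 : r ^ (m - 1) = A * r := by
    rw [hA, ← Real.rpow_add_one hr.ne']; congr 1; ring
  have h2 : r ^ m = A * r ^ 2 := by
    rw [hA, ← Real.rpow_natCast r 2, ← Real.rpow_add hr]; congr 1; push_cast; ring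
  have hB := one_add_mul_self_le_rpow_one_add (s := (t / r) ^ 2 - 1) (p := m / 2)
    (by nlinarith [sq_nonneg (t / r)]) (by linarith)
  have h3 : (1 + ((t / r) ^ 2 - 1)) ^ (m / 2) = t ^ m / r ^ m := by
    rw [add_sub_cancel, ← Real.rpow_natCast (t / r) 2, ← Real.rpow_mul (by positivity),
      ← Real.div_rpow ht0 hr.le]
    congr 1; push_cast; ring
  rw [h3, h2, le_div_iff₀ (by positivity)] at hB
  have h4 : (1 + m / 2 * ((t / r) ^ 2 - 1)) * (A * r ^ 2)
      = A * r ^ 2 + m * (A * (t ^ 2 - r ^ 2) / 2) := by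
    field_simp
  rw [h4] at hB
  have h5 : A * (t ^ 2 - r ^ 2) / 2 ≤ 1 / m * t ^ m - 1 / m * (A * r ^ 2) := by
    rw [← mul_sub, one_div, inv_mul_eq_div, le_div_iff₀ hm0]
    linarith
  have h6 : (2 : ℝ) ^ (-(m + 1)) ≤ 1 / 8 := by
    calc (2 : ℝ) ^ (-(m + 1)) ≤ 2 ^ (-3 : ℝ) :=
          Real.rpow_le_rpow_of_exponent_le (by norm_num) (by linarith)
      _ = 1 / 8 := by
          rw [Real.rpow_neg (by norm_num)]
          norm_num
  have h7 : K ^ (-2 : ℝ) = (K ^ 2)⁻¹ := by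
    rw [Real.rpow_neg hK0.le]; norm_num
  have h8 : (4 * K - r) * r * (K ^ 2)⁻¹ ≤ 4 := by
    rw [← div_eq_mul_inv, div_le_iff₀ (by positivity)]
    nlinarith
  have h9 : (4 * K - r) * r * (K ^ 2)⁻¹ * 2 ^ (-(m + 1)) ≤ 4 * (1 / 8) :=
    mul_le_mul h8 h6 (by positivity) (by norm_num)
  have h10 := mul_le_mul_of_nonneg_right h9 (show 0 ≤ A * ‖p‖ ^ 2 by positivity)
  rw [h1, h2, h7]
  have h11 : inner ℝ q p = (t ^ 2 - r ^ 2 - ‖p‖ ^ 2) / 2 := by linarith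
  rw [h11]
  linarith

end
end

section
/- Let d ≥ 1, m > 1, m* = m/(m−1), and suppose (b,V) satisfies hypothesis (H0) with parameter δ = 0 and constants ρ > 0, R > 0. Assume that for every k > 0 there exist μ > 0 and R₂ ≥ R such that |x|(α(x) + k|α(x)|² + kV(x)) ≤ d − 1 − μ for all x ∉ B_{R₂}. Then λ_max(β) < ρ^{m*}/m* for all β ≥ 0. -/
open Filter Real RealInnerProductSpace

noncomputable section

lemma taylor_aux (ρ q : ℝ) (N : ℕ) (hρ : 0 < ρ) (hq : 1 < q) (hN : q ≤ N) :
    ∃ C : ℝ, 0 ≤ C ∧ ∀ t : ℝ,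
      |ρ + t| ^ q ≤ ρ ^ q + q * ρ ^ (q - 1) * t + C * (t ^ 2 + |t| ^ N) := by
  have hd : HasDerivAt (fun u : ℝ => u ^ (q - 1)) ((q - 1) * ρ ^ (q - 1 - 1)) ρ :=
    Real.hasDerivAt_rpow_const (Or.inl hρ.ne')
  have hO := hd.differentiableAt.isBigO_sub
  obtain ⟨c, hc0, hc⟩ := hO.exists_pos
  rw [Asymptotics.isBigOWith_iff, Metric.eventually_nhds_iff] at hc
  obtain ⟨δ', hδ', hc⟩ := hc
  set δ := min δ' ρ with hδ
  have hδ0 : 0 < δ := lt_min hδ' hρ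
  set K := ((1 + ρ) / δ + 1) ^ N with hK
  have hK0 : 0 ≤ K := by positivity
  have hr : 0 < ρ ^ (q - 1) := Real.rpow_pos_of_pos hρ _
  refine ⟨q * c + K + q * ρ ^ (q - 1) / δ, by positivity, fun t => ?_⟩
  by_cases ht : |t| < δ
  · have h1 := hc (y := ρ + t) (by simpa [Real.dist_eq] using lt_of_lt_of_le ht (min_le_left _ _))
    simp only [add_sub_cancel_left, Real.norm_eq_abs] at h1
    have hu : 0 < ρ + t := by
      have := (abs_lt.1 (lt_of_lt_of_le ht (min_le_right _ _))).1
      linarith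
    rw [abs_of_pos hu]
    have hb := one_add_mul_self_le_rpow_one_add (s := (ρ - (ρ + t)) / (ρ + t)) (p := q)
      (by rw [le_div_iff₀ hu]; linarith) hq.le
    have e1 : 1 + (ρ - (ρ + t)) / (ρ + t) = ρ / (ρ + t) := by field_simp; ring
    rw [e1, Real.div_rpow hρ.le hu.le, le_div_iff₀ (Real.rpow_pos_of_pos hu _)] at hb
    have e2 : (ρ + t) ^ q = (ρ + t) ^ (q - 1) * (ρ + t) := by
      rw [← Real.rpow_add_one hu.ne']; ring_nf
    have e3 : (1 + q * ((ρ - (ρ + t)) / (ρ + t))) * (ρ + t) ^ q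
        = (ρ + t) ^ q - q * (ρ + t) ^ (q - 1) * t := by
      rw [e2]; field_simp; ring
    rw [e3] at hb
    have h2 : ((ρ + t) ^ (q - 1) - ρ ^ (q - 1)) * t ≤ c * t ^ 2 := by
      calc _ ≤ |((ρ + t) ^ (q - 1) - ρ ^ (q - 1)) * t| := le_abs_self _
        _ = |((ρ + t) ^ (q - 1) - ρ ^ (q - 1))| * |t| := abs_mul _ _
        _ ≤ c * |t| * |t| := by gcongr
        _ = c * t ^ 2 := by rw [mul_assoc, abs_mul_abs_self]; ring
    have h3 : 0 ≤ (K + q * ρ ^ (q - 1) / δ) * (t ^ 2 + |t| ^ N) := by positivity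
    have h4 : 0 ≤ q * c * |t| ^ N := by positivity
    nlinarith
  · push Not at ht
    have h1 : |ρ + t| ^ q ≤ K * |t| ^ N := by
      calc |ρ + t| ^ q ≤ (1 + ρ + |t|) ^ q := by
            gcongr
            calc |ρ + t| ≤ |ρ| + |t| := abs_add_le _ _
              _ ≤ 1 + ρ + |t| := by rw [abs_of_pos hρ]; linarith
        _ ≤ (1 + ρ + |t|) ^ (N : ℝ) := by
            apply Real.rpow_le_rpow_of_exponent_le _ hN
            have := abs_nonneg t; linarith
        _ = (1 + ρ + |t|) ^ N := Real.rpow_natCast _ _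
        _ ≤ (((1 + ρ) / δ + 1) * |t|) ^ N := by
            gcongr
            have : (1 + ρ) ≤ (1 + ρ) / δ * |t| := by
              rw [div_mul_eq_mul_div, le_div_iff₀ hδ0]; gcongr
            linarith
        _ = _ := by rw [mul_pow]
    have h2 : - (q * ρ ^ (q - 1) * t) ≤ q * ρ ^ (q - 1) / δ * t ^ 2 := by
      have : |t| ≤ t ^ 2 / δ := by
        rw [le_div_iff₀ hδ0, ← sq_abs]; nlinarith [abs_nonneg t]
      have h5 : -t ≤ |t| := neg_le_abs t
      calc - (q * ρ ^ (q - 1) * t) = q * ρ ^ (q - 1) * (-t) := by ring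
        _ ≤ q * ρ ^ (q - 1) * (t ^ 2 / δ) := by gcongr; linarith
        _ = _ := by ring
    have h3 : 0 ≤ ρ ^ q := by positivity
    have h4 : 0 ≤ (q * c) * (t ^ 2 + |t| ^ N) := by positivity
    have h5 : 0 ≤ K * t ^ 2 := by positivity
    have h6 : 0 ≤ q * ρ ^ (q - 1) / δ * |t| ^ N := by positivity
    nlinarith

lemma cost_bound (ρ q : ℝ) (N : ℕ) (hρ : 0 < ρ) (hq : 1 < q) (hN : q ≤ N) (hN2 : 2 ≤ N) :
    ∃ C : ℝ, 0 ≤ C ∧ ∀ a s : ℝ, |a| ≤ 1 → 0 ≤ s →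
      |ρ + a - s| ^ q / q ≤ ρ ^ q / q + ρ ^ (q - 1) * (a - s) + C * (a ^ 2 + s ^ 2 + s ^ N) := by
  obtain ⟨C, hC, h⟩ := taylor_aux ρ q N hρ hq hN
  refine ⟨C * (2 + 2 ^ (N - 1)), by positivity, fun a s ha hs => ?_⟩
  have h1 := h (a - s)
  have hq0 : 0 < q := by linarith
  rw [← add_sub_assoc] at h1
  have h2 : (a - s) ^ 2 ≤ 2 * (a ^ 2 + s ^ 2) := by nlinarith [sq_nonneg (a + s)]
  have h3 : |a - s| ^ N ≤ 2 ^ (N - 1) * (a ^ 2 + s ^ N) := by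
    calc |a - s| ^ N ≤ (|a| + s) ^ N := by
          gcongr
          calc |a - s| ≤ |a| + |s| := abs_sub _ _
            _ = _ := by rw [abs_of_nonneg hs]
      _ ≤ 2 ^ (N - 1) * (|a| ^ N + s ^ N) := add_pow_le (abs_nonneg a) hs N
      _ ≤ 2 ^ (N - 1) * (a ^ 2 + s ^ N) := by
          gcongr
          rw [← sq_abs a]
          exact pow_le_pow_of_le_one (abs_nonneg a) ha hN2
  have h4 : C * ((a - s) ^ 2 + |a - s| ^ N) ≤ C * (2 + 2 ^ (N - 1)) * (a ^ 2 + s ^ 2 + s ^ N) := by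
    rw [mul_assoc]
    gcongr
    have : (0:ℝ) ≤ 2 * s ^ N := by positivity
    have : (0:ℝ) ≤ 2 ^ (N - 1) * s ^ 2 := by positivity
    nlinarith
  have h5 : C * (2 + 2 ^ (N - 1)) * (a ^ 2 + s ^ 2 + s ^ N) / q ≤ C * (2 + 2 ^ (N - 1)) * (a ^ 2 + s ^ 2 + s ^ N) :=
    div_le_self (by positivity) hq.le
  calc |ρ + a - s| ^ q / q ≤ (ρ ^ q + q * ρ ^ (q - 1) * (a - s) + C * (2 + 2 ^ (N - 1)) * (a ^ 2 + s ^ 2 + s ^ N)) / q := by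
        gcongr; linarith
    _ = ρ ^ q / q + ρ ^ (q - 1) * (a - s) + C * (2 + 2 ^ (N - 1)) * (a ^ 2 + s ^ 2 + s ^ N) / q := by
        field_simp
    _ ≤ _ := by linarith

/-- radial profile -/
def fF (N : ℕ) (T r : ℝ) : ℝ := (max (1 - r ^ 2 / T ^ 2) 0) ^ N

/-- minus the radial derivative of the profile, divided by `r` -/
def fG (N : ℕ) (T r : ℝ) : ℝ := 2 * N / T ^ 2 * (max (1 - r ^ 2 / T ^ 2) 0) ^ (N - 1)

lemma hasDerivAt_max_pow (N : ℕ) (hN : 2 ≤ N) (u : ℝ) :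
    HasDerivAt (fun u : ℝ => (max u 0) ^ N) (N * (max u 0) ^ (N - 1)) u := by
  rcases lt_trichotomy u 0 with hu | hu | hu
  · have h : (fun u : ℝ => (max u 0) ^ N) =ᶠ[nhds u] fun _ => (0:ℝ) := by
      filter_upwards [gt_mem_nhds hu] with v hv
      rw [max_eq_right hv.le, zero_pow (by omega)]
    rw [max_eq_right hu.le, zero_pow (by omega), mul_zero]
    exact (hasDerivAt_const u (0:ℝ)).congr_of_eventuallyEq h
  · subst hu
    rw [max_self, zero_pow (by omega), mul_zero]
    rw [hasDerivAt_iff_isLittleO]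
    simp only [max_self, sub_zero, smul_zero]
    rw [zero_pow (by omega)]
    simp only [sub_zero]
    have h1 : (fun u : ℝ => (max u 0) ^ N) =O[nhds 0] fun u : ℝ => u ^ N := by
      apply Asymptotics.IsBigO.of_bound 1
      filter_upwards with v
      rw [one_mul, norm_pow, norm_pow]
      gcongr
      rw [Real.norm_eq_abs, Real.norm_eq_abs, abs_of_nonneg (le_max_right _ _)]
      exact max_le (le_abs_self v) (abs_nonneg v)
    exact h1.trans_isLittleO (by simpa using Asymptotics.isLittleO_pow_pow (𝕜 := ℝ) (show 1 < N by omega))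
  · have h : (fun u : ℝ => (max u 0) ^ N) =ᶠ[nhds u] fun u => u ^ N := by
      filter_upwards [lt_mem_nhds hu] with v hv
      rw [max_eq_left hv.le]
    rw [max_eq_left hu.le]
    exact (hasDerivAt_pow N u).congr_of_eventuallyEq h

lemma hasDerivAt_fF (N : ℕ) (hN : 2 ≤ N) (T r : ℝ) :
    HasDerivAt (fF N T) (-(fG N T r * r)) r := by
  have h1 : HasDerivAt (fun r : ℝ => 1 - r ^ 2 / T ^ 2) (-(2 * r / T ^ 2)) r := by
    simpa using ((hasDerivAt_pow 2 r).div_const (T ^ 2)).const_sub 1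
  have h2 := (hasDerivAt_max_pow N hN (1 - r ^ 2 / T ^ 2)).comp r h1
  refine h2.congr_deriv ?_
  rw [fG]; ring

lemma hasGradientAt_fF {d : ℕ} (N : ℕ) (hN : 2 ≤ N) (T : ℝ) (x : Euc d) :
    HasGradientAt (fun x : Euc d => fF N T ‖x‖) (-(fG N T ‖x‖) • x) x := by
  rw [hasGradientAt_iff_hasFDerivAt]
  have h0 : HasFDerivAt (fun x : Euc d => 1 - ‖x‖ ^ 2 / T ^ 2)
      (-((T ^ 2)⁻¹ • (2 • (innerSL ℝ x)))) x := by
    have := ((hasStrictFDerivAt_norm_sq x).hasFDerivAt.mul_const ((T ^ 2)⁻¹)).const_sub 1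
    simpa [div_eq_mul_inv] using this
  have h2 := (hasDerivAt_max_pow N hN (1 - ‖x‖ ^ 2 / T ^ 2)).comp_hasFDerivAt x h0
  refine h2.congr_fderiv ?_
  ext v
  simp [fG]
  ring

lemma continuous_fF (N : ℕ) (T : ℝ) : Continuous (fF N T) := by
  unfold fF; fun_prop

lemma continuous_fG (N : ℕ) (T : ℝ) : Continuous (fG N T) := by
  unfold fG; fun_prop

lemma young_core {d : ℕ} (m q : ℝ) (h : m.HolderConjugate q) (w p : Euc d) :
    -⟪w, p⟫ - (1 / m) * ‖p‖ ^ m ≤ ‖w‖ ^ q / q := by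
  have h1 := Real.young_inequality_of_nonneg (norm_nonneg p) (norm_nonneg w) h
  have h2 := neg_le_of_abs_le (abs_real_inner_le_norm w p)
  have h3 : (1 / m) * ‖p‖ ^ m = ‖p‖ ^ m / m := by ring
  rw [h3]
  nlinarith

lemma E_bound {d : ℕ} (m q : ℝ) (h : m.HolderConjugate q) (F c : ℝ) (hF : 0 ≤ F)
    (g b w p : Euc d) (hw : g + F • b = F • w) :
    -⟪g + F • b, p⟫ - F * ((1 / m) * ‖p‖ ^ m) + F * c ≤ F * (‖w‖ ^ q / q + c) := by
  rw [hw, inner_smul_left]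
  have := mul_le_mul_of_nonneg_left (young_core m q h w p) hF
  simp only [conj_trivial]
  linarith

lemma fF_zero (N : ℕ) (hN : 2 ≤ N) (T r : ℝ) (hT : 0 < T) (hr : T ≤ r) : fF N T r = 0 := by
  have : 1 ≤ r ^ 2 / T ^ 2 := by
    rw [le_div_iff₀ (by positivity), one_mul]; gcongr
  rw [fF, max_eq_right (by linarith), zero_pow (by omega)]

lemma fG_zero (N : ℕ) (hN : 2 ≤ N) (T r : ℝ) (hT : 0 < T) (hr : T ≤ r) : fG N T r = 0 := by
  have : 1 ≤ r ^ 2 / T ^ 2 := by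
    rw [le_div_iff₀ (by positivity), one_mul]; gcongr
  rw [fG, max_eq_right (by linarith), zero_pow (by omega), mul_zero]

lemma fF_nonneg (N : ℕ) (T r : ℝ) : 0 ≤ fF N T r := pow_nonneg (le_max_right _ _) _

lemma fG_nonneg (N : ℕ) (T r : ℝ) : 0 ≤ fG N T r :=
  mul_nonneg (by positivity) (pow_nonneg (le_max_right _ _) _)

lemma fF_le_one (N : ℕ) (T r : ℝ) : fF N T r ≤ 1 := by
  apply pow_le_one₀ (le_max_right _ _)
  apply max_le _ zero_le_one
  have : 0 ≤ r ^ 2 / T ^ 2 := by positivity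
  linarith

lemma profile_facts (N : ℕ) (hN : 2 ≤ N) (T r : ℝ) (hT : 1 ≤ T) (hr0 : 0 ≤ r) (hr : r < T) :
    0 < fF N T r ∧ ∃ s : ℝ, 0 ≤ s ∧ fF N T r * s = fG N T r * r ∧
      fF N T r * (s ^ 2 + s ^ N) ≤ ((2 * N) ^ 2 + (2 * N) ^ N) / T ^ 2 ∧
      (r ≤ T / 2 → s ≤ 2 * N ∧ (3 / 4) ^ N ≤ fF N T r) := by
  have hT0 : 0 < T := by linarith
  obtain ⟨u, hu⟩ : ∃ u, u = 1 - r ^ 2 / T ^ 2 := ⟨_, rfl⟩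
  have hu0 : 0 < u := by
    have : r ^ 2 / T ^ 2 < 1 := by
      rw [div_lt_one (by positivity)]; gcongr
    linarith
  have hu1 : u ≤ 1 := by
    have : 0 ≤ r ^ 2 / T ^ 2 := by positivity
    linarith
  have eF : fF N T r = u ^ N := by rw [fF, ← hu, max_eq_left hu0.le]
  have eG : fG N T r = 2 * N / T ^ 2 * u ^ (N - 1) := by rw [fG, ← hu, max_eq_left hu0.le]
  have hkey : 2 * N * r / T ^ 2 ≤ 2 * N / T := by
    rw [div_le_div_iff₀ (by positivity) hT0]
    have : (2 * N * r) * T ≤ (2 * N * T) * T := by gcongr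
    nlinarith
  have hNN : u ^ N = u ^ (N - 1) * u := by
    rw [← pow_succ]; congr 1; omega
  have hpow : ∀ j, 2 ≤ j → j ≤ N → u ^ N * ((2 * N * r / T ^ 2) / u) ^ j ≤ (2 * N) ^ j / T ^ 2 := by
    intro j hj hjN
    have e : u ^ N = u ^ (N - j) * u ^ j := by rw [← pow_add]; congr 1; omega
    rw [e, div_pow, mul_assoc, mul_div_cancel₀ _ (by positivity)]
    calc u ^ (N - j) * (2 * N * r / T ^ 2) ^ j ≤ 1 * (2 * N / T) ^ j := by
          gcongr
          exact pow_le_one₀ hu0.le hu1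
      _ = (2 * N) ^ j / T ^ j := by rw [one_mul, div_pow]
      _ ≤ _ := by
          gcongr
  refine ⟨by rw [eF]; positivity, (2 * N * r / T ^ 2) / u, by positivity, ?_, ?_, ?_⟩
  · rw [eF, eG, hNN]; field_simp
  · rw [eF, mul_add, add_div]
    exact add_le_add (hpow 2 le_rfl hN) (hpow N hN le_rfl)
  · intro hr2
    have hu34 : 3 / 4 ≤ u := by
      have : r ^ 2 / T ^ 2 ≤ 1 / 4 := by
        rw [div_le_iff₀ (by positivity)]
        nlinarith
      linarith
    constructor
    · rw [div_le_iff₀ hu0]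
      have h1 : 2 * N * r / T ^ 2 ≤ N := by
        rw [div_le_iff₀ (by positivity)]
        have : (N:ℝ) * (2 * r) ≤ N * (T ^ 2) := by
          gcongr; nlinarith
        linarith
      have : (0:ℝ) ≤ N := by positivity
      nlinarith
    · rw [eF]; gcongr

/-- radial upper bound -/
def HH (n : ℝ) (N : ℕ) (R2 C0 κ C3 μ T r : ℝ) : ℝ :=
  (Set.Iio R2).indicator (fun _ => C0) r
   + (Set.Icc R2 T).indicator (fun r => κ * (n * fF N T r / r - fG N T r * r) + C3 / T ^ 2) r
   - (Set.Icc R2 (T / 2)).indicator (fun r => κ * μ * (3 / 4) ^ N / r) r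

lemma near_bound {d : ℕ} (m q : ℝ) (h : m.HolderConjugate q) (N : ℕ) (hN : 2 ≤ N)
    (n R2 B C0 κ C3 μ T c L : ℝ) (x b p : Euc d) (hx : ‖x‖ < R2) (hT : 1 ≤ T) (hR2T : 2 * R2 ≤ T)
    (hb : ‖b‖ ≤ B) (hL : 0 ≤ L) (hc : 0 ≤ c)
    (hC0 : (B + 2 * N) ^ q / q + c ≤ C0) :
    -⟪-(fG N T ‖x‖) • x + fF N T ‖x‖ • b, p⟫ - fF N T ‖x‖ * ((1 / m) * ‖p‖ ^ m)
      + fF N T ‖x‖ * (c - L) ≤ HH n N R2 C0 κ C3 μ T ‖x‖ := by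
  have hr0 := norm_nonneg x
  have hH : HH n N R2 C0 κ C3 μ T ‖x‖ = C0 := by
    simp [HH, hx, not_le.2 hx]
  rw [hH]
  obtain ⟨hF, s, hs0, hs1, -, hs2⟩ := profile_facts N hN T ‖x‖ hT hr0 (by linarith)
  obtain ⟨hs3, -⟩ := hs2 (by linarith)
  have hF1 := fF_le_one N T ‖x‖
  have hG := fG_nonneg N T ‖x‖
  set F := fF N T ‖x‖
  set G := fG N T ‖x‖
  have hq := h.symm.pos
  refine (E_bound m q h F (c - L) hF.le (-G • x) b (b - (G / F) • x) p ?_).trans ?_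
  · rw [smul_sub, smul_smul, mul_div_cancel₀ _ hF.ne', neg_smul]; abel
  · have hw : ‖b - (G / F) • x‖ ≤ B + 2 * N := by
      refine (norm_sub_le _ _).trans ?_
      refine add_le_add hb ?_
      rw [norm_smul, Real.norm_eq_abs, abs_of_nonneg (by positivity)]
      have : G / F * ‖x‖ = s := by field_simp; linarith
      linarith
    have h1 : ‖b - (G / F) • x‖ ^ q / q ≤ (B + 2 * N) ^ q / q := by
      gcongr
    have h2 : 0 ≤ (B + 2 * N) ^ q / q := by
      refine div_nonneg (Real.rpow_nonneg ?_ _) hq.le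
      exact (norm_nonneg _).trans hw
    calc F * (‖b - (G / F) • x‖ ^ q / q + (c - L)) ≤ F * C0 := by gcongr; linarith
      _ ≤ 1 * C0 := by gcongr; linarith
      _ = C0 := one_mul _

lemma far_bound {d : ℕ} (m q : ℝ) (h : m.HolderConjugate q) (N : ℕ) (hN : 2 ≤ N)
    (n ρ R2 C0 C2 μ T a k v β : ℝ) (x b p : Euc d) (hR2 : 0 < R2) (hx : R2 ≤ ‖x‖) (hT : 1 ≤ T)
    (hρ : 0 < ρ) (hv : 0 ≤ v) (hμ : 0 < μ) (hC2 : 0 ≤ C2)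
    (hb : b = ((ρ + a) * ‖x‖ ^ ((0:ℝ) - 1)) • x) (ha : |a| ≤ 1)
    (hcost : ∀ a s : ℝ, |a| ≤ 1 → 0 ≤ s →
      |ρ + a - s| ^ q / q ≤ ρ ^ q / q + ρ ^ (q - 1) * (a - s) + C2 * (a ^ 2 + s ^ 2 + s ^ N))
    (hk1 : C2 ≤ ρ ^ (q - 1) * k) (hk2 : β ≤ ρ ^ (q - 1) * k)
    (hstr : ‖x‖ * (a + k * |a| ^ 2 + k * v) ≤ n - μ) :
    -⟪-(fG N T ‖x‖) • x + fF N T ‖x‖ • b, p⟫ - fF N T ‖x‖ * ((1 / m) * ‖p‖ ^ m)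
      + fF N T ‖x‖ * (β * v - ρ ^ q / q)
      ≤ HH n N R2 C0 (ρ ^ (q - 1)) (C2 * ((2 * N) ^ 2 + (2 * N) ^ N)) μ T ‖x‖ := by
  have hT0 : 0 < T := by linarith
  have hr : 0 < ‖x‖ := by linarith
  have hκ : 0 < ρ ^ (q - 1) := Real.rpow_pos_of_pos hρ _
  rcases lt_or_ge ‖x‖ T with hxT | hxT
  · obtain ⟨hF, s, hs0, hs1, hs2, hs3⟩ := profile_facts N hN T ‖x‖ hT hr.le hxT
    have hind : (Set.Icc R2 (T / 2)).indicator (fun r => ρ ^ (q - 1) * μ * (3 / 4) ^ N / r) ‖x‖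
        ≤ ρ ^ (q - 1) * μ * fF N T ‖x‖ / ‖x‖ := by
      by_cases hx2 : ‖x‖ ≤ T / 2
      · rw [Set.indicator_of_mem (Set.mem_Icc.2 ⟨hx, hx2⟩)]
        have := (hs3 hx2).2
        gcongr
      · rw [Set.indicator_of_notMem (fun hh => hx2 hh.2)]
        positivity
    have hH : ρ ^ (q - 1) * (n * fF N T ‖x‖ / ‖x‖ - fG N T ‖x‖ * ‖x‖)
        + C2 * ((2 * N) ^ 2 + (2 * N) ^ N) / T ^ 2 - ρ ^ (q - 1) * μ * fF N T ‖x‖ / ‖x‖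
        ≤ HH n N R2 C0 (ρ ^ (q - 1)) (C2 * ((2 * N) ^ 2 + (2 * N) ^ N)) μ T ‖x‖ := by
      rw [HH, Set.indicator_of_notMem (by simpa using hx), Set.indicator_of_mem (Set.mem_Icc.2 ⟨hx, hxT.le⟩)]
      linarith
    refine le_trans ?_ hH
    set F := fF N T ‖x‖
    set G := fG N T ‖x‖
    set κ := ρ ^ (q - 1)
    refine (E_bound m q h F _ hF.le (-G • x) b (((ρ + a - s) / ‖x‖) • x) p ?_).trans ?_
    · rw [hb, smul_smul, smul_smul, ← add_smul]
      congr 1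
      rw [zero_sub, Real.rpow_neg_one]
      have : G = F * s / ‖x‖ := by field_simp; linarith
      rw [this]; field_simp; ring
    · have hw : ‖((ρ + a - s) / ‖x‖) • x‖ = |ρ + a - s| := by
        rw [norm_smul, Real.norm_eq_abs, abs_div, abs_norm, div_mul_cancel₀ _ hr.ne']
      rw [hw]
      have h1 := hcost a s ha hs0
      have h2 : a + k * a ^ 2 + k * v ≤ (n - μ) / ‖x‖ := by
        rw [le_div_iff₀ hr, ← sq_abs a]; linarith
      have h3 : C2 * a ^ 2 ≤ κ * k * a ^ 2 := by gcongr
      have h4 : β * v ≤ κ * k * v := by gcongr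
      have h5 : κ * (a + k * a ^ 2 + k * v) ≤ κ * ((n - μ) / ‖x‖) := by gcongr
      have h6 : |ρ + a - s| ^ q / q + (β * v - ρ ^ q / q)
          ≤ κ * ((n - μ) / ‖x‖ - s) + C2 * (s ^ 2 + s ^ N) := by
        nlinarith
      have h7 : C2 * (F * (s ^ 2 + s ^ N)) ≤ C2 * (((2 * N) ^ 2 + (2 * N) ^ N) / T ^ 2) := by
        gcongr
      calc F * (|ρ + a - s| ^ q / q + (β * v - ρ ^ q / q))
          ≤ F * (κ * ((n - μ) / ‖x‖ - s) + C2 * (s ^ 2 + s ^ N)) := by gcongr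
        _ = κ * (n * F / ‖x‖ - F * s) + C2 * (F * (s ^ 2 + s ^ N)) - κ * μ * F / ‖x‖ := by ring
        _ ≤ _ := by
          rw [hs1, mul_div_assoc C2]
          linarith
  · have hF := fF_zero N hN T ‖x‖ hT0 hxT
    have hG := fG_zero N hN T ‖x‖ hT0 hxT
    have : 0 ≤ HH n N R2 C0 (ρ ^ (q - 1)) (C2 * ((2 * N) ^ 2 + (2 * N) ^ N)) μ T ‖x‖ := by
      rw [HH, Set.indicator_of_notMem (by simpa using hx),
        Set.indicator_of_notMem (s := Set.Icc R2 (T / 2)) (fun hh => by have := hh.2; linarith)]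
      rw [zero_add, sub_zero]
      apply Set.indicator_apply_nonneg
      intro _
      rw [hF, hG]
      simp only [mul_zero, zero_div, zero_mul, sub_zero, zero_add]
      positivity
    rw [hF, hG]
    simpa using this

lemma ibp {d : ℕ} (f φ : Euc d → ℝ) (g : Euc d → Euc d) (hf : ∀ x, HasGradientAt f (g x) x)
    (hg : Continuous g) (hfc : Continuous f) (hcf : HasCompactSupport f) (hcg : HasCompactSupport g)
    (hφ : ContDiff ℝ 3 φ) :
    MeasureTheory.Integrable (fun x => f x * lap φ x + ⟪g x, gradient φ x⟫) ∧
    ∫ x, (f x * lap φ x + ⟪g x, gradient φ x⟫) = 0 := by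
  let e : Fin d → Euc d := fun i => EuclideanSpace.single i (1:ℝ)
  have hD : ∀ i, ContDiff ℝ 2 (fun y => fderiv ℝ φ y (e i)) := fun i =>
    (hφ.fderiv_right (m := 2) (by norm_num)).clm_apply contDiff_const
  have hDc : ∀ i, Continuous (fun y => fderiv ℝ φ y (e i)) := fun i => (hD i).continuous
  have hDD : ∀ i, Continuous (fun y => fderiv ℝ (fun y => fderiv ℝ φ y (e i)) y (e i)) := fun i =>
    ((hD i).continuous_fderiv (by norm_num)).clm_apply continuous_const
  have hfd : ∀ x v, fderiv ℝ f x v = ⟪g x, v⟫ := by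
    intro x v
    rw [(hf x).hasFDerivAt.fderiv]; simp
  have hgi : ∀ i, HasCompactSupport (fun x => ⟪g x, e i⟫) := fun i =>
    hcg.comp_left (g := fun v => ⟪v, e i⟫) (by simp)
  have i1 : ∀ i, MeasureTheory.Integrable (fun x => f x * fderiv ℝ (fun y => fderiv ℝ φ y (e i)) x (e i)) :=
    fun i => (hfc.mul (hDD i)).integrable_of_hasCompactSupport hcf.mul_right
  have i2 : ∀ i, MeasureTheory.Integrable (fun x => ⟪g x, e i⟫ * fderiv ℝ φ x (e i)) :=
    fun i => ((hg.inner continuous_const).mul (hDc i)).integrable_of_hasCompactSupport (hgi i).mul_right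
  have i3 : ∀ i, MeasureTheory.Integrable (fun x => f x * fderiv ℝ φ x (e i)) :=
    fun i => (hfc.mul (hDc i)).integrable_of_hasCompactSupport hcf.mul_right
  have hz : ∀ i, ∫ x, (f x * fderiv ℝ (fun y => fderiv ℝ φ y (e i)) x (e i)
      + ⟪g x, e i⟫ * fderiv ℝ φ x (e i)) = 0 := by
    intro i
    rw [MeasureTheory.integral_add (i1 i) (i2 i)]
    have := integral_mul_fderiv_eq_neg_fderiv_mul_of_integrable (μ := MeasureTheory.volume)
      (f := f) (g := fun y => fderiv ℝ φ y (e i)) (v := e i) (by simpa only [hfd] using i2 i) (i1 i) (i3 i)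
      (fun x _ => (hf x).differentiableAt) (fun x _ => (hD i).differentiable (by norm_num) x)
    rw [this]; simp only [hfd]; ring
  have heq : (fun x => f x * lap φ x + ⟪g x, gradient φ x⟫) = fun x =>
      ∑ i, (f x * fderiv ℝ (fun y => fderiv ℝ φ y (e i)) x (e i)
      + ⟪g x, e i⟫ * fderiv ℝ φ x (e i)) := by
    funext x
    rw [Finset.sum_add_distrib, ← Finset.mul_sum]
    congr 1
    rw [← OrthonormalBasis.sum_inner_mul_inner (EuclideanSpace.basisFun (Fin d) ℝ)]
    refine Finset.sum_congr rfl fun i _ => ?_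
    rw [EuclideanSpace.basisFun_apply, real_inner_comm (gradient φ x), gradient,
      InnerProductSpace.toDual_symm_apply]
  rw [heq]
  refine ⟨MeasureTheory.integrable_finsetSum _ fun i _ => (i1 i).add (i2 i), ?_⟩
  refine (MeasureTheory.integral_finsetSum _ fun i _ => (i1 i).add (i2 i)).trans ?_
  exact Finset.sum_eq_zero fun i _ => hz i

open MeasureTheory in
lemma HH_integral (n N : ℕ) (hN : 2 ≤ N) (R2 C0 κ C3 μ T : ℝ) (hR2 : 0 < R2) (hT : 1 ≤ T)
    (hRT : 2 * R2 ≤ T) (hκ : 0 < κ) (hC0 : 0 ≤ C0) (hC3 : 0 ≤ C3) :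
    IntegrableOn (fun y : ℝ => y ^ n • HH n N R2 C0 κ C3 μ T y) (Set.Ioi 0) ∧
    ∫ y in Set.Ioi (0:ℝ), y ^ n • HH n N R2 C0 κ C3 μ T y ≤
      C0 * R2 ^ n * R2 + C3 * (T ^ n / T)
        - κ * μ * (3 / 4) ^ N * ∫ y in R2..(T / 2), y ^ n / y := by
  have hT0 : 0 < T := by linarith
  have hRT' : R2 ≤ T := by linarith
  have hRT2 : R2 ≤ T / 2 := by linarith
  let h1 : ℝ → ℝ := fun y => C0 * y ^ n
  let h2 : ℝ → ℝ := fun y => κ * (n * y ^ (n - 1) * fF N T y + y ^ n * (-(fG N T y * y))) + C3 / T ^ 2 * y ^ n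
  let h3 : ℝ → ℝ := fun y => κ * μ * (3 / 4) ^ N * (y ^ n / y)
  have hcF := continuous_fF N T
  have hcG := continuous_fG N T
  have c1 : Continuous h1 := by fun_prop
  have c2 : Continuous h2 := by fun_prop
  have c3 : ContinuousOn h3 (Set.Icc R2 (T / 2)) := by
    have : ∀ y ∈ Set.Icc R2 (T / 2), y ≠ 0 := fun y hy => (lt_of_lt_of_le hR2 hy.1).ne'
    fun_prop (disch := assumption)
  have heq : Set.EqOn (fun y : ℝ => y ^ n • HH n N R2 C0 κ C3 μ T y)
      (fun y => (Set.Iio R2).indicator h1 y + (Set.Icc R2 T).indicator h2 y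
        - (Set.Icc R2 (T / 2)).indicator h3 y) (Set.Ioi 0) := by
    intro y hy
    have hy0 : (0:ℝ) < y := hy
    have e1 : y ^ n * (Set.Iio R2).indicator (fun _ => C0) y = (Set.Iio R2).indicator h1 y := by
      by_cases h : y ∈ Set.Iio R2
      · rw [Set.indicator_of_mem h, Set.indicator_of_mem h]; simp only [h1]; ring
      · rw [Set.indicator_of_notMem h, Set.indicator_of_notMem h, mul_zero]
    have e2 : y ^ n * (Set.Icc R2 T).indicator (fun r => κ * (n * fF N T r / r - fG N T r * r) + C3 / T ^ 2) y
        = (Set.Icc R2 T).indicator h2 y := by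
      by_cases h : y ∈ Set.Icc R2 T
      · rw [Set.indicator_of_mem h, Set.indicator_of_mem h]
        have : y ^ n * (n * fF N T y / y) = n * y ^ (n - 1) * fF N T y := by
          rcases n with _ | k
          · simp
          · simp only [Nat.add_sub_cancel]; rw [pow_succ]; field_simp
        simp only [h2]
        rw [← this]; ring
      · rw [Set.indicator_of_notMem h, Set.indicator_of_notMem h, mul_zero]
    have e3 : y ^ n * (Set.Icc R2 (T / 2)).indicator (fun r => κ * μ * (3 / 4) ^ N / r) y
        = (Set.Icc R2 (T / 2)).indicator h3 y := by
      by_cases h : y ∈ Set.Icc R2 (T / 2)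
      · rw [Set.indicator_of_mem h, Set.indicator_of_mem h]; simp only [h3]; ring
      · rw [Set.indicator_of_notMem h, Set.indicator_of_notMem h, mul_zero]
    simp only [smul_eq_mul, HH]
    rw [mul_sub, mul_add, e1, e2, e3]
  have s1 : Set.Ioi (0:ℝ) ∩ Set.Iio R2 = Set.Ioo 0 R2 := rfl
  have s2 : ∀ S : ℝ, Set.Ioi (0:ℝ) ∩ Set.Icc R2 S = Set.Icc R2 S := fun S =>
    Set.inter_eq_right.2 fun y hy => lt_of_lt_of_le hR2 hy.1
  have i1 : IntegrableOn ((Set.Iio R2).indicator h1) (Set.Ioi 0) := by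
    rw [IntegrableOn, integrable_indicator_iff measurableSet_Iio, IntegrableOn,
      Measure.restrict_restrict measurableSet_Iio, Set.inter_comm, s1]
    exact (c1.integrableOn_Icc).mono_set Set.Ioo_subset_Icc_self
  have i2 : IntegrableOn ((Set.Icc R2 T).indicator h2) (Set.Ioi 0) := by
    rw [IntegrableOn, integrable_indicator_iff measurableSet_Icc, IntegrableOn,
      Measure.restrict_restrict measurableSet_Icc, Set.inter_comm, s2]
    exact c2.integrableOn_Icc
  have i3 : IntegrableOn ((Set.Icc R2 (T / 2)).indicator h3) (Set.Ioi 0) := by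
    rw [IntegrableOn, integrable_indicator_iff measurableSet_Icc, IntegrableOn,
      Measure.restrict_restrict measurableSet_Icc, Set.inter_comm, s2]
    exact c3.integrableOn_Icc
  refine ⟨((i1.add i2).sub i3).congr_fun heq.symm measurableSet_Ioi, ?_⟩
  rw [setIntegral_congr_fun measurableSet_Ioi heq]
  have t1 : ∫ y in Set.Ioi (0:ℝ), (Set.Iio R2).indicator h1 y ≤ C0 * R2 ^ n * R2 := by
    rw [setIntegral_indicator measurableSet_Iio, s1, ← integral_Ioc_eq_integral_Ioo,
      ← intervalIntegral.integral_of_le hR2.le]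
    calc ∫ y in (0:ℝ)..R2, h1 y ≤ ∫ y in (0:ℝ)..R2, C0 * R2 ^ n := by
          apply intervalIntegral.integral_mono_on hR2.le (c1.intervalIntegrable _ _)
            (continuous_const.intervalIntegrable _ _)
          intro y hy
          have := hy.1
          have := hy.2
          simp only [h1]; gcongr
      _ = _ := by simp; ring
  have t2 : ∫ y in Set.Ioi (0:ℝ), (Set.Icc R2 T).indicator h2 y ≤ C3 * (T ^ n / T) := by
    rw [setIntegral_indicator measurableSet_Icc, s2, integral_Icc_eq_integral_Ioc,
      ← intervalIntegral.integral_of_le hRT']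
    have d1 : ∀ y : ℝ, HasDerivAt (fun y => y ^ n * fF N T y)
        (n * y ^ (n - 1) * fF N T y + y ^ n * (-(fG N T y * y))) y := fun y =>
      (hasDerivAt_pow n y).mul (hasDerivAt_fF N hN T y)
    have f1 : ∫ y in R2..T, (n * y ^ (n - 1) * fF N T y + y ^ n * (-(fG N T y * y))) =
        T ^ n * fF N T T - R2 ^ n * fF N T R2 :=
      intervalIntegral.integral_eq_sub_of_hasDerivAt (fun y _ => d1 y)
        (Continuous.intervalIntegrable (by fun_prop) _ _)
    have f2 : ∫ y in R2..T, y ^ n ≤ T ^ n * T := by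
      calc ∫ y in R2..T, y ^ n ≤ ∫ y in R2..T, T ^ n := by
            apply intervalIntegral.integral_mono_on hRT' (Continuous.intervalIntegrable (by fun_prop) _ _)
              (continuous_const.intervalIntegrable _ _)
            intro y hy
            have := hR2.le.trans hy.1
            have := hy.2
            gcongr
        _ = (T - R2) * T ^ n := by simp
        _ ≤ T ^ n * T := by
            have : 0 < T ^ n := by positivity
            nlinarith
    simp only [h2]
    rw [intervalIntegral.integral_add (Continuous.intervalIntegrable (by fun_prop) _ _)
      (Continuous.intervalIntegrable (by fun_prop) _ _), intervalIntegral.integral_const_mul,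
      intervalIntegral.integral_const_mul, f1, fF_zero N hN T T hT0 le_rfl]
    have g1 : 0 ≤ κ * (R2 ^ n * fF N T R2) := by
      have := fF_nonneg N T R2
      positivity
    have g2 : C3 / T ^ 2 * ∫ y in R2..T, y ^ n ≤ C3 / T ^ 2 * (T ^ n * T) := by gcongr
    have g3 : C3 / T ^ 2 * (T ^ n * T) = C3 * (T ^ n / T) := by field_simp
    linarith
  have t3 : ∫ y in Set.Ioi (0:ℝ), (Set.Icc R2 (T / 2)).indicator h3 y
      = κ * μ * (3 / 4) ^ N * ∫ y in R2..(T / 2), y ^ n / y := by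
    rw [setIntegral_indicator measurableSet_Icc, s2, integral_Icc_eq_integral_Ioc,
      ← intervalIntegral.integral_of_le hRT2]
    simp only [h3]
    rw [intervalIntegral.integral_const_mul]
  have hsum : ∫ y in Set.Ioi (0:ℝ), ((Set.Iio R2).indicator h1 y + (Set.Icc R2 T).indicator h2 y
        - (Set.Icc R2 (T / 2)).indicator h3 y) =
      (∫ y in Set.Ioi (0:ℝ), (Set.Iio R2).indicator h1 y)
      + (∫ y in Set.Ioi (0:ℝ), (Set.Icc R2 T).indicator h2 y)
      - ∫ y in Set.Ioi (0:ℝ), (Set.Icc R2 (T / 2)).indicator h3 y := by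
    refine (integral_sub (i1.add i2) i3).trans ?_
    congr 1
    exact integral_add i1 i2
  refine hsum.le.trans ?_
  rw [t3]
  linarith

lemma asymp (n : ℕ) (R2 A B c T0 : ℝ) (hR2 : 0 < R2) (hA : 0 ≤ A) (hB : 0 ≤ B) (hc : 0 < c) :
    ∃ T : ℝ, T0 ≤ T ∧ 1 ≤ T ∧ 2 * R2 ≤ T ∧
      A + B * (T ^ n / T) < c * ∫ y in R2..(T / 2), y ^ n / y := by
  rcases n with _ | k
  · have h1 : Tendsto (fun T : ℝ => c * Real.log (T / 2 / R2)) atTop atTop := by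
      apply Tendsto.const_mul_atTop hc
      apply Real.tendsto_log_atTop.comp
      exact (tendsto_id.atTop_div_const (by norm_num)).atTop_div_const hR2
    obtain ⟨T, h, hT0, hT1, hT2⟩ := ((h1.eventually_gt_atTop (A + B)).and
      ((eventually_ge_atTop T0).and ((eventually_ge_atTop 1).and (eventually_ge_atTop (2 * R2))))).exists
    refine ⟨T, hT0, hT1, hT2, ?_⟩
    have : ∫ y in R2..(T / 2), y ^ 0 / y = Real.log (T / 2 / R2) := by
      simp only [pow_zero]
      rw [integral_one_div_of_pos hR2 (by linarith)]
    rw [this]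
    refine lt_of_le_of_lt ?_ h
    have : B * (T ^ 0 / T) ≤ B * 1 := by
      gcongr
      rw [pow_zero, div_le_one (by linarith)]; exact hT1
    linarith
  · set a := c / (2 ^ (k + 1) * (k + 1)) with ha
    have ha0 : 0 < a := by positivity
    set D := A + c * R2 ^ (k + 1) / (k + 1) + 1 with hD
    have hD0 : 0 < D := by positivity
    refine ⟨max (max T0 1) (max (2 * R2) ((D + B) / a)), ?_⟩
    set T := max (max T0 1) (max (2 * R2) ((D + B) / a)) with hT
    have hT0 : T0 ≤ T := (le_max_left _ _).trans (le_max_left _ _)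
    have hT1 : 1 ≤ T := (le_max_right _ _).trans (le_max_left _ _)
    have hT2 : 2 * R2 ≤ T := (le_max_left _ _).trans (le_max_right _ _)
    have hT3 : (D + B) / a ≤ T := (le_max_right _ _).trans (le_max_right _ _)
    clear_value T
    refine ⟨hT0, hT1, hT2, ?_⟩
    have e : ∫ y in R2..(T / 2), y ^ (k + 1) / y = ((T / 2) ^ (k + 1) - R2 ^ (k + 1)) / (k + 1) := by
      rw [← integral_pow]
      apply intervalIntegral.integral_congr
      intro y hy
      rw [Set.uIcc_of_le (by linarith)] at hy
      have : 0 < y := lt_of_lt_of_le hR2 hy.1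
      simp only [pow_succ]; field_simp
    rw [e]
    have e2 : T ^ (k + 1) / T = T ^ k := by rw [pow_succ]; field_simp
    have e3 : c * (((T / 2) ^ (k + 1) - R2 ^ (k + 1)) / (k + 1))
        = T ^ k * (a * T) - c * R2 ^ (k + 1) / (k + 1) := by
      rw [ha, div_pow, pow_succ T]; field_simp
    rw [e2, e3]
    rw [div_le_iff₀ ha0] at hT3
    have h1 : 1 ≤ T ^ k := one_le_pow₀ hT1
    have h2 : T ^ k * (D + B) ≤ T ^ k * (a * T) := by gcongr; linarith
    have h3 : D ≤ T ^ k * D := by nlinarith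
    nlinarith

/-- strict upper bound `λ_max(β) < ρ^{m*}/m*` under the structure condition (4.2). -/
theorem stmt9 (d : ℕ) (hd : 1 ≤ d) (m ρ R : ℝ) (hm : 1 < m)
    (hρ : 0 < ρ) (hR : 0 < R)
    (mst : ℝ) (hmst : mst = m / (m - 1))
    (b : Euc d → Euc d) (V : Euc d → ℝ) (α : Euc d → ℝ)
    (hH0 : HypH0 0 ρ R b V α)
    (hstr : ∀ k : ℝ, 0 < k → ∃ μ : ℝ, 0 < μ ∧ ∃ R₂ : ℝ, R ≤ R₂ ∧
      ∀ x : Euc d, R₂ ≤ ‖x‖ → ‖x‖ * (α x + k * |α x| ^ 2 + k * V x) ≤ (d : ℝ) - 1 - μ) :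
    ∀ β : ℝ, 0 ≤ β → lamMax m b V β < ρ ^ mst / mst := by
  intro β hβ
  obtain ⟨n, rfl⟩ : ∃ n, d = n + 1 := ⟨d - 1, by omega⟩
  obtain ⟨hb, hV, -, hα, hbf, hα0, hV0, -, -⟩ := hH0
  have hconj : m.HolderConjugate mst := by
    rw [hmst]; exact Real.HolderConjugate.conjExponent hm
  have hq1 : 1 < mst := hconj.symm.lt
  have hq0 : 0 < mst := hconj.symm.pos
  set q := mst with hq
  set N : ℕ := max 2 ⌈q⌉₊ with hNdef
  have hN2 : 2 ≤ N := le_max_left _ _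
  have hNq : q ≤ N := (Nat.le_ceil q).trans (by exact_mod_cast le_max_right _ _)
  clear_value N
  obtain ⟨C2, hC2, hcost⟩ := cost_bound ρ q N hρ hq1 hNq hN2
  set κ := ρ ^ (q - 1) with hκdef
  have hκ : 0 < κ := Real.rpow_pos_of_pos hρ _
  obtain ⟨μ, hμ, R₂, hRR₂, hstr'⟩ := hstr ((C2 + β + 1) / κ) (by positivity)
  have hkk : κ * ((C2 + β + 1) / κ) = C2 + β + 1 := mul_div_cancel₀ _ hκ.ne'
  obtain ⟨R₃, hR₃⟩ : ∃ R₃ : ℝ, ∀ x : Euc (n + 1), R₃ ≤ ‖x‖ → |α x| ≤ 1 := by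
    have h1 : ∀ᶠ x in cocompact (Euc (n + 1)), |α x| ≤ 1 := by
      have := hα0.eventually (Metric.ball_mem_nhds (0:ℝ) one_pos)
      filter_upwards [this] with x hx
      simpa using (show |α x| < 1 by simpa using hx).le
    rw [← Metric.cobounded_eq_cocompact, ← comap_norm_atTop, eventually_comap] at h1
    obtain ⟨R₃, h⟩ := eventually_atTop.1 h1
    exact ⟨R₃, fun x hx => h ‖x‖ hx x rfl⟩
  set R2 := max R₂ R₃ with hR2def
  have hR2 : 0 < R2 := lt_of_lt_of_le (hR.trans_le hRR₂) (le_max_left _ _)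
  obtain ⟨B, hB⟩ := (isCompact_closedBall (0 : Euc (n + 1)) R2).exists_bound_of_continuousOn
    hb.continuous.continuousOn
  obtain ⟨W, hW⟩ := (isCompact_closedBall (0 : Euc (n + 1)) R2).exists_bound_of_continuousOn
    hV.continuous.continuousOn
  have hB0 : 0 ≤ B := (norm_nonneg _).trans (hB 0 (by simp [hR2.le]))
  have hW0 : 0 ≤ W := (norm_nonneg _).trans (hW 0 (by simp [hR2.le]))
  set C0 := (B + 2 * N) ^ q / q + β * W with hC0
  have hC00 : 0 ≤ C0 := by positivity
  set C3 := C2 * ((2 * N) ^ 2 + (2 * N) ^ N : ℝ) with hC3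
  have hC30 : 0 ≤ C3 := by positivity
  obtain ⟨T, -, hT1, hT2, hTneg⟩ := asymp n R2 (C0 * R2 ^ n * R2) C3 (κ * μ * (3 / 4) ^ N) 1
    hR2 (by positivity) hC30 (by positivity)
  have hT0 : 0 < T := by linarith
  obtain ⟨hHint, hHneg⟩ := HH_integral n N hN2 R2 C0 κ C3 μ T hR2 hT1 hT2 hκ hC00 hC30
  have hJint : MeasureTheory.Integrable (fun x : Euc (n + 1) => HH n N R2 C0 κ C3 μ T ‖x‖) := by
    rw [MeasureTheory.integrable_fun_norm_addHaar]
    simpa using hHint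
  have hJ : ∫ x : Euc (n + 1), HH n N R2 C0 κ C3 μ T ‖x‖ < 0 := by
    rw [MeasureTheory.integral_fun_norm_addHaar]
    have hvol : 0 < MeasureTheory.volume.real (Metric.ball (0 : Euc (n + 1)) 1) :=
      ENNReal.toReal_pos (Metric.measure_ball_pos _ _ one_pos).ne' MeasureTheory.measure_ball_lt_top.ne
    simp only [finrank_euclideanSpace, Fintype.card_fin, Nat.add_sub_cancel, nsmul_eq_mul, smul_eq_mul]
      at hHneg ⊢
    have hneg : ∫ y in Set.Ioi (0:ℝ), y ^ n * HH n N R2 C0 κ C3 μ T y < 0 := by linarith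
    have : (0:ℝ) < ((n + 1 : ℕ) : ℝ) := by positivity
    exact mul_neg_of_pos_of_neg this (mul_neg_of_pos_of_neg hvol hneg)
  have hfc : Continuous (fun x : Euc (n + 1) => fF N T ‖x‖) := (continuous_fF N T).comp continuous_norm
  have hgc : Continuous (fun x : Euc (n + 1) => -(fG N T ‖x‖) • x) :=
    ((continuous_fG N T).comp continuous_norm).neg.smul continuous_id
  have hcf : HasCompactSupport (fun x : Euc (n + 1) => fF N T ‖x‖) :=
    HasCompactSupport.intro (isCompact_closedBall 0 T) fun x hx => by
      apply fF_zero N hN2 T _ hT0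
      simp only [Metric.mem_closedBall, dist_zero_right, not_le] at hx
      exact hx.le
  have hcg : HasCompactSupport (fun x : Euc (n + 1) => -(fG N T ‖x‖) • x) :=
    HasCompactSupport.intro (isCompact_closedBall 0 T) fun x hx => by
      simp only [Metric.mem_closedBall, dist_zero_right, not_le] at hx
      rw [fG_zero N hN2 T _ hT0 hx.le]; simp
  have hFint : MeasureTheory.Integrable (fun x : Euc (n + 1) => fF N T ‖x‖) :=
    hfc.integrable_of_hasCompactSupport hcf
  have hZ : 0 < ∫ x : Euc (n + 1), fF N T ‖x‖ := by
    apply hfc.integral_pos_of_hasCompactSupport_nonneg_nonzero hcf (x := 0)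
    · intro x; exact fF_nonneg _ _ _
    · simp [fF]
  set Z := ∫ x : Euc (n + 1), fF N T ‖x‖
  set J := ∫ x : Euc (n + 1), HH n N R2 C0 κ C3 μ T ‖x‖
  have hL : 0 < ρ ^ q / q := div_pos (Real.rpow_pos_of_pos hρ _) hq0
  have hmain : ∀ lam φ, IsSubsol m b V β lam φ → lam ≤ ρ ^ q / q + J / Z := by
    rintro lam φ ⟨hφ, hsub⟩
    obtain ⟨hI, hI0⟩ := ibp (fun x : Euc (n + 1) => fF N T ‖x‖) φ (fun x => -(fG N T ‖x‖) • x)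
      (fun x => hasGradientAt_fF N hN2 T x) hgc hfc hcf hcg hφ
    have hpt : ∀ x : Euc (n + 1), (lam - ρ ^ q / q) * fF N T ‖x‖ ≤
        (fF N T ‖x‖ * lap φ x + ⟪-(fG N T ‖x‖) • x, gradient φ x⟫) + HH n N R2 C0 κ C3 μ T ‖x‖ := by
      intro x
      have hx := mul_le_mul_of_nonneg_left (hsub x) (fF_nonneg N T ‖x‖)
      have hE : -⟪-(fG N T ‖x‖) • x + fF N T ‖x‖ • b x, gradient φ x⟫
          - fF N T ‖x‖ * ((1 / m) * ‖gradient φ x‖ ^ m)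
          + fF N T ‖x‖ * (β * V x - ρ ^ q / q) ≤ HH n N R2 C0 κ C3 μ T ‖x‖ := by
        rcases lt_or_ge ‖x‖ R2 with hxR | hxR
        · have hmem : x ∈ Metric.closedBall (0 : Euc (n + 1)) R2 := by simpa using hxR.le
          have hVx : V x ≤ W := (le_abs_self _).trans (hW x hmem)
          refine near_bound m q hconj N hN2 n R2 B C0 κ C3 μ T (β * V x) _ x (b x) (gradient φ x) hxR hT1 hT2
            (hB x hmem) hL.le (mul_nonneg hβ (hV0 x)) ?_
          rw [hC0]; gcongr
        · have hxR₂ : R₂ ≤ ‖x‖ := (le_max_left _ _).trans hxR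
          refine far_bound m q hconj N hN2 n ρ R2 C0 C2 μ T (α x) ((C2 + β + 1) / κ) (V x) β x (b x)
            (gradient φ x) hR2 hxR hT1 hρ (hV0 x) hμ hC2 (hbf x (hRR₂.trans hxR₂))
            (hR₃ x ((le_max_right _ _).trans hxR)) hcost ?_ ?_ ?_
          · rw [hkk]; linarith
          · rw [hkk]; linarith
          · have := hstr' x hxR₂
            push_cast at this
            linarith
      rw [inner_add_left, inner_smul_left (b x)] at hE
      simp only [conj_trivial] at hE
      linarith
    have hint := MeasureTheory.integral_mono (hFint.const_mul (lam - ρ ^ q / q)) (hI.add hJint) hpt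
    rw [MeasureTheory.integral_const_mul] at hint
    have hs := MeasureTheory.integral_add hI hJint
    rw [hI0, zero_add] at hs
    have hfin : (lam - ρ ^ q / q) * Z ≤ J := hint.trans hs.le
    have := (le_div_iff₀ hZ).2 hfin
    linarith
  have hJZ : J / Z < 0 := div_neg_of_neg_of_pos hJ hZ
  unfold lamMax
  rcases Set.eq_empty_or_nonempty {lam : ℝ | ∃ φ : Euc (n + 1) → ℝ, IsSubsol m b V β lam φ} with he | hne
  · rw [he, Real.sSup_empty]; exact hL
  · refine lt_of_le_of_lt (csSup_le hne ?_) (show ρ ^ q / q + J / Z < ρ ^ q / q by linarith)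
    rintro lam ⟨φ, h⟩
    exact hmain lam φ h

end
end
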